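/- Let H_< = {(x,y) ∈ ℝ² | x < y}, the set of strict intervals of ℝ, with the relation ⪯ that is the reflexive closure of ≺ restricted to H_< (so the Allen relation equals ∪ overlaps ∪ meets ∪ before). The set of formulas of the basic temporal language that are valid on the frame (H_<, ⪯) is decidable: there exists a computable total function from formulas to Bool that returns true exactly on the valid formulas. -/

import Mathlib

/-- Formulas of the basic temporal language. -/
inductive Formula : Type
  | var : ℕ → Formula
  | neg : Formula → Formula
  | or : Formula → Formula → Formula
  | F : Formula → Formula
  | P : Formula → Formula

/-- Satisfaction of a formula at a world, given a frame `(W, R)` and valuation `v`. -/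
def Sat {W : Type} (R : W → W → Prop) (v : ℕ → Set W) : W → Formula → Prop
  | w, Formula.var n => w ∈ v n
  | w, Formula.neg φ => ¬ Sat R v w φ
  | w, Formula.or φ ψ => Sat R v w φ ∨ Sat R v w ψ
  | w, Formula.F φ => ∃ u, R w u ∧ Sat R v u φ
  | w, Formula.P φ => ∃ u, R u w ∧ Sat R v u φ

/-- Validity of a formula on a frame. -/
def Valid {W : Type} (R : W → W → Prop) (φ : Formula) : Prop :=
  ∀ (v : ℕ → Set W) (w : W), Sat R v w φ

/-- The irreflexive slower-than-light relation on ℝ². -/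
def slt (a b : ℝ × ℝ) : Prop := a.1 < b.1 ∧ a.2 < b.2

/-- An injective encoding of formulas as natural numbers. -/
def Formula.enc : Formula → ℕ
  | Formula.var n => Nat.pair 0 n
  | Formula.neg φ => Nat.pair 1 φ.enc
  | Formula.or φ ψ => Nat.pair 2 (Nat.pair φ.enc ψ.enc)
  | Formula.F φ => Nat.pair 3 φ.enc
  | Formula.P φ => Nat.pair 4 φ.enc

/-- The open half-plane `H_< = {(x, y) ∈ ℝ² | x < y}` of strict intervals of ℝ. -/
def HalfPlane : Type := {p : ℝ × ℝ // p.1 < p.2}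

/-- The reflexive closure of `≺` restricted to `H_<`: the Allen relation
`equals ∪ overlaps ∪ meets ∪ before`. -/
def sltHRefl (a b : HalfPlane) : Prop := a = b ∨ slt a.val b.val


namespace HP

inductive J (I : Type) : Type
  | lo | hi | nf (i : I) | ff (i : I) | np (i : I) | fp (i : I)

inductive K (I : Type) : Type
  | fo (i : I) | fv (i : I) | po (i : I) | pv (i : I)

def J.dual {I : Type} : J I → J I
  | .lo => .hi | .hi => .lo | .nf i => .fp i | .fp i => .nf i | .ff i => .np i | .np i => .ff i

def K.dual {I : Type} : K I → K I
  | .fo i => .po i | .po i => .fo i | .fv i => .pv i | .pv i => .fv i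

open J K

section
variable {I α : Type}

def setFar (A : J I → α) (L : K I → α) : J I → α
  | .ff i => L (fv i) | .fp i => L (po i) | .lo => A .lo | .hi => A .hi
  | .nf i => A (.nf i) | .np i => A (.np i)

def setNear (A : J I → α) (L : K I → α) : J I → α
  | .nf i => L (fo i) | .np i => L (pv i) | .lo => A .lo | .hi => A .hi
  | .ff i => A (.ff i) | .fp i => A (.fp i)

variable [LinearOrder α]

def ch1 (C : Bool → J I → α) (d : Bool) (z : α) (L : K I → α) (a : Bool) (j : J I) : α :=
  if a = d then min (C a j) z else setFar (C a) L j

def ch2 (C : Bool → J I → α) (d : Bool) (z : α) (L : K I → α) (a : Bool) (j : J I) : α :=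
  if a = d then max (C a j) z else setNear (C a) L j

def tri1 (A : J I → α) (z : α) (Lh : K I → α) : J I → α := setFar (fun j => min (A j) z) Lh
def tri2 (A : J I → α) (z : α) (Lv : K I → α) : J I → α := setNear (fun j => max (A j) z) Lv
def triR (A : J I → α) (z : α) (Lh Lv : K I → α) (a : Bool) : J I → α :=
  if a then setFar (fun j => max (A j) z) Lv else setNear (fun j => min (A j) z) Lh

structure Cst (C : Bool → J I → α) : Prop where
  lh : ∀ a, C a lo < C a hi
  cl : ∀ a j, C a lo ≤ C a j
  cu : ∀ a j, C a j ≤ C a hi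
  fn : ∀ a i, C a (ff i) ≤ C a (nf i)
  pn : ∀ a i, C a (fp i) ≤ C a (np i)
  c1F : ∀ a i, C a lo < C a (ff i) → C (!a) (nf i) = C (!a) hi
  c1P : ∀ a i, C a (np i) < C a hi → C (!a) (fp i) = C (!a) lo
  c0F : ∀ a i, C a lo < C a (nf i) → C (!a) lo < C (!a) (nf i)
  c0P : ∀ a i, C a (fp i) < C a hi → C (!a) (fp i) < C (!a) hi

structure TCst (A : J I → α) : Prop where
  lh : A lo < A hi
  cl : ∀ j, A lo ≤ A j
  cu : ∀ j, A j ≤ A hi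
  t1F : ∀ i, A lo < A (ff i) → A (nf i) = A hi
  t1P : ∀ i, A (np i) < A hi → A (fp i) = A lo

def kBot (C : Bool → J I → α) : Set I := {i | ∀ a, C a lo < C a (nf i)}
def kTop (C : Bool → J I → α) : Set I := {i | ∃ a, C a hi ≤ C a (ff i)}
def kPb (C : Bool → J I → α) : Set I := {i | ∃ a, C a (np i) ≤ C a lo}
def kPt (C : Bool → J I → α) : Set I := {i | ∀ a, C a (fp i) < C a hi}

structure SameK {β : Type} [LinearOrder β] (C : Bool → J I → α) (C' : Bool → J I → β) : Prop where
  bot : kBot C = kBot C'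
  top : kTop C = kTop C'
  pb : kPb C = kPb C'
  pt : kPt C = kPt C'

def Filled (Ty : Set I → Set I → Set I → Prop) (C : Bool → J I → α) : Prop :=
  ∃ t, Ty (kTop C) (kPb C) t ∧ t ⊆ kBot C ∧ t ⊆ kPt C

structure LineR (Ty : Set I → Set I → Set I → Prop) (l h : α) (exF exP : I → Prop)
    (L : K I → α) (lab : α → Set I) : Prop where
  fofv : ∀ i, L (fo i) ≤ L (fv i)
  pvpo : ∀ i, L (pv i) ≤ L (po i)
  cl : ∀ k, l ≤ L k
  cu : ∀ k, L k ≤ h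
  l1 : ∀ y, l < y → y < h → Ty {i | y < L (fo i)} {i | L (po i) < y} (lab y)
  l2F : ∀ y, l < y → y < h → ∀ i ∈ lab y, y ≤ L (fv i)
  l2P : ∀ y, l < y → y < h → ∀ i ∈ lab y, L (pv i) ≤ y
  wF : ∀ i y, l ≤ y → L (fo i) ≤ y → y < L (fv i) → exF i ∨ ∃ y', y < y' ∧ y' < h ∧ i ∈ lab y'
  wP : ∀ i y, y ≤ h → y ≤ L (po i) → L (pv i) < y → exP i ∨ ∃ y', l < y' ∧ y' < y ∧ i ∈ lab y'

def InR (C : Bool → J I → α) (p : Bool → α) : Prop := ∀ a, C a lo < p a ∧ p a < C a hi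
def InT (A : J I → α) (p : Bool → α) : Prop := A lo < p false ∧ p false < p true ∧ p true < A hi

def Fo (τ : (Bool → α) → Set I) (p : Bool → α) : Set I := {i | ∃ q, (∀ a, p a < q a) ∧ i ∈ τ q}
def Po (τ : (Bool → α) → Set I) (p : Bool → α) : Set I := {i | ∃ q, (∀ a, q a < p a) ∧ i ∈ τ q}

end
end HP

namespace HP
open J K

structure Tr (I α : Type) [LinearOrder α] (Ty : Set I → Set I → Set I → Prop) (D : Set α) where
  R : Type
  T : Type
  C : R → Bool → J I → α
  A : T → J I → α
  d : R → Bool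
  z : R → α
  L : R → K I → α
  lab : R → α → Set I
  c1 : R → R
  c2 : R → R
  w : T → α
  Lh : T → K I → α
  Lv : T → K I → α
  labh : T → α → Set I
  labv : T → α → Set I
  t1 : T → T
  t2 : T → T
  tr : T → R
  root : T
  τ : (Bool → α) → Set I
  cst : ∀ r, Cst (C r)
  tcst : ∀ t, TCst (A t)
  zlo : ∀ r, C r (d r) lo < z r
  zhi : ∀ r, z r < C r (d r) hi
  wlo : ∀ t, A t lo < w t
  whi : ∀ t, w t < A t hi
  C1 : ∀ r, C (c1 r) = ch1 (C r) (d r) (z r) (L r)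
  C2 : ∀ r, C (c2 r) = ch2 (C r) (d r) (z r) (L r)
  T1 : ∀ t, A (t1 t) = tri1 (A t) (w t) (Lh t)
  T2 : ∀ t, A (t2 t) = tri2 (A t) (w t) (Lv t)
  TR : ∀ t, C (tr t) = triR (A t) (w t) (Lh t) (Lv t)
  line : ∀ r, LineR Ty (C r (!(d r)) lo) (C r (!(d r)) hi) (fun i => z r ≤ C r (d r) (ff i))
    (fun i => C r (d r) (np i) ≤ z r) (L r) (lab r)
  lineh : ∀ t, LineR Ty (A t lo) (w t) (fun _ => False) (fun i => A t (np i) ≤ w t) (Lh t) (labh t)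
  linev : ∀ t, LineR Ty (w t) (A t hi) (fun i => w t ≤ A t (ff i)) (fun _ => False) (Lv t) (labv t)
  τl : ∀ r p, InR (C r) p → p (d r) = z r → τ p = lab r (p (!(d r)))
  τh : ∀ t p, InT (A t) p → p true = w t → τ p = labh t (p false)
  τv : ∀ t p, InT (A t) p → p false = w t → τ p = labv t (p true)
  τ0 : ∀ p i, i ∈ τ p → InT (A root) p
  rootF : ∀ i, A root (ff i) = A root lo
  rootP : ∀ i, A root (np i) = A root hi
  ind : ∀ (PT : T → Prop) (PR : R → Prop), PT root → (∀ t, PT t → PT (t1 t) ∧ PT (t2 t) ∧ PR (tr t)) →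
    (∀ r, PR r → PR (c1 r) ∧ PR (c2 r)) → (∀ t, PT t) ∧ ∀ r, PR r
  tshrink : ∀ (s : ℕ → T) p, (∀ n, s (n+1) = t1 (s n) ∨ s (n+1) = t2 (s n)) →
    (∀ n, InT (A (s n)) p) → False
  shrinkLo : ∀ (s : ℕ → R) p, (∀ n, s (n+1) = c1 (s n) ∨ s (n+1) = c2 (s n)) →
    (∀ n, InR (C (s n)) p) → ∀ a x, x < p a → ∃ N, ∀ n ≥ N, x < C (s n) a lo
  shrinkHi : ∀ (s : ℕ → R) p, (∀ n, s (n+1) = c1 (s n) ∨ s (n+1) = c2 (s n)) →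
    (∀ n, InR (C (s n)) p) → ∀ a x, p a < x → ∃ N, ∀ n ≥ N, C (s n) a hi < x
  limit : ∀ (s : ℕ → R) p, (∀ n, s (n+1) = c1 (s n) ∨ s (n+1) = c2 (s n)) →
    (∀ n, InR (C (s n)) p) → (∀ n, τ p ⊆ kBot (C (s n)) ∧ τ p ⊆ kPt (C (s n))) ∧
      ∃ KT KP, Ty KT KP (τ p) ∧ ∃ N, ∀ n ≥ N, kTop (C (s n)) = KT ∧ kPb (C (s n)) = KP
  fairF : ∀ (s : ℕ → R), (∀ n, s (n+1) = c1 (s n) ∨ s (n+1) = c2 (s n)) →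
    ∀ e i, ∀ y ∈ D, ∃ n, C (s n) e lo ≤ y → y < C (s n) e (nf i) → C (s n) e (ff i) ≤ y →
      C (s n) (!e) (ff i) ≤ C (s n) (!e) lo → ∃ q, InR (C (s n)) q ∧ y < q e ∧ i ∈ τ q
  fairP : ∀ (s : ℕ → R), (∀ n, s (n+1) = c1 (s n) ∨ s (n+1) = c2 (s n)) →
    ∀ e i, ∀ y ∈ D, ∃ n, y ≤ C (s n) e hi → C (s n) e (fp i) < y → y ≤ C (s n) e (np i) →
      C (s n) (!e) hi ≤ C (s n) (!e) (np i) → ∃ q, InR (C (s n)) q ∧ q e < y ∧ i ∈ τ q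
  fairF0 : ∀ (s : ℕ → R), (∀ n, s (n+1) = c1 (s n) ∨ s (n+1) = c2 (s n)) →
    ∀ e i, ∃ n, C (s n) e lo < C (s n) e (nf i) → C (s n) e (ff i) ≤ C (s n) e lo →
      C (s n) (!e) (ff i) ≤ C (s n) (!e) lo → ∃ q, InR (C (s n)) q ∧ i ∈ τ q
  fairP0 : ∀ (s : ℕ → R), (∀ n, s (n+1) = c1 (s n) ∨ s (n+1) = c2 (s n)) →
    ∀ e i, ∃ n, C (s n) e (fp i) < C (s n) e hi → C (s n) e hi ≤ C (s n) e (np i) →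
      C (s n) (!e) hi ≤ C (s n) (!e) (np i) → ∃ q, InR (C (s n)) q ∧ i ∈ τ q
  tfairF : ∀ (s : ℕ → T), (∀ n, s (n+1) = t1 (s n) ∨ s (n+1) = t2 (s n)) →
    ∀ i, ∀ y ∈ D, ∃ n, A (s n) lo ≤ y → y < A (s n) (nf i) → A (s n) (ff i) ≤ A (s n) lo →
      ∃ q, InT (A (s n)) q ∧ y < q true ∧ i ∈ τ q
  tfairP : ∀ (s : ℕ → T), (∀ n, s (n+1) = t1 (s n) ∨ s (n+1) = t2 (s n)) →
    ∀ i, ∀ y ∈ D, ∃ n, y ≤ A (s n) hi → A (s n) (fp i) < y → A (s n) hi ≤ A (s n) (np i) →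
      ∃ q, InT (A (s n)) q ∧ q false < y ∧ i ∈ τ q
  tfairF0 : ∀ (s : ℕ → T), (∀ n, s (n+1) = t1 (s n) ∨ s (n+1) = t2 (s n)) →
    ∀ i, ∃ n, A (s n) lo < A (s n) (nf i) → A (s n) (ff i) ≤ A (s n) lo →
      ∃ q, InT (A (s n)) q ∧ i ∈ τ q
  tfairP0 : ∀ (s : ℕ → T), (∀ n, s (n+1) = t1 (s n) ∨ s (n+1) = t2 (s n)) →
    ∀ i, ∃ n, A (s n) (fp i) < A (s n) hi → A (s n) hi ≤ A (s n) (np i) →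
      ∃ q, InT (A (s n)) q ∧ i ∈ τ q

theorem exists_path {X : Type} (f g : X → X) (Q : X → Prop) (h : ∀ x, Q x → Q (f x) ∨ Q (g x))
    (x : X) (hx : Q x) : ∃ s : ℕ → X, s 0 = x ∧ (∀ n, s (n+1) = f (s n) ∨ s (n+1) = g (s n)) ∧
      ∀ n, Q (s n) := by
  classical
  have h' : ∀ x : {x // Q x}, ∃ y : {x // Q x}, y.1 = f x.1 ∨ y.1 = g x.1 := by
    rintro ⟨x, hx⟩
    rcases h x hx with h1 | h1
    · exact ⟨⟨_, h1⟩, Or.inl rfl⟩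
    · exact ⟨⟨_, h1⟩, Or.inr rfl⟩
  choose nx hnx using h'
  refine ⟨fun n => (Nat.rec ⟨x, hx⟩ (fun _ y => nx y) n : {x // Q x}).1, rfl, ?_, ?_⟩
  · intro n; exact hnx _
  · intro n; exact Subtype.property _

theorem bool_cases (a d : Bool) : a = d ∨ a = !d := by cases a <;> cases d <;> simp

namespace Tr
variable {I α : Type} [LinearOrder α] {Ty : Set I → Set I → Set I → Prop}
  {D : Set α} (S : Tr I α Ty D)


theorem c1d (r j) : S.C (S.c1 r) (S.d r) j = min (S.C r (S.d r) j) (S.z r) := by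
  rw [S.C1]; simp [ch1]
theorem c1e (r j) : S.C (S.c1 r) (!S.d r) j = setFar (S.C r (!S.d r)) (S.L r) j := by
  rw [S.C1]; simp [ch1]
theorem c2d (r j) : S.C (S.c2 r) (S.d r) j = max (S.C r (S.d r) j) (S.z r) := by
  rw [S.C2]; simp [ch2]
theorem c2e (r j) : S.C (S.c2 r) (!S.d r) j = setNear (S.C r (!S.d r)) (S.L r) j := by
  rw [S.C2]; simp [ch2]
theorem trx (t j) : S.C (S.tr t) false j = setNear (fun j => min (S.A t j) (S.w t)) (S.Lh t) j := by
  rw [S.TR]; simp [triR]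
theorem try' (t j) : S.C (S.tr t) true j = setFar (fun j => max (S.A t j) (S.w t)) (S.Lv t) j := by
  rw [S.TR]; simp [triR]

/-- basic facts about a split -/
theorem inR_split (r) (d' : Bool) (hd : S.d r = d') (p : Bool → α) :
    InR (S.C (S.c1 r)) p ↔ InR (S.C r) p ∧ p d' < S.z r := by
  subst hd
  have h1 := S.c1d r lo; have h2 := S.c1d r hi; have h3 := S.c1e r lo; have h4 := S.c1e r hi
  have zl := S.zlo r; have zh := S.zhi r
  rw [min_eq_left zl.le] at h1; rw [min_eq_right zh.le] at h2
  simp only [setFar] at h3 h4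
  constructor
  · intro h
    have hd := h (S.d r); have he := h (!S.d r)
    rw [h1, h2] at hd; rw [h3, h4] at he
    refine ⟨fun a => ?_, hd.2⟩
    rcases bool_cases a (S.d r) with rfl | rfl
    · exact ⟨hd.1, hd.2.trans zh⟩
    · exact he
  · rintro ⟨h, hz⟩ a
    rcases bool_cases a (S.d r) with rfl | rfl
    · rw [h1, h2]; exact ⟨(h _).1, hz⟩
    · rw [h3, h4]; exact h _
theorem inR_split2 (r) (d' : Bool) (hd : S.d r = d') (p : Bool → α) :
    InR (S.C (S.c2 r)) p ↔ InR (S.C r) p ∧ S.z r < p d' := by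
  subst hd
  have h1 := S.c2d r lo; have h2 := S.c2d r hi; have h3 := S.c2e r lo; have h4 := S.c2e r hi
  have zl := S.zlo r; have zh := S.zhi r
  rw [max_eq_right zl.le] at h1; rw [max_eq_left zh.le] at h2
  simp only [setNear] at h3 h4
  constructor
  · intro h
    have hd := h (S.d r); have he := h (!S.d r)
    rw [h1, h2] at hd; rw [h3, h4] at he
    refine ⟨fun a => ?_, hd.1⟩
    rcases bool_cases a (S.d r) with rfl | rfl
    · exact ⟨zl.trans hd.1, hd.2⟩
    · exact he
  · rintro ⟨h, hz⟩ a
    rcases bool_cases a (S.d r) with rfl | rfl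
    · rw [h1, h2]; exact ⟨hz, (h _).2⟩
    · rw [h3, h4]; exact h _

theorem inT1 (t p) : InT (S.A (S.t1 t)) p ↔ InT (S.A t) p ∧ p true < S.w t := by
  have zl := S.wlo t; have zh := S.whi t
  simp only [S.T1, InT, tri1, setFar, min_eq_left zl.le, min_eq_right zh.le]
  constructor
  · rintro ⟨a, b, c⟩; exact ⟨⟨a, b, c.trans zh⟩, c⟩
  · rintro ⟨⟨a, b, c⟩, d⟩; exact ⟨a, b, d⟩
theorem inT2 (t p) : InT (S.A (S.t2 t)) p ↔ InT (S.A t) p ∧ S.w t < p false := by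
  have zl := S.wlo t; have zh := S.whi t
  simp only [S.T2, InT, tri2, setNear, max_eq_right zl.le, max_eq_left zh.le]
  constructor
  · rintro ⟨a, b, c⟩; exact ⟨⟨zl.trans a, b, c⟩, a⟩
  · rintro ⟨⟨a, b, c⟩, d⟩; exact ⟨d, b, c⟩
theorem inTR (t p) : InR (S.C (S.tr t)) p ↔ InT (S.A t) p ∧ p false < S.w t ∧ S.w t < p true := by
  have zl := S.wlo t; have zh := S.whi t
  have h1 := S.trx t lo; have h2 := S.trx t hi; have h3 := S.try' t lo; have h4 := S.try' t hi
  simp only [setNear, setFar, max_eq_right zl.le, max_eq_left zh.le, min_eq_left zl.le,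
    min_eq_right zh.le] at h1 h2 h3 h4
  simp only [InR, InT, Bool.forall_bool, h1, h2, h3, h4]
  constructor
  · rintro ⟨⟨a, b⟩, c, d⟩; exact ⟨⟨a, b.trans c, d⟩, b, c⟩
  · rintro ⟨⟨a, b, c⟩, d, e⟩; exact ⟨⟨a, d⟩, e, c⟩

/-- a point with given coordinates -/
def pt (e : Bool) (x y : α) : Bool → α := fun a => if a = e then x else y

/-- useful expansions -/
theorem fvnf (r i) : S.L r (fv i) ≤ S.C r (!S.d r) (nf i) := by
  have := (S.cst (S.c1 r)).fn (!S.d r) i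
  simpa only [S.c1e, setFar] using this
theorem fffo (r i) : S.C r (!S.d r) (ff i) ≤ S.L r (fo i) := by
  have := (S.cst (S.c2 r)).fn (!S.d r) i
  simpa only [S.c2e, setNear] using this

def BadR (r : S.R) (e : Bool) (i : I) (y : α) : Prop :=
  S.C r e lo ≤ y ∧ y < S.C r e (nf i) ∧ S.C r e (ff i) ≤ y ∧ S.C r (!e) (ff i) ≤ S.C r (!e) lo
    ∧ ¬ ∃ q, InR (S.C r) q ∧ y < q e ∧ i ∈ S.τ q

theorem badR_step (r e i y) (h : S.BadR r e i y) :
    S.BadR (S.c1 r) e i y ∨ S.BadR (S.c2 r) e i y ∨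
     (S.BadR (S.c2 r) e i (S.C (S.c2 r) e lo)) := by
  obtain ⟨h1, h2, h3, h4, h5⟩ := h
  have zl := S.zlo r; have zh := S.zhi r
  have e1 := S.inR_split r _ rfl
  have e2 := S.inR_split2 r _ rfl
  have n1 : ¬ ∃ q, InR (S.C (S.c1 r)) q ∧ y < q e ∧ i ∈ S.τ q := fun ⟨q, a, b, c⟩ =>
    h5 ⟨q, ((e1 q).1 a).1, b, c⟩
  have n2 : ¬ ∃ q, InR (S.C (S.c2 r)) q ∧ y < q e ∧ i ∈ S.τ q := fun ⟨q, a, b, c⟩ =>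
    h5 ⟨q, ((e2 q).1 a).1, b, c⟩
  have ln := S.line r
  have yh : y < S.C r e hi := h2.trans_le ((S.cst r).cu _ _)
  rcases bool_cases e (S.d r) with he | he
  · -- split along e
    subst he
    rcases le_or_gt (S.z r) y with hy | hy
    · right; left
      refine ⟨?_, ?_, ?_, ?_, n2⟩
      · rw [c2d]; exact max_le h1 hy
      · rw [c2d]; exact lt_max_of_lt_left h2
      · rw [c2d]; exact max_le h3 hy
      · rw [c2e, c2e]; exact h4
    · rcases lt_or_ge (S.z r) (S.C r (S.d r) (nf i)) with hw | hw
      · right; right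
        have hl : S.C (S.c2 r) (S.d r) lo = S.z r := by rw [c2d]; exact max_eq_right zl.le
        refine ⟨le_rfl, ?_, ?_, ?_, ?_⟩
        · rw [hl, c2d]; exact lt_max_of_lt_left hw
        · rw [hl, c2d]; exact max_le (h3.trans hy.le) le_rfl
        · rw [c2e, c2e]; exact h4
        · rw [hl]; rintro ⟨q, a, b, c⟩; exact n2 ⟨q, a, hy.trans b, c⟩
      · left
        refine ⟨?_, ?_, ?_, ?_, n1⟩
        · rw [c1d]; exact (min_le_left _ _).trans h1
        · rw [c1d]; exact lt_min h2 hy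
        · rw [c1d]; exact (min_le_left _ _).trans h3
        · rw [c1e, c1e]; simp only [setFar]
          by_contra! hc
          rcases lt_or_ge (S.C r (!S.d r) lo) (S.L r (fo i)) with hf | hf
          · have := (S.cst (S.c2 r)).c0F (!S.d r) i (by rw [c2e, c2e]; exact hf)
            rw [Bool.not_not, c2d, c2d, max_eq_right zl.le, max_eq_right hw] at this
            exact lt_irrefl _ this
          · rcases ln.wF i _ le_rfl hf hc with hx | ⟨y', a, b, c⟩
            · exact absurd (hx.trans h3) (not_le.2 hy)
            · refine h5 ⟨pt (S.d r) (S.z r) y', ?_, ?_, ?_⟩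
              · intro b; rcases bool_cases b (S.d r) with rfl | rfl <;> simp [pt, *]
              · simp [pt, hy]
              · rw [S.τl r]
                · simpa [pt]
                · intro b; rcases bool_cases b (S.d r) with rfl | rfl <;> simp [pt, *]
                · simp [pt]
  · have he' : (!e) = S.d r := by simp [he]
    rw [he'] at h4
    subst he
    rcases le_or_gt (S.L r (fv i)) y with hy | hy
    · left
      refine ⟨?_, ?_, ?_, ?_, n1⟩
      · rw [c1e]; exact h1
      · rw [c1e]; exact h2
      · rw [c1e]; exact hy
      · rw [he', c1d, c1d]; exact min_le_min h4 le_rfl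
    · rcases lt_or_ge y (S.L r (fo i)) with hf | hf
      · right; left
        refine ⟨?_, ?_, ?_, ?_, n2⟩
        · rw [c2e]; exact h1
        · rw [c2e]; exact hf
        · rw [c2e]; exact h3
        · rw [he', c2d, c2d]; exact max_le_max h4 le_rfl
      · exfalso
        rcases ln.wF i _ h1 hf hy with hx | ⟨y', a, b, c⟩
        · exact absurd (hx.trans h4) (not_le.2 zl)
        · refine h5 ⟨pt (S.d r) (S.z r) y', ?_, ?_, ?_⟩
          · intro b; rcases bool_cases b (S.d r) with rfl | rfl <;> simp [pt, *]
            exact h1.trans_lt a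
          · simp [pt, a]
          · rw [S.τl r]
            · simpa [pt]
            · intro b; rcases bool_cases b (S.d r) with rfl | rfl <;> simp [pt, *]
              exact h1.trans_lt a
            · simp [pt]

theorem badR0 (r e i) : ¬ S.BadR r e i (S.C r e lo) := by
  intro h
  obtain ⟨s, -, hs, hQ⟩ := exists_path S.c1 S.c2 (fun r => S.BadR r e i (S.C r e lo)) (by
    intro r h
    rcases S.badR_step r e i _ h with h' | h' | h'
    · left
      convert h' using 1
      rcases bool_cases e (S.d r) with he | he
      · subst he; rw [c1d]; exact min_eq_left (S.zlo r).le
      · subst he; rw [c1e]; rfl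
    · right
      have h1 := h'.1
      convert h' using 1
      apply le_antisymm h1
      rcases bool_cases e (S.d r) with he | he
      · subst he; rw [c2d]; exact le_max_left _ _
      · subst he; rw [c2e]; rfl
    · right; exact h') r h
  obtain ⟨n, hn⟩ := S.fairF0 s hs e i
  obtain ⟨-, h2, h3, h4, h5⟩ := hQ n
  obtain ⟨q, a, b⟩ := hn h2 h3 h4
  exact h5 ⟨q, a, (a e).1, b⟩

theorem badRD (r e i y) (hy : y ∈ D) : ¬ S.BadR r e i y := by
  intro h
  obtain ⟨s, -, hs, hQ⟩ := exists_path S.c1 S.c2 (fun r => S.BadR r e i y) (by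
    intro r h
    rcases S.badR_step r e i _ h with h' | h' | h'
    · left; exact h'
    · right; exact h'
    · exact absurd h' (S.badR0 _ _ _)) r h
  obtain ⟨n, hn⟩ := S.fairF s hs e i y hy
  obtain ⟨h1, h2, h3, h4, h5⟩ := hQ n
  exact h5 (hn h1 h2 h3 h4)

theorem innerR (hD : ∀ x y : α, x < y → ∃ z ∈ D, x < z ∧ z < y) (r e i y)
    (h1 : S.C r e lo ≤ y) (h2 : y < S.C r e (nf i)) (h3 : S.C r e (ff i) ≤ y)
    (h4 : S.C r (!e) (ff i) ≤ S.C r (!e) lo) : ∃ q, InR (S.C r) q ∧ y < q e ∧ i ∈ S.τ q := by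
  obtain ⟨y', hy', ha, hb⟩ := hD _ _ h2
  by_contra h5
  exact S.badRD r e i y' hy' ⟨h1.trans ha.le, hb, h3.trans ha.le, h4,
    fun ⟨q, a, b, c⟩ => h5 ⟨q, a, ha.trans b, c⟩⟩

end Tr
end HP

namespace HP
open J K
namespace Tr
variable {I α : Type} [LinearOrder α] {Ty : Set I → Set I → Set I → Prop}
  {D : Set α} (S : Tr I α Ty D)

theorem inT_h (t : S.T) (x : α) (h1 : S.A t lo < x) (h2 : x < S.w t) :
    InT (S.A t) (pt false x (S.w t)) := by
  refine ⟨?_, ?_, ?_⟩ <;> simp [pt, h1, h2, S.whi t]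
theorem inT_v (t : S.T) (x : α) (h1 : S.w t < x) (h2 : x < S.A t hi) :
    InT (S.A t) (pt false (S.w t) x) := by
  refine ⟨?_, ?_, ?_⟩ <;> simp [pt, h1, h2, S.wlo t]
theorem inR_l (r : S.R) (y : α) (h1 : S.C r (!S.d r) lo < y) (h2 : y < S.C r (!S.d r) hi) :
    InR (S.C r) (pt (S.d r) (S.z r) y) := by
  have := S.zlo r; have := S.zhi r
  intro b; rcases bool_cases b (S.d r) with rfl | rfl <;> simp [pt, *]
theorem τl' (r : S.R) (y : α) (h1 : S.C r (!S.d r) lo < y) (h2 : y < S.C r (!S.d r) hi) :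
    S.τ (pt (S.d r) (S.z r) y) = S.lab r y := by
  rw [S.τl r _ (S.inR_l r y h1 h2) (by simp [pt])]; simp [pt]
theorem τh' (t : S.T) (x : α) (h1 : S.A t lo < x) (h2 : x < S.w t) :
    S.τ (pt false x (S.w t)) = S.labh t x := by
  rw [S.τh t _ (S.inT_h t x h1 h2) (by simp [pt])]; simp [pt]
theorem τv' (t : S.T) (x : α) (h1 : S.w t < x) (h2 : x < S.A t hi) :
    S.τ (pt false (S.w t) x) = S.labv t x := by
  rw [S.τv t _ (S.inT_v t x h1 h2) (by simp [pt])]; simp [pt]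

def BadT (t : S.T) (i : I) (y : α) : Prop :=
  S.A t lo ≤ y ∧ y < S.A t (nf i) ∧ S.A t (ff i) ≤ S.A t lo
    ∧ ¬ ∃ q, InT (S.A t) q ∧ y < q true ∧ i ∈ S.τ q

variable (hD : ∀ x y : α, x < y → ∃ z ∈ D, x < z ∧ z < y)
include hD

theorem badT_hi (t i y) (h : S.BadT t i y) (hy : S.w t ≤ y) : S.BadT (S.t2 t) i y := by
  obtain ⟨h1, h2, h4, h5⟩ := h
  have zl := S.wlo t; have zh := S.whi t
  refine ⟨?_, ?_, ?_, fun ⟨q, a, b, c⟩ => h5 ⟨q, ((S.inT2 t q).1 a).1, b, c⟩⟩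
  · simpa only [S.T2, tri2, setNear, max_eq_right zl.le] using hy
  · simp only [S.T2, tri2, setNear]
    by_contra! hf
    rcases le_or_gt (S.Lv t (fv i)) y with hv | hv
    · obtain ⟨q, a, b, c⟩ := S.innerR hD (S.tr t) true i y
        (by simp only [S.try', setFar, max_eq_right zl.le]; exact hy)
        (by simp only [S.try', setFar]; exact lt_max_of_lt_left h2)
        (by simp only [S.try', setFar]; exact hv)
        (by simp only [Bool.not_true, S.trx, setNear]; exact min_le_min h4 le_rfl)
      exact h5 ⟨q, ((S.inTR t q).1 a).1, b, c⟩
    · rcases (S.linev t).wF i y hy hf hv with hx | ⟨y', a, b, c⟩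
      · exact absurd (hx.trans h4) (not_le.2 zl)
      · refine h5 ⟨pt false (S.w t) y', S.inT_v t y' (hy.trans_lt a) b, by simp [pt, a], ?_⟩
        rwa [S.τv' t y' (hy.trans_lt a) b]
  · simp only [S.T2, tri2, setNear]; exact max_le_max h4 le_rfl

theorem badT_step (t i y) (h : S.BadT t i y) :
    S.BadT (S.t1 t) i y ∨ S.BadT (S.t2 t) i y ∨ S.BadT (S.t2 t) i (S.A (S.t2 t) lo) := by
  have zl := S.wlo t; have zh := S.whi t
  rcases le_or_gt (S.w t) y with hy | hy
  · right; left; exact S.badT_hi hD t i y h hy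
  · obtain ⟨h1, h2, h4, h5⟩ := h
    rcases lt_or_ge (S.w t) (S.A t (nf i)) with hw | hw
    · right; right
      have hl : S.A (S.t2 t) lo = S.w t := by
        simp only [S.T2, tri2, setNear]; exact max_eq_right zl.le
      rw [hl]
      exact S.badT_hi hD t i _ ⟨zl.le, hw, h4, fun ⟨q, a, b, c⟩ => h5 ⟨q, a, hy.trans b, c⟩⟩ le_rfl
    · left
      refine ⟨?_, ?_, ?_, fun ⟨q, a, b, c⟩ => h5 ⟨q, ((S.inT1 t q).1 a).1, b, c⟩⟩
      · simp only [S.T1, tri1, setFar]; exact (min_le_left _ _).trans h1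
      · simp only [S.T1, tri1, setFar]; exact lt_min h2 hy
      · simp only [S.T1, tri1, setFar, min_eq_left zl.le]
        by_contra! hc
        rcases lt_or_ge (S.A t lo) (S.Lh t (fo i)) with hf | hf
        · have := (S.cst (S.tr t)).c0F false i
            (by simp only [S.trx, setNear, min_eq_left zl.le]; exact hf)
          simp only [Bool.not_false, S.try', setFar, max_eq_right zl.le, max_eq_right hw] at this
          exact lt_irrefl _ this
        · rcases (S.lineh t).wF i _ le_rfl hf hc with hx | ⟨y', a, b, c⟩
          · exact hx
          · refine h5 ⟨pt false y' (S.w t), S.inT_h t y' a b, by simp [pt, hy], ?_⟩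
            rwa [S.τh' t y' a b]

theorem badT0 (t i) : ¬ S.BadT t i (S.A t lo) := by
  intro h
  obtain ⟨s, -, hs, hQ⟩ := exists_path S.t1 S.t2 (fun t => S.BadT t i (S.A t lo)) (by
    intro t h
    rcases S.badT_step hD t i _ h with h' | h' | h'
    · left
      convert h' using 1
      simp only [S.T1, tri1, setFar]; exact min_eq_left (S.wlo t).le
    · have := h'.1
      simp only [S.T2, tri2, setNear] at this
      exact absurd this (not_le.2 (lt_max_of_lt_right (S.wlo t)))
    · right; exact h') t h
  obtain ⟨n, hn⟩ := S.tfairF0 s hs i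
  obtain ⟨-, h2, h3, h5⟩ := hQ n
  obtain ⟨q, a, b⟩ := hn h2 h3
  exact h5 ⟨q, a, a.1.trans a.2.1, b⟩

theorem innerT (t i y) (h1 : S.A t lo ≤ y) (h2 : y < S.A t (nf i))
    (h4 : S.A t (ff i) ≤ S.A t lo) : ∃ q, InT (S.A t) q ∧ y < q true ∧ i ∈ S.τ q := by
  obtain ⟨y', hy', ha, hb⟩ := hD _ _ h2
  by_contra h5
  have h : S.BadT t i y' := ⟨h1.trans ha.le, hb, h4, fun ⟨q, a, b, c⟩ => h5 ⟨q, a, ha.trans b, c⟩⟩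
  obtain ⟨s, -, hs, hQ⟩ := exists_path S.t1 S.t2 (fun t => S.BadT t i y') (by
    intro t h
    rcases S.badT_step hD t i _ h with h' | h' | h'
    · left; exact h'
    · right; exact h'
    · exact absurd h' (S.badT0 hD _ _)) t h
  obtain ⟨n, hn⟩ := S.tfairF s hs i y' hy'
  obtain ⟨h1, h2, h3, h5⟩ := hQ n
  exact h5 (hn h1 h2 h3)

/-- Statement O for rectangles -/
def OR (r : S.R) : Prop := ∀ p, InR (S.C r) p → ∀ a i, p a < S.C r a (ff i) → i ∈ Fo S.τ p
def OT (t : S.T) : Prop := ∀ p, InT (S.A t) p → ∀ i, p false < S.A t (ff i) → i ∈ Fo S.τ p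

theorem nR (r) (h : S.OR r) (e i y) (h1 : S.C r e lo ≤ y) (h3 : y < S.C r e (nf i)) :
    ∃ q, S.C r (!e) lo < q (!e) ∧ y < q e ∧ i ∈ S.τ q := by
  have h2 : y < S.C r e hi := h3.trans_le ((S.cst r).cu _ _)
  have cs := S.cst r
  have key : ∀ p, InR (S.C r) p → y < p e → i ∈ Fo S.τ p →
      ∃ q, S.C r (!e) lo < q (!e) ∧ y < q e ∧ i ∈ S.τ q := by
    rintro p hp hy ⟨q, hq, hi⟩
    exact ⟨q, (hp _).1.trans (hq _), hy.trans (hq _), hi⟩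
  have inn : ∀ x x', S.C r e lo < x → x < S.C r e hi → S.C r (!e) lo < x' → x' < S.C r (!e) hi →
      InR (S.C r) (pt e x x') := by
    intro x x' a b c d a'
    rcases bool_cases a' e with rfl | rfl <;> simp [pt, *]
  rcases lt_or_ge y (S.C r e (ff i)) with hf | hf
  · obtain ⟨x, -, a, b⟩ := hD _ _ hf
    obtain ⟨x', -, a', b'⟩ := hD _ _ (cs.lh (!e))
    have hp := inn x x' (h1.trans_lt a) (b.trans_le (cs.cu _ _)) a' b'
    exact key _ hp (by simp [pt, a]) (h _ hp e i (by simp [pt, b]))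
  · rcases lt_or_ge (S.C r (!e) lo) (S.C r (!e) (ff i)) with hg | hg
    · obtain ⟨x, -, a, b⟩ := hD _ _ h2
      obtain ⟨x', -, a', b'⟩ := hD _ _ hg
      have hp := inn x x' (h1.trans_lt a) b a' (b'.trans_le (cs.cu _ _))
      exact key _ hp (by simp [pt, a]) (h _ hp (!e) i (by simp [pt, b']))
    · obtain ⟨q, a, b, c⟩ := S.innerR hD r e i y h1 h3 hf hg
      exact ⟨q, (a _).1, b, c⟩

theorem nT (t) (h : S.OT t) (i y) (h1 : S.A t lo ≤ y) (h3 : y < S.A t (nf i)) :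
    ∃ q, S.A t lo < q false ∧ y < q true ∧ i ∈ S.τ q := by
  have h2 : y < S.A t hi := h3.trans_le ((S.tcst t).cu _)
  have cs := S.tcst t
  rcases lt_or_ge (S.A t lo) (S.A t (ff i)) with hg | hg
  · obtain ⟨x, -, a, b⟩ := hD _ _ hg
    obtain ⟨x', -, a', b'⟩ := hD _ _ (max_lt h2 (b.trans_le (cs.cu _)))
    rw [max_lt_iff] at a'
    obtain ⟨q, hq, hi⟩ := h (pt false x x') ⟨by simp [pt, a], by simp [pt, a'.2], by simp [pt, b']⟩ i
      (by simp [pt, b])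
    have q1 := hq false; have q2 := hq true
    simp only [pt, if_true] at q1
    simp [pt] at q2
    exact ⟨q, a.trans q1, a'.1.trans q2, hi⟩
  · obtain ⟨q, a, b, c⟩ := S.innerT hD t i y h1 h3 hg
    exact ⟨q, a.1, b, c⟩

theorem oR_step (r) (h : S.OR r) : S.OR (S.c1 r) ∧ S.OR (S.c2 r) := by
  have zl := S.zlo r; have zh := S.zhi r
  have o2 : S.OR (S.c2 r) := by
    intro p hp a i hf
    obtain ⟨hp', hz⟩ := (S.inR_split2 r _ rfl p).1 hp
    rcases bool_cases a (S.d r) with rfl | rfl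
    · rw [c2d, lt_max_iff] at hf
      exact h p hp' _ i (hf.resolve_right (not_lt.2 hz.le))
    · rw [c2e] at hf
      exact h p hp' _ i hf
  refine ⟨?_, o2⟩
  intro p hp a i hf
  obtain ⟨hp', hz⟩ := (S.inR_split r _ rfl p).1 hp
  rcases bool_cases a (S.d r) with rfl | rfl
  · rw [c1d, lt_min_iff] at hf
    exact h p hp' _ i hf.1
  · rw [c1e] at hf
    simp only [setFar] at hf
    rcases lt_or_ge (p (!S.d r)) (S.L r (fo i)) with hg | hg
    · obtain ⟨q, a, b, c⟩ := S.nR hD _ o2 (!S.d r) i (p (!S.d r)) (by rw [c2e]; exact (hp' _).1.le)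
        (by rw [c2e]; exact hg)
      rw [Bool.not_not, c2d, max_eq_right zl.le] at a
      refine ⟨q, fun b => ?_, c⟩
      rcases bool_cases b (S.d r) with rfl | rfl
      · exact hz.trans a
      · assumption
    · rcases (S.line r).wF i _ (hp' _).1.le hg hf with hx | ⟨y', a, b, c⟩
      · exact h p hp' _ i (hz.trans_le hx)
      · refine ⟨pt (S.d r) (S.z r) y', fun b => ?_, ?_⟩
        · rcases bool_cases b (S.d r) with rfl | rfl <;> simp [pt, *]
        · rwa [S.τl' r _ ((hp' _).1.trans a) b]

theorem oT_step (t) (h : S.OT t) : S.OT (S.t1 t) ∧ S.OT (S.t2 t) ∧ S.OR (S.tr t) := by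
  have zl := S.wlo t; have zh := S.whi t
  have o2 : S.OT (S.t2 t) := by
    intro p hp i hf
    obtain ⟨hp', hz⟩ := (S.inT2 t p).1 hp
    simp only [S.T2, tri2, setNear, lt_max_iff] at hf
    exact h p hp' i (hf.resolve_right (not_lt.2 hz.le))
  have oR : S.OR (S.tr t) := by
    intro p hp a i hf
    obtain ⟨hp', hx, hy⟩ := (S.inTR t p).1 hp
    cases a
    · simp only [trx, setNear, lt_min_iff] at hf
      exact h p hp' i hf.1
    · simp only [try', setFar] at hf
      rcases lt_or_ge (p true) (S.Lv t (fo i)) with hg | hg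
      · obtain ⟨q, a, b, c⟩ := S.nT hD _ o2 i (p true)
          (by simp only [S.T2, tri2, setNear, max_eq_right zl.le]; exact hy.le)
          (by simpa only [S.T2, tri2, setNear] using hg)
        simp only [S.T2, tri2, setNear, max_eq_right zl.le] at a
        refine ⟨q, fun b => ?_, c⟩
        cases b
        · exact hx.trans a
        · exact b
      · rcases (S.linev t).wF i _ hy.le hg hf with hx' | ⟨y', a, b, c⟩
        · exact h p hp' i (hx.trans_le hx')
        · refine ⟨pt false (S.w t) y', fun b => ?_, ?_⟩
          · cases b <;> simp [pt, *]
          · rwa [S.τv' t _ (hy.trans a) b]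
  refine ⟨?_, o2, oR⟩
  intro p hp i hf
  obtain ⟨hp', hz⟩ := (S.inT1 t p).1 hp
  simp only [S.T1, tri1, setFar] at hf
  rcases lt_or_ge (p false) (S.Lh t (fo i)) with hg | hg
  · obtain ⟨q, a, b, c⟩ := S.nR hD _ oR false i (p false)
      (by simp only [trx, setNear, min_eq_left zl.le]; exact hp'.1.le)
      (by simpa only [trx, setNear] using hg)
    simp only [Bool.not_false, try', setFar, max_eq_right zl.le] at a
    refine ⟨q, fun b => ?_, c⟩
    cases b
    · exact b
    · exact hz.trans a
  · rcases (S.lineh t).wF i _ hp'.1.le hg hf with hx' | ⟨y', a, b, c⟩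
    · exact hx'.elim
    · refine ⟨pt false y' (S.w t), fun b => ?_, ?_⟩
      · cases b <;> simp [pt, *]
      · rwa [S.τh' t _ (hp'.1.trans a) b]

theorem oAll : (∀ t, S.OT t) ∧ (∀ r, S.OR r) := by
  refine S.ind _ _ ?_ (S.oT_step hD) (S.oR_step hD)
  intro p hp i hf
  rw [S.rootF] at hf
  exact absurd hp.1 (not_lt.2 hf.le)

end Tr
end HP

namespace HP
open J K
namespace Tr
variable {I α : Type} [LinearOrder α] {Ty : Set I → Set I → Set I → Prop}
  {D : Set α} (S : Tr I α Ty D)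

theorem descR (p : Bool → α) (Q : S.R → Prop) (r) (hp : InR (S.C r) p) (hQ : Q r)
    (h1 : ∀ r, InR (S.C r) p → Q r → p (S.d r) < S.z r → Q (S.c1 r))
    (h2 : ∀ r, InR (S.C r) p → Q r → S.z r < p (S.d r) → Q (S.c2 r)) :
    (∃ r, InR (S.C r) p ∧ Q r ∧ p (S.d r) = S.z r) ∨
    ∃ s : ℕ → S.R, (∀ n, s (n+1) = S.c1 (s n) ∨ s (n+1) = S.c2 (s n)) ∧
      (∀ n, InR (S.C (s n)) p) ∧ ∀ n, Q (s n) := by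
  by_contra! hc
  obtain ⟨hc1, hc2⟩ := hc
  obtain ⟨s, -, hs, hQ⟩ := exists_path S.c1 S.c2 (fun r => InR (S.C r) p ∧ Q r) (by
    rintro r ⟨ha, hb⟩
    rcases lt_trichotomy (p (S.d r)) (S.z r) with h | h | h
    · exact Or.inl ⟨(S.inR_split r _ rfl p).2 ⟨ha, h⟩, h1 r ha hb h⟩
    · exact absurd h (hc1 r ha hb)
    · exact Or.inr ⟨(S.inR_split2 r _ rfl p).2 ⟨ha, h⟩, h2 r ha hb h⟩) r ⟨hp, hQ⟩
  obtain ⟨n, hn⟩ := hc2 s hs (fun n => (hQ n).1)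
  exact hn (hQ n).2

theorem descT (p : Bool → α) (Q : S.T → Prop) (t) (hp : InT (S.A t) p) (hQ : Q t)
    (h1 : ∀ t, InT (S.A t) p → Q t → p true < S.w t → Q (S.t1 t))
    (h2 : ∀ t, InT (S.A t) p → Q t → S.w t < p false → Q (S.t2 t)) :
    ∃ t, InT (S.A t) p ∧ Q t ∧ (p true = S.w t ∨ p false = S.w t ∨
      (p false < S.w t ∧ S.w t < p true)) := by
  by_contra! hc
  obtain ⟨s, -, hs, hQ⟩ := exists_path S.t1 S.t2 (fun r => InT (S.A r) p ∧ Q r) (by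
    rintro t ⟨ha, hb⟩
    obtain ⟨c1, c2, c3⟩ := hc t ha hb
    rcases lt_trichotomy (p true) (S.w t) with h | h | h
    · exact Or.inl ⟨(S.inT1 t p).2 ⟨ha, h⟩, h1 t ha hb h⟩
    · exact absurd h c1
    · have : S.w t < p false := by
        rcases lt_trichotomy (p false) (S.w t) with h' | h' | h'
        · exact absurd (c3 h') (not_le.2 h)
        · exact absurd h' c2
        · exact h'
      exact Or.inr ⟨(S.inT2 t p).2 ⟨ha, this⟩, h2 t ha hb this⟩) t ⟨hp, hQ⟩
  exact S.tshrink s p hs (fun n => (hQ n).1)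

theorem sndR (r p i) (hp : InR (S.C r) p) (hi : i ∈ S.τ p) (a) : p a ≤ S.C r a (nf i) := by
  by_contra! hc
  rcases S.descR p (fun r => S.C r a (nf i) < p a) r hp hc (by
    intro r hr hq hz
    rcases bool_cases a (S.d r) with rfl | rfl
    · rw [c1d]; exact min_lt_of_left_lt hq
    · rw [c1e]; exact hq) (by
    intro r hr hq hz
    rcases bool_cases a (S.d r) with rfl | rfl
    · rw [c2d]; exact max_lt hq hz
    · rw [c2e]; exact (((S.line r).fofv i).trans (S.fvnf r i)).trans_lt hq)
    with ⟨r, hr, hq, hz⟩ | ⟨s, hs, hin, hQ⟩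
  · have zl := S.zlo r; have zh := S.zhi r
    rw [S.τl r p hr hz] at hi
    have hfv := (S.line r).l2F _ (hr _).1 (hr _).2 i hi
    rcases bool_cases a (S.d r) with rfl | rfl
    · have := (S.cst (S.c1 r)).c1F (!S.d r) i (by rw [c1e, c1e]; exact (hr _).1.trans_le hfv)
      rw [Bool.not_not, c1d, c1d, min_eq_right zh.le, min_eq_right_iff] at this
      exact absurd (this.trans_lt hq) (by rw [hz]; exact lt_irrefl _)
    · exact absurd (hfv.trans (S.fvnf r i)) (not_le.2 hq)
  · obtain ⟨N, hN⟩ := S.shrinkLo s p hs hin a _ (hQ 0)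
    have h2 : ∀ n, S.C (s n) a (nf i) ≤ max (S.C (s 0) a (nf i)) (S.C (s n) a lo) := by
      intro n
      induction n with
      | zero => exact le_max_left _ _
      | succ n ih =>
        rcases hs n with h | h
        · rw [h]
          rcases bool_cases a (S.d (s n)) with rfl | rfl
          · rw [c1d, c1d, min_eq_left (S.zlo _).le]; exact (min_le_left _ _).trans ih
          · rw [c1e, c1e]; exact ih
        · rw [h]
          rcases bool_cases a (S.d (s n)) with rfl | rfl
          · rw [c2d, c2d]
            refine max_le (ih.trans (max_le_max le_rfl (le_max_left _ _))) ?_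
            exact le_max_of_le_right (le_max_right _ _)
          · rw [c2e, c2e]
            exact (((S.line _).fofv i).trans (S.fvnf _ i)).trans ih
    have h3 := ((S.limit s p hs hin).1 N).1 hi a
    have h4 := h2 N
    rw [max_eq_right (hN N le_rfl).le] at h4
    exact absurd h3 (not_lt.2 h4)

theorem lvfv (t i) : S.Lv t (fv i) ≤ max (S.A t (nf i)) (S.w t) := by
  have := (S.cst (S.tr t)).fn true i
  simpa only [try', setFar] using this
theorem fflh (t i) : min (S.A t (ff i)) (S.w t) ≤ S.Lh t (fo i) := by
  have := (S.cst (S.tr t)).fn false i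
  simpa only [trx, setNear] using this

theorem sndT (t p i) (hp : InT (S.A t) p) (hi : i ∈ S.τ p) : p true ≤ S.A t (nf i) := by
  by_contra! hc
  obtain ⟨t, ht, hq, hz⟩ := S.descT p (fun t => S.A t (nf i) < p true) t hp hc (by
    intro t ht hq hz
    simp only [S.T1, tri1, setFar]; exact min_lt_of_left_lt hq) (by
    intro t ht hq hz
    simp only [S.T2, tri2, setNear]
    exact (((S.linev t).fofv i).trans (S.lvfv t i)).trans_lt (max_lt hq (hz.trans ht.2.1)))
  have zl := S.wlo t; have zh := S.whi t
  rcases hz with hz | hz | ⟨hx, hy⟩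
  · rw [S.τh t p ht hz] at hi
    have hfv := (S.lineh t).l2F _ ht.1 (hz ▸ ht.2.1) i hi
    have := (S.tcst (S.t1 t)).t1F i (by
      simp only [S.T1, tri1, setFar, min_eq_left zl.le]; exact ht.1.trans_le hfv)
    simp only [S.T1, tri1, setFar, min_eq_right zh.le, min_eq_right_iff] at this
    exact absurd (this.trans_lt hq) (by rw [hz]; exact lt_irrefl _)
  · rw [S.τv t p ht hz] at hi
    have hfv := (S.linev t).l2F _ (hz ▸ ht.2.1) ht.2.2 i hi
    have := hfv.trans (S.lvfv t i)
    exact absurd this (not_le.2 (max_lt hq (hz ▸ ht.2.1)))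
  · have := S.sndR (S.tr t) p i ((S.inTR t p).2 ⟨ht, hx, hy⟩) hi true
    simp only [try', setFar] at this
    exact absurd this (not_le.2 (max_lt hq hy))

def SOR (r : S.R) : Prop := ∀ q i, i ∈ S.τ q →
  (∀ b, S.C r b J.hi ≤ q b → S.C r (!b) lo < q (!b) → q (!b) < S.C r (!b) J.hi →
    q (!b) ≤ S.C r (!b) (ff i)) ∧
  ((∀ b, S.C r b J.hi ≤ q b) → ∃ a, S.C r a J.hi ≤ S.C r a (ff i))
def SOT (t : S.T) : Prop := ∀ q i, i ∈ S.τ q → S.A t J.hi ≤ q true → S.A t lo < q false →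
  min (q false) (S.A t J.hi) ≤ S.A t (ff i)

theorem soR_step (r) (h : S.SOR r) : S.SOR (S.c1 r) ∧ S.SOR (S.c2 r) := by
  have zl := S.zlo r; have zh := S.zhi r
  have fofv := (S.line r).fofv
  constructor
  · intro q i hi
    obtain ⟨ha, hb⟩ := h q i hi
    constructor
    · intro b
      rcases bool_cases b (S.d r) with rfl | rfl
      · rw [c1d, c1e, c1e, c1e, min_eq_right zh.le]
        simp only [setFar]
        intro h1 h2 h3
        rcases le_or_gt (S.C r (S.d r) J.hi) (q (S.d r)) with h4 | h4
        · exact (ha _ h4 h2 h3).trans ((S.fffo r i).trans (fofv i))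
        · have inr : InR (S.C r) q := by
            intro b
            rcases bool_cases b (S.d r) with rfl | rfl
            · exact ⟨zl.trans_le h1, h4⟩
            · exact ⟨h2, h3⟩
          rcases h1.eq_or_lt with h5 | h5
          · rw [S.τl r q inr h5.symm] at hi
            exact (S.line r).l2F _ h2 h3 i hi
          · have := S.sndR (S.c2 r) q i ((S.inR_split2 r _ rfl q).2 ⟨inr, h5⟩) hi (!S.d r)
            rw [c2e] at this
            exact this.trans (fofv i)
      · rw [Bool.not_not, c1d, c1d, c1d, c1e, min_eq_right zh.le, min_eq_left zl.le]
        simp only [setFar]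
        intro h1 h2 h3
        have := ha _ h1 (by rwa [Bool.not_not]) (by rw [Bool.not_not]; exact h3.trans zh)
        rw [Bool.not_not] at this
        exact le_min this h3.le
    · intro hh
      have h1 := hh (S.d r); have h2 := hh (!S.d r)
      rw [c1d, min_eq_right zh.le] at h1
      rw [c1e] at h2
      simp only [setFar] at h2
      rcases le_or_gt (S.C r (S.d r) J.hi) (q (S.d r)) with h4 | h4
      · obtain ⟨a, h5⟩ := hb (fun b => by
          rcases bool_cases b (S.d r) with rfl | rfl
          · exact h4
          · exact h2)
        refine ⟨a, ?_⟩
        rcases bool_cases a (S.d r) with rfl | rfl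
        · rw [c1d, c1d]; exact min_le_min h5 le_rfl
        · rw [c1e, c1e]; exact h5.trans ((S.fffo r i).trans (fofv i))
      · refine ⟨S.d r, ?_⟩
        have := ha (!S.d r) h2 (by rw [Bool.not_not]; exact zl.trans_le h1)
          (by rwa [Bool.not_not])
        rw [Bool.not_not] at this
        rw [c1d, c1d, min_eq_right zh.le]
        exact le_min (h1.trans this) le_rfl
  · intro q i hi
    obtain ⟨ha, hb⟩ := h q i hi
    constructor
    · intro b
      rcases bool_cases b (S.d r) with rfl | rfl
      · rw [c2d, c2e, c2e, c2e, max_eq_left zh.le]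
        simp only [setNear]
        exact ha _
      · rw [Bool.not_not, c2d, c2d, c2d, c2e, max_eq_left zh.le, max_eq_right zl.le]
        simp only [setNear]
        intro h1 h2 h3
        have := ha _ h1 (by rw [Bool.not_not]; exact zl.trans h2) (by rwa [Bool.not_not])
        rw [Bool.not_not] at this
        exact le_max_of_le_left this
    · intro hh
      have h1 := hh (S.d r); have h2 := hh (!S.d r)
      rw [c2d, max_eq_left zh.le] at h1
      rw [c2e] at h2
      obtain ⟨a, h5⟩ := hb (fun b => by
          rcases bool_cases b (S.d r) with rfl | rfl
          · exact h1
          · exact h2)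
      refine ⟨a, ?_⟩
      rcases bool_cases a (S.d r) with rfl | rfl
      · rw [c2d, c2d]; exact max_le_max h5 le_rfl
      · rw [c2e, c2e]; exact h5

theorem soT_step (t) (h : S.SOT t) : S.SOT (S.t1 t) ∧ S.SOT (S.t2 t) ∧ S.SOR (S.tr t) := by
  have zl := S.wlo t; have zh := S.whi t
  have fofvh := (S.lineh t).fofv
  have fofvv := (S.linev t).fofv
  have hrt : ∀ q i, i ∈ S.τ q → q false < q true := fun q i h => (S.τ0 q i h).2.1
  have lvlh : ∀ i, S.w t < S.Lv t (fv i) → S.Lh t (fo i) = S.w t := by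
    intro i h
    have := (S.cst (S.tr t)).c1F true i (by simp only [try', setFar, max_eq_right zl.le]; exact h)
    simpa only [Bool.not_true, trx, setNear, min_eq_right zh.le] using this
  have right : ∀ q i, i ∈ S.τ q → S.w t ≤ q false → q true < S.A t J.hi → q true ≤ S.Lv t (fv i) := by
    intro q i hi h1 h2
    have hlt := hrt q i hi
    have inn : InT (S.A t) q := ⟨zl.trans_le h1, hlt, h2⟩
    rcases h1.eq_or_lt with h5 | h5
    · rw [S.τv t q inn h5.symm] at hi
      exact (S.linev t).l2F _ (h5 ▸ hlt) h2 i hi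
    · have := S.sndT (S.t2 t) q i ((S.inT2 t q).2 ⟨inn, h5⟩) hi
      simp only [S.T2, tri2, setNear] at this
      exact this.trans (fofvv i)
  refine ⟨?_, ?_, ?_⟩
  · intro q i hi
    simp only [S.T1, tri1, setFar, min_eq_left zl.le, min_eq_right zh.le]
    intro h1 h2
    have hlt := hrt q i hi
    rcases le_or_gt (S.A t J.hi) (q true) with h4 | h4
    · have h5 := h q i hi h4 h2
      refine le_trans (le_min (le_trans ?_ h5) (min_le_right _ _))
        ((S.fflh t i).trans (fofvh i))
      exact le_min (min_le_left _ _) ((min_le_right _ _).trans zh.le)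
    · have inn : InT (S.A t) q := ⟨h2, hlt, h4⟩
      rcases lt_or_ge (q false) (S.w t) with h5 | h5
      · refine (min_le_left _ _).trans ?_
        rcases h1.eq_or_lt with h6 | h6
        · rw [S.τh t q inn h6.symm] at hi
          exact (S.lineh t).l2F _ h2 h5 i hi
        · have := S.sndR (S.tr t) q i ((S.inTR t q).2 ⟨inn, h5, h6⟩) hi false
          simp only [trx, setNear] at this
          exact this.trans (fofvh i)
      · refine (min_le_right _ _).trans ?_
        have := right q i hi h5 h4
        rw [← lvlh i ((h5.trans_lt hlt).trans_le this)]
        exact fofvh i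
  · intro q i hi
    simp only [S.T2, tri2, setNear, max_eq_right zl.le, max_eq_left zh.le]
    intro h1 h2
    exact (h q i hi h1 (zl.trans h2)).trans (le_max_left _ _)
  · intro q i hi
    constructor
    · intro b
      cases b
      · simp only [Bool.not_false, trx, try', setNear, setFar, max_eq_right zl.le, max_eq_left zh.le,
          min_eq_right zh.le]
        intro h1 h2 h3
        exact right q i hi h1 h3
      · simp only [Bool.not_true, trx, try', setNear, setFar, min_eq_left zl.le, max_eq_left zh.le,
          min_eq_right zh.le]
        intro h1 h2 h3
        have := h q i hi h1 h2
        rw [min_eq_left (h3.trans zh).le] at this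
        exact le_min this h3.le
    · intro hh
      have h1 := hh false; have h2 := hh true
      simp only [trx, try', setNear, setFar, min_eq_right zh.le, max_eq_left zh.le] at h1 h2
      refine ⟨false, ?_⟩
      simp only [trx, setNear, min_eq_right zh.le]
      have := h q i hi h2 (zl.trans_le h1)
      exact le_min ((le_min h1 zh.le).trans this) le_rfl

theorem soAll : (∀ t, S.SOT t) ∧ (∀ r, S.SOR r) := by
  refine S.ind _ _ ?_ S.soT_step S.soR_step
  intro q i hi h1 h2
  exact absurd (S.τ0 q i hi).2.2 (not_lt.2 h1)

theorem nearR (r e i y q) (hi : i ∈ S.τ q) (h1 : S.C r (!e) lo < q (!e)) (h2 : y < q e)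
    (h3 : S.C r e lo ≤ y) (h4 : y < S.C r e J.hi) : y < S.C r e (nf i) := by
  have cs := S.cst r
  obtain ⟨ha, hb⟩ := S.soAll.2 r q i hi
  have key : S.C r (!e) lo < S.C r (!e) (ff i) → y < S.C r e (nf i) := by
    intro h
    have := cs.c1F (!e) i h
    rw [Bool.not_not] at this
    rwa [this]
  rcases lt_or_ge (q e) (S.C r e J.hi) with he | he
  · rcases lt_or_ge (q (!e)) (S.C r (!e) J.hi) with hd | hd
    · refine h2.trans_le (S.sndR r q i (fun b => ?_) hi e)
      rcases bool_cases b e with rfl | rfl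
      · exact ⟨h3.trans_lt h2, he⟩
      · exact ⟨h1, hd⟩
    · have := ha (!e) hd
      rw [Bool.not_not] at this
      exact h2.trans_le ((this (h3.trans_lt h2) he).trans (cs.fn e i))
  · rcases lt_or_ge (q (!e)) (S.C r (!e) J.hi) with hd | hd
    · exact key (h1.trans_le (ha e he h1 hd))
    · obtain ⟨a, h5⟩ := hb (fun b => by rcases bool_cases b e with rfl | rfl <;> assumption)
      rcases bool_cases a e with rfl | rfl
      · exact h4.trans_le (h5.trans (cs.fn _ i))
      · exact key ((cs.lh _).trans_le h5)

theorem nearT (t i y q) (hi : i ∈ S.τ q) (h1 : S.A t lo < q false) (h2 : y < q true)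
    (h4 : y < S.A t J.hi) : y < S.A t (nf i) := by
  have cs := S.tcst t
  rcases lt_or_ge (q true) (S.A t J.hi) with he | he
  · exact h2.trans_le (S.sndT t q i ⟨h1, (S.τ0 q i hi).2.1, he⟩ hi)
  · have := S.soAll.1 t q i hi he h1
    rwa [cs.t1F i ((lt_min h1 cs.lh).trans_le this)]

variable (hD : ∀ x y : α, x < y → ∃ z ∈ D, x < z ∧ z < y)
include hD

theorem FoR (r e) (p : Bool → α) (h1 : p (!e) = S.C r (!e) lo) (h2 : S.C r e lo ≤ p e)
    (h3 : p e < S.C r e J.hi) : Fo S.τ p = {i | p e < S.C r e (nf i)} := by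
  ext i
  constructor
  · rintro ⟨q, hq, hi⟩
    exact S.nearR r e i (p e) q hi (h1 ▸ hq _) (hq _) h2 h3
  · intro h
    obtain ⟨q, a, b, c⟩ := S.nR hD r ((S.oAll hD).2 r) e i (p e) h2 h
    refine ⟨q, fun b => ?_, c⟩
    rcases bool_cases b e with rfl | rfl
    · assumption
    · rwa [h1]
theorem FoT (t) (p : Bool → α) (h1 : p false = S.A t lo) (h2 : S.A t lo ≤ p true)
    (h3 : p true < S.A t J.hi) : Fo S.τ p = {i | p true < S.A t (nf i)} := by
  ext i
  constructor
  · rintro ⟨q, hq, hi⟩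
    exact S.nearT t i (p true) q hi (h1 ▸ hq _) (hq _) h3
  · intro h
    obtain ⟨q, a, b, c⟩ := S.nT hD t ((S.oAll hD).1 t) i (p true) h2 h
    refine ⟨q, fun b => ?_, c⟩
    cases b
    · rwa [h1]
    · assumption

theorem FoLine (r p) (hp : InR (S.C r) p) (hz : p (S.d r) = S.z r) :
    Fo S.τ p = {i | p (!S.d r) < S.L r (fo i)} := by
  rw [S.FoR hD (S.c2 r) (!S.d r) p]
  · ext i; simp only [Set.mem_ofPred_eq]; rw [c2e]; rfl
  · rw [Bool.not_not, c2d, max_eq_right (S.zlo r).le, hz]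
  · rw [c2e]; exact (hp _).1.le
  · rw [c2e]; exact (hp _).2

theorem FoH (t p) (hp : InT (S.A t) p) (hz : p true = S.w t) :
    Fo S.τ p = {i | p false < S.Lh t (fo i)} := by
  have zl := S.wlo t; have zh := S.whi t
  rw [S.FoR hD (S.tr t) false p]
  · simp only [trx, setNear]
  · simp only [Bool.not_false, try', setFar, max_eq_right zl.le, hz]
  · simp only [trx, setNear, min_eq_left zl.le]; exact hp.1.le
  · simp only [trx, setNear, min_eq_right zh.le]; exact hz ▸ hp.2.1
theorem FoV (t p) (hp : InT (S.A t) p) (hz : p false = S.w t) :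
    Fo S.τ p = {i | p true < S.Lv t (fo i)} := by
  have zl := S.wlo t; have zh := S.whi t
  rw [S.FoT hD (S.t2 t) p]
  · simp only [S.T2, tri2, setNear]
  · simp only [S.T2, tri2, setNear, max_eq_right zl.le, hz]
  · simp only [S.T2, tri2, setNear, max_eq_right zl.le]; exact (hz ▸ hp.2.1).le
  · simp only [S.T2, tri2, setNear, max_eq_left zh.le]; exact hp.2.2

theorem FoLim (s : ℕ → S.R) (p) (hs : ∀ n, s (n+1) = S.c1 (s n) ∨ s (n+1) = S.c2 (s n))
    (hin : ∀ n, InR (S.C (s n)) p) (KT) (h : ∃ N, ∀ n ≥ N, kTop (S.C (s n)) = KT) :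
    Fo S.τ p = KT := by
  obtain ⟨N, hN⟩ := h
  ext i
  constructor
  · rintro ⟨q, hq, hi⟩
    obtain ⟨N1, h1⟩ := S.shrinkHi s p hs hin false _ (hq false)
    obtain ⟨N2, h2⟩ := S.shrinkHi s p hs hin true _ (hq true)
    let n := max N (max N1 N2)
    rw [← hN n (le_max_left _ _)]
    refine (S.soAll.2 (s n) q i hi).2 fun b => ?_
    cases b
    · exact (h1 n (by simp [n])).le
    · exact (h2 n (by simp [n])).le
  · intro hi
    rw [← hN N le_rfl] at hi
    obtain ⟨a, ha⟩ := hi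
    exact (S.oAll hD).2 (s N) p (hin N) a i ((hin N a).2.trans_le ha)

end Tr
end HP

namespace HP
open J K OrderDual
section
variable {I α : Type} [LinearOrder α]

def dA (A : J I → α) : J I → αᵒᵈ := fun j => toDual (A j.dual)
def dC (C : Bool → J I → α) : Bool → J I → αᵒᵈ := fun a => dA (C (!a))
def dL (L : K I → α) : K I → αᵒᵈ := fun k => toDual (L k.dual)
def dp (p : Bool → αᵒᵈ) : Bool → α := fun a => ofDual (p (!a))
def dTy (Ty : Set I → Set I → Set I → Prop) : Set I → Set I → Set I → Prop := fun F P t => Ty P F t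

theorem cst_dual {C : Bool → J I → α} (h : Cst C) : Cst (dC C) where
  lh a := h.lh (!a)
  cl a j := h.cu (!a) j.dual
  cu a j := h.cl (!a) j.dual
  fn a i := h.pn (!a) i
  pn a i := h.fn (!a) i
  c1F a i := h.c1P (!a) i
  c1P a i := h.c1F (!a) i
  c0F a i := h.c0P (!a) i
  c0P a i := h.c0F (!a) i

theorem tcst_dual {A : J I → α} (h : TCst A) : TCst (dA A) where
  lh := h.lh
  cl j := h.cu j.dual
  cu j := h.cl j.dual
  t1F i := h.t1P i
  t1P i := h.t1F i

theorem lineR_dual {Ty : Set I → Set I → Set I → Prop} {l h : α} {exF exP : I → Prop}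
    {L : K I → α} {lab : α → Set I} (H : LineR Ty l h exF exP L lab) :
    LineR (dTy Ty) (toDual h) (toDual l) exP exF (dL L) (fun y => lab (ofDual y)) where
  fofv i := H.pvpo i
  pvpo i := H.fofv i
  cl k := H.cu k.dual
  cu k := H.cl k.dual
  l1 y h1 h2 := H.l1 (ofDual y) h2 h1
  l2F y h1 h2 := H.l2P (ofDual y) h2 h1
  l2P y h1 h2 := H.l2F (ofDual y) h2 h1
  wF i y h1 h2 h3 := by
    rcases H.wP i (ofDual y) h1 h2 h3 with h | ⟨y', a, b, c⟩
    · exact Or.inl h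
    · exact Or.inr ⟨toDual y', b, a, c⟩
  wP i y h1 h2 h3 := by
    rcases H.wF i (ofDual y) h1 h2 h3 with h | ⟨y', a, b, c⟩
    · exact Or.inl h
    · exact Or.inr ⟨toDual y', b, a, c⟩

theorem inR_dual (C : Bool → J I → α) (p : Bool → αᵒᵈ) : InR (dC C) p ↔ InR C (dp p) := by
  constructor
  · intro h a
    have := h (!a)
    simp only [dC, Bool.not_not] at this
    exact ⟨this.2, this.1⟩
  · intro h a
    have := h (!a)
    simp only [dp, Bool.not_not] at this
    exact ⟨this.2, this.1⟩
theorem inT_dual (A : J I → α) (p : Bool → αᵒᵈ) : InT (dA A) p ↔ InT A (dp p) := by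
  constructor
  · rintro ⟨a, b, c⟩; exact ⟨c, b, a⟩
  · rintro ⟨a, b, c⟩; exact ⟨c, b, a⟩
theorem ch1_dual (C : Bool → J I → α) (d : Bool) (z : α) (L : K I → α) :
    dC (ch2 C d z L) = ch1 (dC C) (!d) (toDual z) (dL L) := by
  funext a j
  cases a <;> cases d <;> cases j <;> rfl
theorem ch2_dual (C : Bool → J I → α) (d : Bool) (z : α) (L : K I → α) :
    dC (ch1 C d z L) = ch2 (dC C) (!d) (toDual z) (dL L) := by
  funext a j
  cases a <;> cases d <;> cases j <;> rfl
theorem tri1_dual (A : J I → α) (z : α) (L : K I → α) :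
    dA (tri2 A z L) = tri1 (dA A) (toDual z) (dL L) := by
  funext j
  cases j <;> rfl
theorem tri2_dual (A : J I → α) (z : α) (L : K I → α) :
    dA (tri1 A z L) = tri2 (dA A) (toDual z) (dL L) := by
  funext j
  cases j <;> rfl
theorem triR_dual (A : J I → α) (z : α) (Lh Lv : K I → α) :
    dC (triR A z Lh Lv) = triR (dA A) (toDual z) (dL Lv) (dL Lh) := by
  funext a j
  cases a <;> cases j <;> rfl

theorem kTop_dual (C : Bool → J I → α) : kTop (dC C) = kPb C := by
  ext i
  constructor
  · rintro ⟨a, h⟩; exact ⟨!a, h⟩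
  · rintro ⟨a, h⟩; exact ⟨!a, by simp only [dC, Bool.not_not]; exact h⟩
theorem kPb_dual (C : Bool → J I → α) : kPb (dC C) = kTop C := by
  ext i
  constructor
  · rintro ⟨a, h⟩; exact ⟨!a, h⟩
  · rintro ⟨a, h⟩; exact ⟨!a, by simp only [dC, Bool.not_not]; exact h⟩
theorem kBot_dual (C : Bool → J I → α) : kBot (dC C) = kPt C := by
  ext i
  constructor
  · intro h a; have := h (!a); simp only [dC, Bool.not_not] at this; exact this
  · intro h a; exact h (!a)
theorem kPt_dual (C : Bool → J I → α) : kPt (dC C) = kBot C := by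
  ext i
  constructor
  · intro h a; have := h (!a); simp only [dC, Bool.not_not] at this; exact this
  · intro h a; exact h (!a)

theorem dp_up {α : Type} (q : Bool → α) : dp (fun a => toDual (q (!a))) = q := by
  funext a; simp [dp]

variable {Ty : Set I → Set I → Set I → Prop} {D : Set α}

def Tr.dual (S : Tr I α Ty D) : Tr I αᵒᵈ (dTy Ty) {y | ofDual y ∈ D} where
  R := S.R
  T := S.T
  C r := dC (S.C r)
  A t := dA (S.A t)
  d r := !S.d r
  z r := toDual (S.z r)
  L r := dL (S.L r)
  lab r := fun y => S.lab r (ofDual y)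
  c1 := S.c2
  c2 := S.c1
  w t := toDual (S.w t)
  Lh t := dL (S.Lv t)
  Lv t := dL (S.Lh t)
  labh t := fun y => S.labv t (ofDual y)
  labv t := fun y => S.labh t (ofDual y)
  t1 := S.t2
  t2 := S.t1
  tr := S.tr
  root := S.root
  τ p := S.τ (dp p)
  cst r := cst_dual (S.cst r)
  tcst t := tcst_dual (S.tcst t)
  zlo r := by have := S.zhi r; simp only [dC, Bool.not_not]; exact this
  zhi r := by have := S.zlo r; simp only [dC, Bool.not_not]; exact this
  wlo t := S.whi t
  whi t := S.wlo t
  C1 r := by rw [S.C2, ch1_dual]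
  C2 r := by rw [S.C1, ch2_dual]
  T1 t := by rw [S.T2, tri1_dual]
  T2 t := by rw [S.T1, tri2_dual]
  TR t := by rw [S.TR, triR_dual]
  line r := by
    have := lineR_dual (S.line r)
    simp only [dC, Bool.not_not]
    exact this
  lineh t := lineR_dual (S.linev t)
  linev t := lineR_dual (S.lineh t)
  τl r p hp h := by
    rw [inR_dual] at hp
    rw [S.τl r (dp p) hp h]; rfl
  τh t p hp h := by
    rw [inT_dual] at hp
    rw [S.τv t (dp p) hp h]; rfl
  τv t p hp h := by
    rw [inT_dual] at hp
    rw [S.τh t (dp p) hp h]; rfl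
  τ0 p i h := (inT_dual _ _).2 (S.τ0 _ i h)
  rootF i := congrArg toDual (S.rootP i)
  rootP i := congrArg toDual (S.rootF i)
  ind PT PR h0 h1 h2 := S.ind PT PR h0 (fun t h => ⟨(h1 t h).2.1, (h1 t h).1, (h1 t h).2.2⟩)
    (fun r h => (h2 r h).symm)
  tshrink s p hs hp := S.tshrink s (dp p) (fun n => (hs n).symm) (fun n => (inT_dual _ _).1 (hp n))
  shrinkLo s p hs hp a x h := S.shrinkHi s (dp p) (fun n => (hs n).symm)
    (fun n => (inR_dual _ _).1 (hp n)) (!a) (ofDual x) (by simp only [dp, Bool.not_not]; exact h)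
  shrinkHi s p hs hp a x h := S.shrinkLo s (dp p) (fun n => (hs n).symm)
    (fun n => (inR_dual _ _).1 (hp n)) (!a) (ofDual x) (by simp only [dp, Bool.not_not]; exact h)
  limit s p hs hp := by
    obtain ⟨h1, KT, KP, h2, N, h3⟩ := S.limit s (dp p) (fun n => (hs n).symm)
      (fun n => (inR_dual _ _).1 (hp n))
    refine ⟨fun n => ?_, KP, KT, h2, N, fun n hn => ?_⟩
    · rw [kBot_dual, kPt_dual]; exact (h1 n).symm
    · rw [kTop_dual, kPb_dual]; exact (h3 n hn).symm
  fairF s hs e i y hy := by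
    obtain ⟨n, hn⟩ := S.fairP s (fun n => (hs n).symm) (!e) i (ofDual y) hy
    refine ⟨n, fun h1 h2 h3 h4 => ?_⟩
    obtain ⟨q, a, b, c⟩ := hn h1 h2 h3 h4
    exact ⟨fun a => toDual (q (!a)), by rw [inR_dual, dp_up]; exact a, b, by rw [dp_up]; exact c⟩
  fairP s hs e i y hy := by
    obtain ⟨n, hn⟩ := S.fairF s (fun n => (hs n).symm) (!e) i (ofDual y) hy
    refine ⟨n, fun h1 h2 h3 h4 => ?_⟩
    obtain ⟨q, a, b, c⟩ := hn h1 h2 h3 h4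
    exact ⟨fun a => toDual (q (!a)), by rw [inR_dual, dp_up]; exact a, b, by rw [dp_up]; exact c⟩
  fairF0 s hs e i := by
    obtain ⟨n, hn⟩ := S.fairP0 s (fun n => (hs n).symm) (!e) i
    refine ⟨n, fun h1 h2 h3 => ?_⟩
    obtain ⟨q, a, c⟩ := hn h1 h2 h3
    exact ⟨fun a => toDual (q (!a)), by rw [inR_dual, dp_up]; exact a, by rw [dp_up]; exact c⟩
  fairP0 s hs e i := by
    obtain ⟨n, hn⟩ := S.fairF0 s (fun n => (hs n).symm) (!e) i
    refine ⟨n, fun h1 h2 h3 => ?_⟩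
    obtain ⟨q, a, c⟩ := hn h1 h2 h3
    exact ⟨fun a => toDual (q (!a)), by rw [inR_dual, dp_up]; exact a, by rw [dp_up]; exact c⟩
  tfairF s hs i y hy := by
    obtain ⟨n, hn⟩ := S.tfairP s (fun n => (hs n).symm) i (ofDual y) hy
    refine ⟨n, fun h1 h2 h3 => ?_⟩
    obtain ⟨q, a, b, c⟩ := hn h1 h2 h3
    exact ⟨fun a => toDual (q (!a)), by rw [inT_dual, dp_up]; exact a, b, by rw [dp_up]; exact c⟩
  tfairP s hs i y hy := by
    obtain ⟨n, hn⟩ := S.tfairF s (fun n => (hs n).symm) i (ofDual y) hy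
    refine ⟨n, fun h1 h2 h3 => ?_⟩
    obtain ⟨q, a, b, c⟩ := hn h1 h2 h3
    exact ⟨fun a => toDual (q (!a)), by rw [inT_dual, dp_up]; exact a, b, by rw [dp_up]; exact c⟩
  tfairF0 s hs i := by
    obtain ⟨n, hn⟩ := S.tfairP0 s (fun n => (hs n).symm) i
    refine ⟨n, fun h1 h2 => ?_⟩
    obtain ⟨q, a, c⟩ := hn h1 h2
    exact ⟨fun a => toDual (q (!a)), by rw [inT_dual, dp_up]; exact a, by rw [dp_up]; exact c⟩
  tfairP0 s hs i := by
    obtain ⟨n, hn⟩ := S.tfairF0 s (fun n => (hs n).symm) i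
    refine ⟨n, fun h1 h2 => ?_⟩
    obtain ⟨q, a, c⟩ := hn h1 h2
    exact ⟨fun a => toDual (q (!a)), by rw [inT_dual, dp_up]; exact a, by rw [dp_up]; exact c⟩

theorem Fo_dual (S : Tr I α Ty D) (p : Bool → α) :
    Fo S.dual.τ (fun a => toDual (p (!a))) = Po S.τ p := by
  ext i
  constructor
  · rintro ⟨q, h1, h2⟩
    refine ⟨dp q, fun a => ?_, h2⟩
    have := h1 (!a)
    simp only [Bool.not_not] at this
    exact this
  · rintro ⟨q, h1, h2⟩
    refine ⟨fun a => toDual (q (!a)), fun a => h1 (!a), ?_⟩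
    show i ∈ S.τ (dp _)
    rw [dp_up]; exact h2

theorem Tr.main (S : Tr I α Ty D) (hD : ∀ x y : α, x < y → ∃ z ∈ D, x < z ∧ z < y)
    (p : Bool → α) (hp : InT (S.A S.root) p) : Ty (Fo S.τ p) (Po S.τ p) (S.τ p) := by
  have hD' : ∀ x y : αᵒᵈ, x < y → ∃ z ∈ {y | ofDual y ∈ D}, x < z ∧ z < y := by
    intro x y h
    obtain ⟨z, h1, h2, h3⟩ := hD (ofDual y) (ofDual x) h
    exact ⟨toDual z, h1, h3, h2⟩
  rw [← Fo_dual]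
  set p' : Bool → αᵒᵈ := fun a => toDual (p (!a)) with hp'
  have dpp : dp p' = p := dp_up p
  obtain ⟨t, ht, -, hz⟩ := S.descT p (fun _ => True) S.root hp trivial
    (fun _ _ _ _ => trivial) (fun _ _ _ _ => trivial)
  rcases hz with hz | hz | ⟨hx, hy⟩
  · rw [S.FoH hD t p ht hz, S.dual.FoV hD' t p' ((inT_dual _ _).2 (dpp ▸ ht)) (congrArg toDual hz),
      S.τh t p ht hz]
    exact (S.lineh t).l1 _ ht.1 (hz ▸ ht.2.1)
  · rw [S.FoV hD t p ht hz, S.dual.FoH hD' t p' ((inT_dual _ _).2 (dpp ▸ ht)) (congrArg toDual hz),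
      S.τv t p ht hz]
    exact (S.linev t).l1 _ (hz ▸ ht.2.1) ht.2.2
  · rcases S.descR p (fun _ => True) (S.tr t) ((S.inTR t p).2 ⟨ht, hx, hy⟩) trivial
      (fun _ _ _ _ => trivial) (fun _ _ _ _ => trivial) with ⟨r, hr, -, hz⟩ | ⟨s, hs, hin, -⟩
    · have := S.dual.FoLine hD' r p' ((inR_dual _ _).2 (dpp ▸ hr))
        (by simp only [hp', Tr.dual, Bool.not_not]; exact congrArg toDual hz)
      rw [this, S.FoLine hD r p hr hz, S.τl r p hr hz]
      simp only [hp', Tr.dual, Bool.not_not]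
      exact (S.line r).l1 _ (hr _).1 (hr _).2
    · obtain ⟨-, KT, KP, h1, N, h2⟩ := S.limit s p hs hin
      rw [S.FoLim hD s p hs hin KT ⟨N, fun n hn => (h2 n hn).1⟩]
      rw [S.dual.FoLim hD' s p' (fun n => (hs n).symm) (fun n => (inR_dual _ _).2 (dpp ▸ hin n)) KP
        ⟨N, fun n hn => (kTop_dual _).trans (h2 n hn).2⟩]
      exact h1

end
end HP

namespace HP
open J K

/-- order equivalence of two families -/
def OEq {ι α β : Type} [LinearOrder α] [LinearOrder β] (A : ι → α) (B : ι → β) : Prop :=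
  ∀ x y, A x < A y ↔ B x < B y

/-- same relative position -/
def RPos {ι α β : Type} [LinearOrder α] [LinearOrder β] (A : ι → α) (x : α) (B : ι → β) (y : β) : Prop :=
  ∀ j, (A j < x ↔ B j < y) ∧ (x < A j ↔ y < B j)

theorem exists_ext {ι : Type} [Finite ι] (A : ι → ℝ) (B : ι → ℕ) (h : OEq A B) :
    ∃ g : ℕ → ℝ, StrictMono g ∧ ∀ x, g (B x) = A x := by
  classical
  have pick : ∀ v : ℝ, ∃ v', v < v' ∧ ∀ x, v < A x → v' < A x := by
    intro v
    have hf : (Set.range A ∩ Set.Ioi v).Finite := (Set.finite_range A).inter_of_left _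
    rcases (Set.range A ∩ Set.Ioi v).eq_empty_or_nonempty with he | he
    · refine ⟨v+1, by linarith, fun x hx => ?_⟩
      have : A x ∈ Set.range A ∩ Set.Ioi v := ⟨⟨x, rfl⟩, hx⟩
      rw [he] at this; exact this.elim
    · obtain ⟨m, hm, hm2⟩ := Set.exists_min_image _ id hf he
      refine ⟨(v+m)/2, ?_, fun x hx => ?_⟩
      · have : v < m := hm.2
        linarith
      · have h1 : m ≤ A x := hm2 _ ⟨⟨x, rfl⟩, hx⟩
        have : v < m := hm.2
        linarith
  choose pk hpk1 hpk2 using pick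
  obtain ⟨v0, hv0⟩ : ∃ v0 : ℝ, ∀ x, v0 < A x := by
    obtain ⟨b, hb⟩ := (Set.finite_range A).bddBelow
    exact ⟨b - 1, fun x => by have := hb ⟨x, rfl⟩; linarith⟩
  let stp : ℕ → ℝ → ℝ := fun n v => if hx : ∃ x, B x = n then A hx.choose else pk v
  have stp1 : ∀ n v x, B x = n → stp n v = A x := by
    intro n v x hx
    have hx' : ∃ x, B x = n := ⟨x, hx⟩
    simp only [stp, dif_pos hx']
    have := hx'.choose_spec
    apply le_antisymm
    · by_contra! hc
      have := (h _ _).1 hc; omega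
    · by_contra! hc
      have := (h _ _).1 hc; omega
  let g : ℕ → ℝ := fun n => Nat.rec (stp 0 v0) (fun n v => stp (n+1) v) n
  have gs : ∀ n, g (n+1) = stp (n+1) (g n) := fun n => rfl
  have g0 : g 0 = stp 0 v0 := rfl
  have inv0 : ∀ n v, (∀ x, n ≤ B x → v < A x) → v < stp n v ∧ ∀ x, n < B x → stp n v < A x := by
    intro n v hv
    by_cases hx : ∃ x, B x = n
    · obtain ⟨x, hx⟩ := hx
      rw [stp1 n v x hx]
      exact ⟨hv x hx.ge, fun y hy => (h _ _).2 (by omega)⟩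
    · simp only [stp, dif_neg hx]
      exact ⟨hpk1 v, fun y hy => hpk2 _ _ (hv y hy.le)⟩
  have inv : ∀ n, ∀ x, n < B x → g n < A x := by
    intro n
    induction n with
    | zero => rw [g0]; exact (inv0 0 v0 (fun x _ => hv0 x)).2
    | succ n ih => rw [gs]; exact (inv0 (n+1) (g n) (fun x hx => ih x hx)).2
  refine ⟨g, strictMono_nat_of_lt_succ fun n => ?_, fun x => ?_⟩
  · rw [gs]; exact (inv0 (n+1) (g n) (fun x hx => inv n x hx)).1
  · rcases hB : B x with _ | n
    · rw [g0]; exact stp1 _ _ _ hB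
    · rw [gs]; exact stp1 _ _ _ hB

theorem exists_shuffle : ∃ sh : ℝ → ℕ, ∀ n (x y : ℝ), x < y → ∃ z, x < z ∧ z < y ∧ sh z = n := by
  classical
  let f : ℕ → ℝ := fun n => n * Real.sqrt 2
  have hf : ∀ n m (q q' : ℚ), (q:ℝ) + f n = q' + f m → n = m := by
    intro n m q q' h
    by_contra hne
    have h1 : ((n:ℝ) - m) ≠ 0 := sub_ne_zero.2 (by exact_mod_cast hne)
    have h2 : Real.sqrt 2 = (((q' - q) / ((n:ℚ) - m) : ℚ) : ℝ) := by
      push_cast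
      rw [eq_div_iff h1]
      simp only [f] at h
      linarith
    exact irrational_sqrt_two ⟨_, h2.symm⟩
  refine ⟨fun z => if h : ∃ n, ∃ q : ℚ, (q:ℝ) + f n = z then h.choose else 0, fun n x y hxy => ?_⟩
  obtain ⟨q, h1, h2⟩ := exists_rat_btwn (show x - f n < y - f n by linarith)
  refine ⟨q + f n, by linarith, by linarith, ?_⟩
  have h : ∃ n', ∃ q' : ℚ, (q':ℝ) + f n' = q + f n := ⟨n, q, rfl⟩
  simp only [dif_pos h]
  obtain ⟨q', hq'⟩ := h.choose_spec
  exact hf _ _ _ _ hq'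

/-- position of a real among the images of even numbers -/
def KP (g : ℕ → ℝ) (y : ℝ) (k : ℕ) : Prop :=
  ∀ e, Even e → (e < k ↔ g e < y) ∧ (k < e ↔ y < g e)

theorem exists_KP (g : ℕ → ℝ) (hg : StrictMono g) (l h : ℕ) (hl : Even l) (hh : Even h) (y : ℝ)
    (h1 : g l ≤ y) (h2 : y ≤ g h) : ∃ k, KP g y k := by
  classical
  have hex : ∃ e, Even e ∧ y ≤ g e := ⟨h, hh, h2⟩
  obtain ⟨he, hy⟩ := Nat.find_spec hex
  have hmin := fun e => @Nat.find_min _ _ hex e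
  set e := Nat.find hex with hE
  rcases hy.eq_or_lt with hy | hy
  · refine ⟨e, fun e' _ => ?_⟩
    rw [hy, hg.lt_iff_lt, hg.lt_iff_lt]; exact ⟨Iff.rfl, Iff.rfl⟩
  · have hle : l < e := by
      rw [← hg.lt_iff_lt]; exact h1.trans_lt hy
    refine ⟨e - 1, fun e' he' => ?_⟩
    rcases le_or_gt e e' with h3 | h3
    · have h4 : g e ≤ g e' := hg.monotone h3
      constructor
      · constructor
        · intro h; omega
        · intro h; exact absurd (hy.trans_le h4) (not_lt.2 h.le)
      · constructor
        · intro h; exact hy.trans_le h4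
        · intro h; omega
    · have h4 : g e' < y := by
        by_contra! hc; exact hmin e' h3 ⟨he', hc⟩
      have h5 : e' < e - 1 := by
        obtain ⟨a, ha⟩ := he; obtain ⟨b, hb⟩ := he'; omega
      constructor
      · exact ⟨fun _ => h4, fun _ => h5⟩
      · exact ⟨fun h => by omega, fun h => absurd h (not_lt.2 h4.le)⟩

section
variable {I : Type} (Ty : Set I → Set I → Set I → Prop)

def Leg {α : Type} [LinearOrder α] (L : K I → α) (y : α) (t : Set I) : Prop :=
  Ty {i | y < L (fo i)} {i | L (po i) < y} t ∧ ∀ i ∈ t, L (pv i) ≤ y ∧ y ≤ L (fv i)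

theorem leg_KP (g : ℕ → ℝ) (L : K I → ℕ) (hL : ∀ k, Even (L k)) (y : ℝ) (k : ℕ) (h : KP g y k)
    (t : Set I) : Leg Ty L k t ↔ Leg Ty (fun j => g (L j)) y t := by
  have h1 : ∀ j, k < L j ↔ y < g (L j) := fun j => (h _ (hL j)).2
  have h2 : ∀ j, L j < k ↔ g (L j) < y := fun j => (h _ (hL j)).1
  simp only [Leg, ← not_lt (a := k), ← not_lt (b := k), ← not_lt (a := y), ← not_lt (b := y), h1, h2]

def NF (exF : I → Prop) (L : K I → ℕ) (i : I) : Prop :=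
  L (fo i) < L (fv i) ∧ ¬ exF i ∧ ¬ ∃ t, Leg Ty L (L (fv i) - 1) t ∧ i ∈ t
def NP (exP : I → Prop) (L : K I → ℕ) (i : I) : Prop :=
  L (pv i) < L (po i) ∧ ¬ exP i ∧ ¬ ∃ t, Leg Ty L (L (pv i) + 1) t ∧ i ∈ t

structure LineOK (l h : ℕ) (exF exP : I → Prop) (L : K I → ℕ) (req : ℕ → I → Prop) : Prop where
  ev : ∀ k, Even (L k)
  fofv : ∀ i, L (fo i) ≤ L (fv i)
  pvpo : ∀ i, L (pv i) ≤ L (po i)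
  cl : ∀ k, l ≤ L k
  cu : ∀ k, L k ≤ h
  leg : ∀ k, l < k → k < h → ∃ t, Leg Ty L k t ∧ (∀ i, NF Ty exF L i → L (fv i) = k → i ∈ t) ∧
    (∀ i, NP Ty exP L i → L (pv i) = k → i ∈ t) ∧ ∀ i, req k i → i ∈ t
  nf : ∀ i, NF Ty exF L i → L (fv i) ≠ h
  np : ∀ i, NP Ty exP L i → L (pv i) ≠ l

theorem lineB [Finite I] (l h : ℕ) (hl : Even l) (hh : Even h) (exF exP : I → Prop) (L : K I → ℕ)
    (req : ℕ → I → Prop) (H : LineOK Ty l h exF exP L req) (g : ℕ → ℝ) (hg : StrictMono g) :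
    ∃ lab : ℝ → Set I, LineR Ty (g l) (g h) exF exP (fun k => g (L k)) lab ∧
      ∀ k, Even k → l < k → k < h → ∀ i, req k i → i ∈ lab (g k) := by
  classical
  obtain ⟨sh, hsh⟩ := exists_shuffle
  obtain ⟨dec, hdec⟩ := exists_surjective_nat (Set I)
  have hleg := H.leg
  choose! t ht1 ht2 ht3 ht4 using hleg
  have kpe : ∀ e, KP g (g e) e := fun e e' _ => ⟨hg.lt_iff_lt.symm, hg.lt_iff_lt.symm⟩
  have key : ∀ y, ∃ T, g l < y → y < g h → Leg Ty (fun k => g (L k)) y T ∧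
      (∀ e, Even e → y = g e → T = t e) ∧
      ((∀ e, Even e → y ≠ g e) → Leg Ty (fun k => g (L k)) y (dec (sh y)) → T = dec (sh y)) := by
    intro y
    by_cases hy : g l < y ∧ y < g h
    swap
    · exact ⟨∅, fun a b => absurd ⟨a, b⟩ hy⟩
    obtain ⟨hy1, hy2⟩ := hy
    by_cases he : ∃ e, Even e ∧ y = g e
    · obtain ⟨e, he, rfl⟩ := he
      refine ⟨t e, fun _ _ => ⟨?_, ?_, ?_⟩⟩
      · rw [← leg_KP Ty g L H.ev _ e (kpe e)]
        exact ht1 e (hg.lt_iff_lt.1 hy1) (hg.lt_iff_lt.1 hy2)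
      · intro e' _ h; rw [hg.injective h]
      · intro h; exact absurd rfl (h e he)
    · push Not at he
      by_cases hd : Leg Ty (fun k => g (L k)) y (dec (sh y))
      · exact ⟨_, fun _ _ => ⟨hd, fun e h1 h2 => absurd h2 (he e h1), fun _ _ => rfl⟩⟩
      · obtain ⟨k, hk⟩ := exists_KP g hg l h hl hh y hy1.le hy2.le
        refine ⟨t k, fun _ _ => ⟨?_, fun e h1 h2 => absurd h2 (he e h1), fun _ h => absurd h hd⟩⟩
        rw [← leg_KP Ty g L H.ev _ k hk]
        exact ht1 k ((hk l hl).1.2 hy1) ((hk h hh).2.2 hy2)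
  choose lab hlab using key
  have lab1 := fun y a b => (hlab y a b).1
  have labe : ∀ e, Even e → l < e → e < h → lab (g e) = t e := fun e he a b =>
    (hlab (g e) (hg a) (hg b)).2.1 e he rfl
  have labd := fun y a b => (hlab y a b).2.2
  refine ⟨lab, ?_, ?_⟩
  swap
  · intro k hk h1 h2 i hr
    rw [labe k hk h1 h2]; exact ht4 k h1 h2 i hr
  -- dense witnesses in a gap (e, e+2)
  have gap : ∀ e, Even e → l ≤ e → e + 2 ≤ h → ∀ T, Leg Ty L (e+1) T → ∀ x x', x < x' →
      g e ≤ x → x' ≤ g (e+2) → ∃ z, x < z ∧ z < x' ∧ lab z = T := by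
    intro e he h1 h2 T hT x x' hx hx1 hx2
    obtain ⟨n, hn⟩ := hdec T
    obtain ⟨z, hz1, hz2, hz3⟩ := hsh n x x' hx
    have z1 : g e < z := hx1.trans_lt hz1
    have z2 : z < g (e+2) := hz2.trans_le hx2
    have kp : KP g z (e+1) := by
      intro e' he'
      rcases le_or_gt e' e with h3 | h3
      · have : g e' < z := (hg.monotone h3).trans_lt z1
        exact ⟨⟨fun _ => this, fun _ => by omega⟩, ⟨fun _ => by omega, fun h => absurd h (not_lt.2 this.le)⟩⟩
      · have h4 : e + 2 ≤ e' := by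
          obtain ⟨a, ha⟩ := he; obtain ⟨b, hb⟩ := he'; omega
        have : z < g e' := z2.trans_le (hg.monotone h4)
        exact ⟨⟨fun _ => by omega, fun h => absurd h (not_lt.2 this.le)⟩, ⟨fun _ => this, fun _ => by omega⟩⟩
    refine ⟨z, hz1, hz2, ?_⟩
    rw [labd z ((hg.monotone h1).trans_lt z1) (z2.trans_le (hg.monotone h2)), hz3, hn]
    · intro e' he' h
      have := kp e' he'
      subst h
      obtain ⟨a, ha⟩ := he; obtain ⟨b, hb⟩ := he'
      rcases lt_trichotomy e' (e+1) with h | h | h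
      · exact lt_irrefl _ (this.1.1 h)
      · omega
      · exact lt_irrefl _ (this.2.1 h)
    · rw [hz3, hn, ← leg_KP Ty g L H.ev _ _ kp]; exact hT
  refine ⟨fun i => hg.monotone (H.fofv i), fun i => hg.monotone (H.pvpo i),
    fun k => hg.monotone (H.cl k), fun k => hg.monotone (H.cu k), fun y a b => (lab1 y a b).1,
    fun y a b i hi => ((lab1 y a b).2 i hi).2, fun y a b i hi => ((lab1 y a b).2 i hi).1, ?_, ?_⟩
  · intro i y h1 h2 h3
    by_cases hx : exF i
    · exact Or.inl hx
    right
    have lt : L (fo i) < L (fv i) := hg.lt_iff_lt.1 (h2.trans_lt h3)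
    have hl1 := H.cl (fo i)
    have hu1 := H.cu (fv i)
    by_cases hgp : ∃ t, Leg Ty L (L (fv i) - 1) t ∧ i ∈ t
    · obtain ⟨T, hT, hiT⟩ := hgp
      obtain ⟨a, ha⟩ := H.ev (fv i)
      obtain ⟨b, hb⟩ := hl
      have ea : L (fv i) - 2 + 2 = L (fv i) := by omega
      obtain ⟨z, z1, z2, z3⟩ := gap (L (fv i) - 2) ⟨a - 1, by omega⟩ (by omega) (by omega) T
        (by rwa [show L (fv i) - 2 + 1 = L (fv i) - 1 by omega])
        (max y (g (L (fv i) - 2))) (g (L (fv i))) (max_lt h3 (hg (by omega))) (le_max_right _ _)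
        (by rw [ea])
      exact ⟨z, (le_max_left _ _).trans_lt z1, z2.trans_le (hg.monotone hu1), z3 ▸ hiT⟩
    · have hnf : NF Ty exF L i := ⟨lt, hx, hgp⟩
      have h4 := H.nf i hnf
      refine ⟨g (L (fv i)), h3, hg (by omega), ?_⟩
      rw [labe _ (H.ev _) (by omega) (by omega)]
      exact ht2 _ (by omega) (by omega) i hnf rfl
  · intro i y h1 h2 h3
    by_cases hx : exP i
    · exact Or.inl hx
    right
    have lt : L (pv i) < L (po i) := hg.lt_iff_lt.1 (h3.trans_le h2)
    have hl1 := H.cl (pv i)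
    have hu1 := H.cu (po i)
    by_cases hgp : ∃ t, Leg Ty L (L (pv i) + 1) t ∧ i ∈ t
    · obtain ⟨T, hT, hiT⟩ := hgp
      obtain ⟨a, ha⟩ := H.ev (pv i)
      obtain ⟨b, hb⟩ := H.ev (po i)
      obtain ⟨z, z1, z2, z3⟩ := gap (L (pv i)) (H.ev _) (by omega) (by omega) T hT
        (g (L (pv i))) (min y (g (L (pv i) + 2))) (lt_min h3 (hg (by omega))) le_rfl
        (min_le_right _ _)
      exact ⟨z, (hg.monotone hl1).trans_lt z1, z2.trans_le (min_le_left _ _), z3 ▸ hiT⟩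
    · have hnf : NP Ty exP L i := ⟨lt, hx, hgp⟩
      have h4 := H.np i hnf
      refine ⟨g (L (pv i)), hg (by omega), h3, ?_⟩
      rw [labe _ (H.ev _) (by omega) (by omega)]
      exact ht3 _ (by omega) (by omega) i hnf rfl

end
end HP

namespace HP
open J K

structure PSys (I : Type) where
  S : Type
  T : Type
  cfg : S → Bool → J I → ℕ
  E : S → Bool → Bool → Prop
  ρ : S → ℕ
  tcfg : T → J I → ℕ

section
variable {I : Type} (Ty : Set I → Set I → Set I → Prop) (Q : PSys I)

def Evolves (s s1 : Q.S) (d side : Bool) (strict : Prop) : Prop :=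
  SameK (Q.cfg s) (Q.cfg s1) →
    (∀ a b, Q.E s1 a b → Q.E s a b ∧ ¬ (a = d ∧ b = side)) ∧
    ((∀ a b, ¬ Q.E s a b) → ¬ Filled Ty (Q.cfg s) → Q.ρ s1 ≤ Q.ρ s ∧ (strict → Q.ρ s1 < Q.ρ s))

structure Split (s : Q.S) (d : Bool) (C : Bool → J I → ℕ) (z : ℕ) (L : K I → ℕ)
    (req : ℕ → I → Prop) (strict : Prop) : Prop where
  oeq : ∀ a, OEq (Q.cfg s a) (C a)
  ev : ∀ a j, Even (C a j)
  zlo : C d lo < z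
  zhi : z < C d hi
  line : LineOK Ty (C (!d) lo) (C (!d) hi) (fun i => z ≤ C d (ff i)) (fun i => C d (np i) ≤ z) L req
  ch : ∃ s1 s2, (Q.cfg s1 = ch1 C d z L ∧ Evolves Ty Q s s1 d true strict) ∧
    (Q.cfg s2 = ch2 C d z L ∧ Evolves Ty Q s s2 d false strict)

structure TSplit (θ : Q.T) (A : J I → ℕ) (z : ℕ) (Lh Lv : K I → ℕ)
    (reqh reqv : ℕ → I → Prop) : Prop where
  oeq : OEq (Q.tcfg θ) A
  ev : ∀ j, Even (A j)
  ez : Even z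
  zlo : A lo < z
  zhi : z < A hi
  lineh : LineOK Ty (A lo) z (fun _ => False) (fun i => A (np i) ≤ z) Lh reqh
  linev : LineOK Ty z (A hi) (fun i => z ≤ A (ff i)) (fun _ => False) Lv reqv
  ch : ∃ θ1 θ2 s, Q.tcfg θ1 = tri1 A z Lh ∧ Q.tcfg θ2 = tri2 A z Lv ∧ Q.cfg s = triR A z Lh Lv

def noReq : ℕ → I → Prop := fun _ _ => False
def oneReq (k0 : ℕ) (i0 : I) : ℕ → I → Prop := fun k i => k = k0 ∧ i = i0

structure Good : Prop where
  ev : ∀ s a j, Even (Q.cfg s a j)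
  tev : ∀ s j, Even (Q.tcfg s j)
  cst : ∀ s, Cst (Q.cfg s)
  tcst : ∀ s, TCst (Q.tcfg s)
  rv : ∀ s d k, Q.cfg s d lo < k → k < Q.cfg s d hi → ∃ C z L, RPos (Q.cfg s d) k (C d) z ∧
    Split Ty Q s d C z L noReq False
  rcf : ∀ s e i k, Q.cfg s e lo ≤ k → k < Q.cfg s e (nf i) → Q.cfg s e (ff i) ≤ k →
    Q.cfg s (!e) (ff i) ≤ Q.cfg s (!e) lo → ∃ C z L k' k0, RPos (Q.cfg s e) k (C e) k' ∧
      Even k0 ∧ k' < k0 ∧ k0 < C e hi ∧ Split Ty Q s (!e) C z L (oneReq k0 i) False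
  rcp : ∀ s e i k, k ≤ Q.cfg s e hi → Q.cfg s e (fp i) < k → k ≤ Q.cfg s e (np i) →
    Q.cfg s (!e) hi ≤ Q.cfg s (!e) (np i) → ∃ C z L k' k0, RPos (Q.cfg s e) k (C e) k' ∧
      Even k0 ∧ k0 < k' ∧ C e lo < k0 ∧ Split Ty Q s (!e) C z L (oneReq k0 i) False
  rr : ∀ s, ¬ Filled Ty (Q.cfg s) → (∀ a b, ¬ Q.E s a b) → ∃ d C z L, Split Ty Q s d C z L noReq True
  tv : ∀ s k, Q.tcfg s lo < k → k < Q.tcfg s hi → ∃ C z Lh Lv, RPos (Q.tcfg s) k C z ∧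
    TSplit Ty Q s C z Lh Lv noReq noReq
  tcf : ∀ s i k, Q.tcfg s lo ≤ k → k < Q.tcfg s (nf i) → Q.tcfg s (ff i) ≤ Q.tcfg s lo →
    ∃ C z Lh Lv k' k0, RPos (Q.tcfg s) k C k' ∧ Even k0 ∧ k' < k0 ∧ z < k0 ∧ k0 < C hi ∧
      TSplit Ty Q s C z Lh Lv noReq (oneReq k0 i)
  tcp : ∀ s i k, k ≤ Q.tcfg s hi → Q.tcfg s (fp i) < k → Q.tcfg s hi ≤ Q.tcfg s (np i) →
    ∃ C z Lh Lv k' k0, RPos (Q.tcfg s) k C k' ∧ Even k0 ∧ k0 < k' ∧ C lo < k0 ∧ k0 < z ∧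
      TSplit Ty Q s C z Lh Lv (oneReq k0 i) noReq

/-! order-equivalence transfer -/
section oeq
variable {α β : Type} [LinearOrder α] [LinearOrder β]

theorem OEq.le {ι : Type} {A : ι → α} {B : ι → β} (h : OEq A B) (x y) : A x ≤ A y ↔ B x ≤ B y := by
  rw [← not_lt, ← not_lt, h]
theorem OEq.eq {ι : Type} {A : ι → α} {B : ι → β} (h : OEq A B) (x y) : A x = A y ↔ B x = B y := by
  rw [le_antisymm_iff, le_antisymm_iff, h.le, h.le]
theorem OEq.symm {ι : Type} {A : ι → α} {B : ι → β} (h : OEq A B) : OEq B A := fun x y => (h x y).symm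

theorem OEq.cst {A : Bool → J I → α} {B : Bool → J I → β} (h : ∀ a, OEq (A a) (B a)) (c : Cst A) : Cst B := by
  refine ⟨fun a => ?_, fun a j => ?_, fun a j => ?_, fun a i => ?_, fun a i => ?_, fun a i => ?_,
    fun a i => ?_, fun a i => ?_, fun a i => ?_⟩ <;>
    simp only [← (h _).eq, ← (h _).le, ← h _ _ _]
  · exact c.lh a
  · exact c.cl a j
  · exact c.cu a j
  · exact c.fn a i
  · exact c.pn a i
  · exact c.c1F a i
  · exact c.c1P a i
  · exact c.c0F a i
  · exact c.c0P a i

theorem OEq.tcst {A : J I → α} {B : J I → β} (h : OEq A B) (c : TCst A) : TCst B := by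
  refine ⟨?_, fun j => ?_, fun j => ?_, fun i => ?_, fun i => ?_⟩ <;>
    simp only [← h.eq, ← h.le, ← h _ _]
  · exact c.lh
  · exact c.cl j
  · exact c.cu j
  · exact c.t1F i
  · exact c.t1P i

theorem OEq.kBot {A : Bool → J I → α} {B : Bool → J I → β} (h : ∀ a, OEq (A a) (B a)) :
    kBot A = kBot B := by simp only [HP.kBot, h _ _ _]
theorem OEq.kPt {A : Bool → J I → α} {B : Bool → J I → β} (h : ∀ a, OEq (A a) (B a)) :
    kPt A = kPt B := by simp only [HP.kPt, h _ _ _]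
theorem OEq.kTop {A : Bool → J I → α} {B : Bool → J I → β} (h : ∀ a, OEq (A a) (B a)) :
    kTop A = kTop B := by simp only [HP.kTop, (h _).le]
theorem OEq.kPb {A : Bool → J I → α} {B : Bool → J I → β} (h : ∀ a, OEq (A a) (B a)) :
    kPb A = kPb B := by simp only [HP.kPb, (h _).le]
theorem OEq.sameK {A : Bool → J I → α} {B : Bool → J I → β} (h : ∀ a, OEq (A a) (B a)) :
    SameK A B := ⟨OEq.kBot h, OEq.kTop h, OEq.kPb h, OEq.kPt h⟩
theorem SameK.filled {A : Bool → J I → α} {B : Bool → J I → β} (h : SameK A B) :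
    Filled Ty A ↔ Filled Ty B := by
  simp only [Filled, h.bot, h.top, h.pb, h.pt]
theorem SameK.symm {A : Bool → J I → α} {B : Bool → J I → β} (h : SameK A B) : SameK B A :=
  ⟨h.bot.symm, h.top.symm, h.pb.symm, h.pt.symm⟩
theorem SameK.trans {γ : Type} [LinearOrder γ] {A : Bool → J I → α} {B : Bool → J I → β}
    {C : Bool → J I → γ} (h : SameK A B) (h' : SameK B C) : SameK A C :=
  ⟨h.bot.trans h'.bot, h.top.trans h'.top, h.pb.trans h'.pb, h.pt.trans h'.pt⟩

end oeq

instance [Finite I] : Finite (J I) := by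
  have : Function.Surjective (fun x : Bool ⊕ (Fin 4 × I) => match x with
    | .inl true => (J.lo : J I) | .inl false => J.hi | .inr (0, i) => nf i | .inr (1, i) => ff i
    | .inr (2, i) => np i | .inr (3, i) => fp i) := by
    rintro (_ | _ | i | i | i | i)
    · exact ⟨.inl true, rfl⟩
    · exact ⟨.inl false, rfl⟩
    · exact ⟨.inr (0, i), rfl⟩
    · exact ⟨.inr (1, i), rfl⟩
    · exact ⟨.inr (2, i), rfl⟩
    · exact ⟨.inr (3, i), rfl⟩
  exact Finite.of_surjective _ this

/-- extension including extra points -/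
theorem ext_pos {ι : Type} [Finite ι] (A : ι → ℝ) (B : ι → ℕ) (h : OEq A B) (y : ℝ) (k : ℕ)
    (hy : RPos A y B k) : ∃ g : ℕ → ℝ, StrictMono g ∧ (∀ x, g (B x) = A x) ∧ g k = y := by
  obtain ⟨g, h1, h2⟩ := exists_ext (fun o : Option ι => o.elim y A) (fun o => o.elim k B) (by
    rintro (_ | x) (_ | x')
    · simp
    · exact (hy x').2
    · exact (hy x).1
    · exact h x x')
  exact ⟨g, h1, fun x => h2 (some x), h2 none⟩

/-- position of a real in a configuration -/
theorem exists_pos (A : J I → ℝ) (B : J I → ℕ) [Finite I] (h : OEq A B) (ev : ∀ j, Even (B j)) (y : ℝ)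
    (h1 : A lo ≤ y) (h2 : y ≤ A hi) : ∃ k, RPos A y B k := by
  obtain ⟨g, g1, g2⟩ := exists_ext A B h
  obtain ⟨k, hk⟩ := exists_KP g g1 (B lo) (B hi) (ev _) (ev _) y (by rwa [g2]) (by rwa [g2])
  refine ⟨k, fun j => ?_⟩
  have := hk (B j) (ev j)
  rw [g2] at this
  exact ⟨this.1.symm, this.2.symm⟩

theorem RPos.trans' {ι α β γ : Type} [LinearOrder α] [LinearOrder β] [LinearOrder γ]
    {A : ι → α} {x : α} {B : ι → β} {y : β} {C : ι → γ} {z : γ} (h : RPos A x B y) (h' : RPos B y C z) :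
    RPos A x C z := fun j => ⟨(h j).1.trans (h' j).1, (h j).2.trans (h' j).2⟩

theorem RPos.self {ι α β : Type} [LinearOrder α] [LinearOrder β]
    {A : ι → α} {B : ι → β} (h : OEq A B) (x) : RPos A (A x) B (B x) := fun j => ⟨h _ _, h _ _⟩

/-- a realised split -/
structure RStep (C : Bool → J I → ℝ) (s : Q.S) where
  d : Bool
  z : ℝ
  L : K I → ℝ
  lab : ℝ → Set I
  s1 : Q.S
  s2 : Q.S
  zlo : C d lo < z
  zhi : z < C d hi
  line : LineR Ty (C (!d) lo) (C (!d) hi) (fun i => z ≤ C d (ff i)) (fun i => C d (np i) ≤ z) L lab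
  o1 : ∀ a, OEq (ch1 C d z L a) (Q.cfg s1 a)
  o2 : ∀ a, OEq (ch2 C d z L a) (Q.cfg s2 a)

structure TStep (A : J I → ℝ) (θ : Q.T) where
  z : ℝ
  Lh : K I → ℝ
  Lv : K I → ℝ
  labh : ℝ → Set I
  labv : ℝ → Set I
  θ1 : Q.T
  θ2 : Q.T
  s : Q.S
  zlo : A lo < z
  zhi : z < A hi
  lineh : LineR Ty (A lo) z (fun _ => False) (fun i => A (np i) ≤ z) Lh labh
  linev : LineR Ty z (A hi) (fun i => z ≤ A (ff i)) (fun _ => False) Lv labv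
  o1 : OEq (tri1 A z Lh) (Q.tcfg θ1)
  o2 : OEq (tri2 A z Lv) (Q.tcfg θ2)
  o3 : ∀ a, OEq (triR A z Lh Lv a) (Q.cfg s a)

theorem setFar_map {α β : Type} (g : α → β) (A : J I → α) (L : K I → α) (j) :
    setFar (fun j => g (A j)) (fun k => g (L k)) j = g (setFar A L j) := by
  cases j <;> rfl
theorem setNear_map {α β : Type} (g : α → β) (A : J I → α) (L : K I → α) (j) :
    setNear (fun j => g (A j)) (fun k => g (L k)) j = g (setNear A L j) := by
  cases j <;> rfl

variable {Ty Q}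

theorem Split.real [Finite I] {C : Bool → J I → ℝ} {s : Q.S} {d C' z' L' req strict}
    (h : Split Ty Q s d C' z' L' req strict)
    (g : Bool → ℕ → ℝ) (hg : ∀ a, StrictMono (g a)) (hC : ∀ a j, g a (C' a j) = C a j) :
    ∃ st : RStep Ty Q C s, st.d = d ∧ st.z = g d z' ∧ Evolves Ty Q s st.s1 d true strict ∧
      Evolves Ty Q s st.s2 d false strict ∧
      ∀ k, Even k → C' (!d) lo < k → k < C' (!d) hi → ∀ i, req k i → i ∈ st.lab (g (!d) k) := by
  obtain ⟨lab, hl, hr⟩ := lineB Ty _ _ (h.ev _ _) (h.ev _ _) _ _ _ _ h.line (g (!d)) (hg _)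
  obtain ⟨s1, s2, ⟨h1, e1⟩, h2, e2⟩ := h.ch
  have hCf : ∀ a, C a = fun j => g a (C' a j) := fun a => funext fun j => (hC a j).symm
  refine ⟨⟨d, g d z', fun k => g (!d) (L' k), lab, s1, s2, ?_, ?_, ?_, ?_, ?_⟩, rfl, rfl, e1, e2, hr⟩
  · rw [← hC]; exact hg _ h.zlo
  · rw [← hC]; exact hg _ h.zhi
  · simp only [← hC, (hg _).le_iff_le]; exact hl
  · intro a x y
    rw [h1]
    rcases bool_cases a d with rfl | rfl
    · simp only [ch1, if_true, ← hC, ← (hg a).monotone.map_min, (hg a).lt_iff_lt]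
    · simp only [ch1, Bool.not_eq_self, if_false, hCf, setFar_map, (hg (!d)).lt_iff_lt]
  · intro a x y
    rw [h2]
    rcases bool_cases a d with rfl | rfl
    · simp only [ch2, if_true, ← hC, ← (hg a).monotone.map_max, (hg a).lt_iff_lt]
    · simp only [ch2, Bool.not_eq_self, if_false, hCf, setNear_map, (hg (!d)).lt_iff_lt]

theorem TSplit.real [Finite I] {A : J I → ℝ} {θ : Q.T} {A' z' Lh' Lv' reqh reqv}
    (h : TSplit Ty Q θ A' z' Lh' Lv' reqh reqv)
    (g : ℕ → ℝ) (hg : StrictMono g) (hA : ∀ j, g (A' j) = A j) :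
    ∃ st : TStep Ty Q A θ, st.z = g z' ∧
      (∀ k, Even k → A' lo < k → k < z' → ∀ i, reqh k i → i ∈ st.labh (g k)) ∧
      (∀ k, Even k → z' < k → k < A' hi → ∀ i, reqv k i → i ∈ st.labv (g k)) := by
  obtain ⟨labh, hlh, hrh⟩ := lineB Ty _ _ (h.ev _) h.ez _ _ _ _ h.lineh g hg
  obtain ⟨labv, hlv, hrv⟩ := lineB Ty _ _ h.ez (h.ev _) _ _ _ _ h.linev g hg
  obtain ⟨θ1, θ2, s, h1, h2, h3⟩ := h.ch
  obtain rfl : A = fun j => g (A' j) := funext fun j => (hA j).symm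
  refine ⟨⟨g z', fun k => g (Lh' k), fun k => g (Lv' k), labh, labv, θ1, θ2, s, hg h.zlo, hg h.zhi,
    ?_, ?_, ?_, ?_, ?_⟩, rfl, hrh, hrv⟩
  · simp only [hg.le_iff_le]; exact hlh
  · simp only [hg.le_iff_le]; exact hlv
  · intro x y
    rw [h1]; simp only [tri1, ← hg.monotone.map_min]
    simp only [setFar_map, hg.lt_iff_lt]
  · intro x y
    rw [h2]; simp only [tri2, ← hg.monotone.map_max]
    simp only [setNear_map, hg.lt_iff_lt]
  · intro a x y
    rw [h3]
    cases a
    · simp only [triR, ← hg.monotone.map_min, Bool.false_eq_true, if_false]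
      simp only [setNear_map, hg.lt_iff_lt]
    · simp only [triR, ← hg.monotone.map_max, if_true]
      simp only [setFar_map, hg.lt_iff_lt]

end
end HP

namespace HP
open J K
section
variable {I : Type} {Ty : Set I → Set I → Set I → Prop} {Q : PSys I}

abbrev Task (I : Type) := Bool ⊕ (Bool × Bool × I × Option ℚ) ⊕ Unit

def yOf (o : Option ℚ) (x : ℝ) : ℝ := o.elim x (fun q => (q:ℝ))

def TaskOK : Task I → (C : Bool → J I → ℝ) → (s : Q.S) → RStep Ty Q C s → Prop
  | .inl a, C, _, st => st.d = a ∧ st.z = (C a lo + C a hi)/2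
  | .inr (.inl (true, e, i, o)), C, _, st => C e lo ≤ yOf o (C e lo) → yOf o (C e lo) < C e (nf i) →
      C e (ff i) ≤ yOf o (C e lo) → C (!e) (ff i) ≤ C (!e) lo →
      st.d = !e ∧ ∃ y', yOf o (C e lo) < y' ∧ C e lo < y' ∧ y' < C e hi ∧ i ∈ st.lab y'
  | .inr (.inl (false, e, i, o)), C, _, st => yOf o (C e hi) ≤ C e hi → C e (fp i) < yOf o (C e hi) →
      yOf o (C e hi) ≤ C e (np i) → C (!e) hi ≤ C (!e) (np i) →
      st.d = !e ∧ ∃ y', y' < yOf o (C e hi) ∧ C e lo < y' ∧ y' < C e hi ∧ i ∈ st.lab y'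
  | .inr (.inr _), C, s, st => (∀ a b, ¬ Q.E s a b) → ¬ Filled Ty C →
      Evolves Ty Q s st.s1 st.d true True ∧ Evolves Ty Q s st.s2 st.d false True

def TTaskOK : Task I → (A : J I → ℝ) → (θ : Q.T) → TStep Ty Q A θ → Prop
  | .inl _, A, _, st => st.z = (A lo + A hi)/2
  | .inr (.inl (true, _, i, o)), A, _, st => A lo ≤ yOf o (A lo) → yOf o (A lo) < A (nf i) →
      A (ff i) ≤ A lo → ∃ y', yOf o (A lo) < y' ∧ st.z < y' ∧ y' < A hi ∧ i ∈ st.labv y'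
  | .inr (.inl (false, _, i, o)), A, _, st => yOf o (A hi) ≤ A hi → A (fp i) < yOf o (A hi) →
      A hi ≤ A (np i) → ∃ y', y' < yOf o (A hi) ∧ A lo < y' ∧ y' < st.z ∧ i ∈ st.labh y'
  | .inr (.inr _), _, _, _ => True

theorem Evolves.weak {s s1 : Q.S} {d side} {strict : Prop} (h : Evolves Ty Q s s1 d side strict) :
    Evolves Ty Q s s1 d side False := fun hk => ⟨(h hk).1, fun a b => ⟨((h hk).2 a b).1, False.elim⟩⟩

theorem exists_ext2 {C : Bool → J I → ℝ} {C' : Bool → J I → ℕ} [Finite I] (h : ∀ a, OEq (C a) (C' a))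
    (e : Bool) (y : ℝ) (k : ℕ) (hy : RPos (C e) y (C' e) k) :
    ∃ g : Bool → ℕ → ℝ, (∀ a, StrictMono (g a)) ∧ (∀ a j, g a (C' a j) = C a j) ∧ g e k = y := by
  obtain ⟨g0, a1, a2, a3⟩ := ext_pos _ _ (h e) y k hy
  obtain ⟨g1, b1, b2⟩ := exists_ext _ _ (h (!e))
  refine ⟨fun a => if a = e then g0 else g1, fun a => ?_, fun a j => ?_, by simpa using a3⟩
  · rcases bool_cases a e with rfl | rfl
    · simpa using a1
    · simpa using b1
  · rcases bool_cases a e with rfl | rfl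
    · simpa using a2 j
    · simpa using b2 j

theorem OEq.trans {ι α β γ : Type} [LinearOrder α] [LinearOrder β] [LinearOrder γ]
    {A : ι → α} {B : ι → β} {C : ι → γ} (h : OEq A B) (h' : OEq B C) : OEq A C :=
  fun x y => (h x y).trans (h' x y)

theorem step_exists [Finite I] (G : Good Ty Q) (t : Task I) (C : Bool → J I → ℝ) (s : Q.S)
    (h : ∀ a, OEq (C a) (Q.cfg s a)) : ∃ st : RStep Ty Q C s, TaskOK t C s st ∧
      Evolves Ty Q s st.s1 st.d true False ∧ Evolves Ty Q s st.s2 st.d false False := by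
  have hc : Cst C := OEq.cst (fun a => (h a).symm) (G.cst s)
  have hmid : ∀ a, ∃ st : RStep Ty Q C s, (st.d = a ∧ st.z = (C a lo + C a hi)/2) ∧
      Evolves Ty Q s st.s1 st.d true False ∧ Evolves Ty Q s st.s2 st.d false False := by
    intro a
    have hl := hc.lh a
    obtain ⟨k, hk⟩ := exists_pos (C a) _ (h a) (G.ev s a) ((C a lo + C a hi)/2) (by linarith) (by linarith)
    obtain ⟨C', z, L, h1, h2⟩ := G.rv s a k ((hk lo).1.1 (by linarith)) ((hk J.hi).2.1 (by linarith))
    obtain ⟨g, g1, g2, g3⟩ := exists_ext2 (fun b => (h b).trans (h2.oeq b)) a _ _ (hk.trans' h1)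
    obtain ⟨st, s1, s2, s3, s4, _⟩ := h2.real g g1 g2
    refine ⟨st, ⟨s1, by rw [s2, g3]⟩, ?_, ?_⟩
    · rw [s1]; exact s3
    · rw [s1]; exact s4
  have fall : (∀ st : RStep Ty Q C s, TaskOK t C s st) → ∃ st : RStep Ty Q C s, TaskOK t C s st ∧
      Evolves Ty Q s st.s1 st.d true False ∧ Evolves Ty Q s st.s2 st.d false False := by
    intro hs
    obtain ⟨st, _, b⟩ := hmid true
    exact ⟨st, hs st, b⟩
  rcases t with a | ⟨b, e, i, o⟩ | u
  · exact hmid a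
  · cases b
    · by_cases hy : (yOf o (C e hi) ≤ C e hi ∧ C e (fp i) < yOf o (C e hi) ∧
        yOf o (C e hi) ≤ C e (np i) ∧ C (!e) hi ≤ C (!e) (np i))
      swap
      · exact fall fun st a b c d => absurd ⟨a, b, c, d⟩ hy
      obtain ⟨y1, y2, y3, y4⟩ := hy
      set y := yOf o (C e hi)
      have := hc.cl e (fp i)
      obtain ⟨k, hk⟩ := exists_pos (C e) _ (h e) (G.ev s e) y (by linarith) y1
      obtain ⟨C', z, L, k', k0, h1, h2, h3, h4, h5⟩ := G.rcp s e i k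
        (by rw [← not_lt, ← (hk _).1, not_lt]; exact y1) ((hk _).1.1 y2)
        (by rw [← not_lt, ← (hk _).1, not_lt]; exact y3) ((h (!e)).le _ _ |>.1 y4)
      obtain ⟨g, g1, g2, g3⟩ := exists_ext2 (fun b => (h b).trans (h5.oeq b)) e _ _ (hk.trans' h1)
      obtain ⟨st, s1, s2, s3, s4, s5⟩ := h5.real g g1 g2
      rw [Bool.not_not] at s5
      have q1 : g e k0 < y := g3 ▸ g1 e h3
      have q2 : C e lo < g e k0 := g2 e lo ▸ g1 e h4
      refine ⟨st, fun _ _ _ _ => ⟨s1, g e k0, q1, q2, q1.trans_le y1,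
        s5 k0 h2 h4 ?_ i ⟨rfl, rfl⟩⟩, ?_, ?_⟩
      · rw [← (g1 e).lt_iff_lt, g2]; exact q1.trans_le y1
      · rw [s1]; exact s3
      · rw [s1]; exact s4
    · by_cases hy : (C e lo ≤ yOf o (C e lo) ∧ yOf o (C e lo) < C e (nf i) ∧
        C e (ff i) ≤ yOf o (C e lo) ∧ C (!e) (ff i) ≤ C (!e) lo)
      swap
      · exact fall fun st a b c d => absurd ⟨a, b, c, d⟩ hy
      obtain ⟨y1, y2, y3, y4⟩ := hy
      set y := yOf o (C e lo)
      have := hc.cu e (nf i)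
      obtain ⟨k, hk⟩ := exists_pos (C e) _ (h e) (G.ev s e) y y1 (by linarith)
      obtain ⟨C', z, L, k', k0, h1, h2, h3, h4, h5⟩ := G.rcf s e i k
        (by rw [← not_lt, ← (hk _).2, not_lt]; exact y1) ((hk _).2.1 y2)
        (by rw [← not_lt, ← (hk _).2, not_lt]; exact y3) ((h (!e)).le _ _ |>.1 y4)
      obtain ⟨g, g1, g2, g3⟩ := exists_ext2 (fun b => (h b).trans (h5.oeq b)) e _ _ (hk.trans' h1)
      obtain ⟨st, s1, s2, s3, s4, s5⟩ := h5.real g g1 g2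
      rw [Bool.not_not] at s5
      have q1 : y < g e k0 := g3 ▸ g1 e h3
      have q2 : g e k0 < C e hi := g2 e J.hi ▸ g1 e h4
      refine ⟨st, fun _ _ _ _ => ⟨s1, g e k0, q1, y1.trans_lt q1, q2,
        s5 k0 h2 ?_ h4 i ⟨rfl, rfl⟩⟩, ?_, ?_⟩
      · rw [← (g1 e).lt_iff_lt, g2]; exact y1.trans_lt q1
      · rw [s1]; exact s3
      · rw [s1]; exact s4
  · by_cases hy : (∀ a b, ¬ Q.E s a b) ∧ ¬ Filled Ty C
    swap
    · exact fall fun st a b => absurd ⟨a, b⟩ hy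
    obtain ⟨d, C', z, L, h5⟩ := G.rr s (fun hf => hy.2 (((OEq.sameK h).filled Ty).2 hf)) hy.1
    obtain ⟨g, g1, g2, g3⟩ := exists_ext2 (fun b => (h b).trans (h5.oeq b)) d _ _ (RPos.self ((h d).trans (h5.oeq d)) lo)
    obtain ⟨st, s1, s2, s3, s4, s5⟩ := h5.real g g1 g2
    rw [← s1] at s3 s4
    exact ⟨st, fun _ _ => ⟨s3, s4⟩, s3.weak, s4.weak⟩

theorem tstep_exists [Finite I] (G : Good Ty Q) (t : Task I) (C : J I → ℝ) (s : Q.T)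
    (h : OEq C (Q.tcfg s)) : ∃ st : TStep Ty Q C s, TTaskOK t C s st := by
  have hc : TCst C := OEq.tcst h.symm (G.tcst s)
  have hl := hc.lh
  have hmid : ∃ st : TStep Ty Q C s, (st.z = (C lo + C hi)/2) := by
    obtain ⟨k, hk⟩ := exists_pos C _ h (G.tev s) ((C lo + C hi)/2) (by linarith) (by linarith)
    obtain ⟨C', z, Lh, Lv, h1, h2⟩ := G.tv s k ((hk lo).1.1 (by linarith)) ((hk J.hi).2.1 (by linarith))
    obtain ⟨g, g1, g2, g3⟩ := ext_pos _ _ (h.trans h2.oeq) _ _ (hk.trans' h1)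
    obtain ⟨st, s1, _⟩ := h2.real g g1 g2
    exact ⟨st, by rw [s1, g3]⟩
  rcases t with a | ⟨b, e, i, o⟩ | u
  · exact hmid
  · cases b
    · by_cases hy : (yOf o (C hi) ≤ C hi ∧ C (fp i) < yOf o (C hi) ∧ C hi ≤ C (np i))
      swap
      · obtain ⟨st, _⟩ := hmid
        exact ⟨st, fun a b c => absurd ⟨a, b, c⟩ hy⟩
      obtain ⟨y1, y2, y4⟩ := hy
      set y := yOf o (C hi)
      have := hc.cl (fp i)
      obtain ⟨k, hk⟩ := exists_pos C _ h (G.tev s) y (by linarith) y1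
      obtain ⟨C', z, Lh, Lv, k', k0, h1, h2, h3, h4, h4', h5⟩ := G.tcp s i k
        (by rw [← not_lt, ← (hk _).1, not_lt]; exact y1) ((hk _).1.1 y2) (h.le _ _ |>.1 y4)
      obtain ⟨g, g1, g2, g3⟩ := ext_pos _ _ (h.trans h5.oeq) _ _ (hk.trans' h1)
      obtain ⟨st, s1, s2, s3⟩ := h5.real g g1 g2
      have q1 : g k0 < y := g3 ▸ g1 h3
      have q2 : C lo < g k0 := g2 lo ▸ g1 h4
      exact ⟨st, fun _ _ _ => ⟨g k0, q1, q2, s1 ▸ g1 h4', s2 k0 h2 h4 h4' i ⟨rfl, rfl⟩⟩⟩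
    · by_cases hy : (C lo ≤ yOf o (C lo) ∧ yOf o (C lo) < C (nf i) ∧ C (ff i) ≤ C lo)
      swap
      · obtain ⟨st, _⟩ := hmid
        exact ⟨st, fun a b c => absurd ⟨a, b, c⟩ hy⟩
      obtain ⟨y1, y2, y4⟩ := hy
      set y := yOf o (C lo)
      have := hc.cu (nf i)
      obtain ⟨k, hk⟩ := exists_pos C _ h (G.tev s) y y1 (by linarith)
      obtain ⟨C', z, Lh, Lv, k', k0, h1, h2, h3, h4', h4, h5⟩ := G.tcf s i k
        (by rw [← not_lt, ← (hk _).2, not_lt]; exact y1) ((hk _).2.1 y2) (h.le _ _ |>.1 y4)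
      obtain ⟨g, g1, g2, g3⟩ := ext_pos _ _ (h.trans h5.oeq) _ _ (hk.trans' h1)
      obtain ⟨st, s1, s2, s3⟩ := h5.real g g1 g2
      have q1 : y < g k0 := g3 ▸ g1 h3
      have q2 : g k0 < C hi := g2 J.hi ▸ g1 h4
      exact ⟨st, fun _ _ _ => ⟨g k0, q1, s1 ▸ g1 h4', q2, s3 k0 h2 h4' h4 i ⟨rfl, rfl⟩⟩⟩
  · obtain ⟨st, _⟩ := hmid
    exact ⟨st, trivial⟩

end
end HP

namespace HP
open J K
section
variable {I : Type} 

theorem inR_ch1 {C : Bool → J I → ℝ} {d z} (L : K I → ℝ) (zl : C d lo < z) (zh : z < C d hi) (p : Bool → ℝ) :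
    InR (ch1 C d z L) p ↔ InR C p ∧ p d < z := by
  constructor
  · intro h
    have hd := h d; have he := h (!d)
    simp only [ch1, if_true, min_eq_left zl.le, min_eq_right zh.le] at hd
    simp only [ch1, Bool.not_eq_self, if_false, setFar] at he
    refine ⟨fun a => ?_, hd.2⟩
    rcases bool_cases a d with rfl | rfl
    · exact ⟨hd.1, hd.2.trans zh⟩
    · exact he
  · rintro ⟨h, hz⟩ a
    rcases bool_cases a d with rfl | rfl
    · simp only [ch1, if_true, min_eq_left zl.le, min_eq_right zh.le]; exact ⟨(h _).1, hz⟩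
    · simp only [ch1, Bool.not_eq_self, if_false, setFar]; exact h _

theorem inR_ch2 {C : Bool → J I → ℝ} {d z} (L : K I → ℝ) (zl : C d lo < z) (zh : z < C d hi) (p : Bool → ℝ) :
    InR (ch2 C d z L) p ↔ InR C p ∧ z < p d := by
  constructor
  · intro h
    have hd := h d; have he := h (!d)
    simp only [ch2, if_true, max_eq_right zl.le, max_eq_left zh.le] at hd
    simp only [ch2, Bool.not_eq_self, if_false, setNear] at he
    refine ⟨fun a => ?_, hd.1⟩
    rcases bool_cases a d with rfl | rfl
    · exact ⟨zl.trans hd.1, hd.2⟩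
    · exact he
  · rintro ⟨h, hz⟩ a
    rcases bool_cases a d with rfl | rfl
    · simp only [ch2, if_true, max_eq_right zl.le, max_eq_left zh.le]; exact ⟨hz, (h _).2⟩
    · simp only [ch2, Bool.not_eq_self, if_false, setNear]; exact h _

theorem inT_tri1 {A : J I → ℝ} {z} (L : K I → ℝ) (zl : A lo < z) (zh : z < A hi) (p : Bool → ℝ) :
    InT (tri1 A z L) p ↔ InT A p ∧ p true < z := by
  simp only [InT, tri1, setFar, min_eq_left zl.le, min_eq_right zh.le]
  constructor
  · rintro ⟨a, b, c⟩; exact ⟨⟨a, b, c.trans zh⟩, c⟩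
  · rintro ⟨⟨a, b, c⟩, d⟩; exact ⟨a, b, d⟩
theorem inT_tri2 {A : J I → ℝ} {z} (L : K I → ℝ) (zl : A lo < z) (zh : z < A hi) (p : Bool → ℝ) :
    InT (tri2 A z L) p ↔ InT A p ∧ z < p false := by
  simp only [InT, tri2, setNear, max_eq_right zl.le, max_eq_left zh.le]
  constructor
  · rintro ⟨a, b, c⟩; exact ⟨⟨zl.trans a, b, c⟩, a⟩
  · rintro ⟨⟨a, b, c⟩, d⟩; exact ⟨d, b, c⟩
theorem inR_triR {A : J I → ℝ} {z} (Lh Lv : K I → ℝ) (zl : A lo < z) (zh : z < A hi) (p : Bool → ℝ) :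
    InR (triR A z Lh Lv) p ↔ InT A p ∧ p false < z ∧ z < p true := by
  simp only [InR, InT, Bool.forall_bool, triR, Bool.false_eq_true, if_false, if_true, setNear, setFar,
    max_eq_right zl.le, max_eq_left zh.le, min_eq_left zl.le, min_eq_right zh.le]
  constructor
  · rintro ⟨⟨a, b⟩, c, d⟩; exact ⟨⟨a, b.trans c, d⟩, b, c⟩
  · rintro ⟨⟨a, b, c⟩, d, e⟩; exact ⟨⟨a, d⟩, e, c⟩

variable {Ty : Set I → Set I → Set I → Prop} (Q : PSys I)
structure RN where
  C : Bool → J I → ℝ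
  s : Q.S
  h : ∀ a, OEq (C a) (Q.cfg s a)
structure TN where
  A : J I → ℝ
  s : Q.T
  h : OEq A (Q.tcfg s)
variable {Q}
variable (str : ∀ (_ : ℕ) (x : RN Q), RStep Ty Q x.C x.s) (stt : ∀ (_ : ℕ) (x : TN Q), TStep Ty Q x.A x.s)
  (rt : TN Q)

noncomputable def r1 (n : ℕ) (x : RN Q) : RN Q :=
  ⟨ch1 x.C (str n x).d (str n x).z (str n x).L, (str n x).s1, (str n x).o1⟩
noncomputable def r2 (n : ℕ) (x : RN Q) : RN Q :=
  ⟨ch2 x.C (str n x).d (str n x).z (str n x).L, (str n x).s2, (str n x).o2⟩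
noncomputable def u1 (n : ℕ) (x : TN Q) : TN Q :=
  ⟨tri1 x.A (stt n x).z (stt n x).Lh, (stt n x).θ1, (stt n x).o1⟩
noncomputable def u2 (n : ℕ) (x : TN Q) : TN Q :=
  ⟨tri2 x.A (stt n x).z (stt n x).Lv, (stt n x).θ2, (stt n x).o2⟩
noncomputable def ur (n : ℕ) (x : TN Q) : RN Q :=
  ⟨triR x.A (stt n x).z (stt n x).Lh (stt n x).Lv, (stt n x).s, (stt n x).o3⟩

inductive Reach : ℕ → TN Q ⊕ RN Q → Prop
  | root : Reach 0 (.inl rt)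
  | t1 {n x} : Reach n (.inl x) → Reach (n+1) (.inl (u1 stt n x))
  | t2 {n x} : Reach n (.inl x) → Reach (n+1) (.inl (u2 stt n x))
  | tr {n x} : Reach n (.inl x) → Reach (n+1) (.inr (ur stt n x))
  | r1 {n x} : Reach n (.inr x) → Reach (n+1) (.inr (r1 str n x))
  | r2 {n x} : Reach n (.inr x) → Reach (n+1) (.inr (r2 str n x))

def inN (p : Bool → ℝ) : TN Q ⊕ RN Q → Prop
  | .inl x => InT x.A p
  | .inr x => InR x.C p

open Classical in
noncomputable def nxt (p : Bool → ℝ) (n : ℕ) : TN Q ⊕ RN Q → Option (TN Q ⊕ RN Q)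
  | .inl x => if p true < (stt n x).z then some (.inl (u1 stt n x)) else
      if (stt n x).z < p false then some (.inl (u2 stt n x)) else
      if p false < (stt n x).z ∧ (stt n x).z < p true then some (.inr (ur stt n x)) else none
  | .inr x => if p (str n x).d < (str n x).z then some (.inr (r1 str n x)) else
      if (str n x).z < p (str n x).d then some (.inr (r2 str n x)) else none

noncomputable def Np (p : Bool → ℝ) : ℕ → Option (TN Q ⊕ RN Q)
  | 0 => some (.inl rt)
  | n+1 => (Np p n).bind (nxt str stt p n)

theorem reach_N (p : Bool → ℝ) {n X} (h : Reach str stt rt n X) (hp : inN p X) :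
    Np str stt rt p n = some X := by
  induction h with
  | root => rfl
  | @t1 n x h ih =>
    have := (inT_tri1 (stt n x).Lh (stt n x).zlo (stt n x).zhi p).1 hp
    rw [Np, ih this.1]
    simp only [Option.bind_some, nxt, if_pos this.2]
  | @t2 n x h ih =>
    have := (inT_tri2 (stt n x).Lv (stt n x).zlo (stt n x).zhi p).1 hp
    rw [Np, ih this.1]
    have h1 : ¬ p true < (stt n x).z := not_lt.2 (this.2.trans this.1.2.1).le
    simp only [Option.bind_some, nxt, if_neg h1, if_pos this.2]
  | @tr n x h ih =>
    have := (inR_triR (stt n x).Lh (stt n x).Lv (stt n x).zlo (stt n x).zhi p).1 hp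
    rw [Np, ih this.1]
    have h1 : ¬ p true < (stt n x).z := not_lt.2 this.2.2.le
    have h2 : ¬ (stt n x).z < p false := not_lt.2 this.2.1.le
    simp only [Option.bind_some, nxt, if_neg h1, if_neg h2, if_pos this.2]
  | @r1 n x h ih =>
    have := (inR_ch1 (str n x).L (str n x).zlo (str n x).zhi p).1 hp
    rw [Np, ih this.1]
    simp only [Option.bind_some, nxt, if_pos this.2]
  | @r2 n x h ih =>
    have := (inR_ch2 (str n x).L (str n x).zlo (str n x).zhi p).1 hp
    rw [Np, ih this.1]
    simp only [Option.bind_some, nxt, if_neg (not_lt.2 this.2.le), if_pos this.2]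

theorem reach_root (p : Bool → ℝ) {n X} (h : Reach str stt rt n X) (hp : inN p X) : InT rt.A p := by
  induction h with
  | root => exact hp
  | @t1 n x h ih => exact ih ((inT_tri1 (stt n x).Lh (stt n x).zlo (stt n x).zhi p).1 hp).1
  | @t2 n x h ih => exact ih ((inT_tri2 (stt n x).Lv (stt n x).zlo (stt n x).zhi p).1 hp).1
  | @tr n x h ih => exact ih ((inR_triR (stt n x).Lh (stt n x).Lv (stt n x).zlo (stt n x).zhi p).1 hp).1
  | @r1 n x h ih => exact ih ((inR_ch1 (str n x).L (str n x).zlo (str n x).zhi p).1 hp).1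
  | @r2 n x h ih => exact ih ((inR_ch2 (str n x).L (str n x).zlo (str n x).zhi p).1 hp).1

def Stop (p : Bool → ℝ) (x : ℕ × (TN Q ⊕ RN Q)) : Prop :=
  Np str stt rt p x.1 = some x.2 ∧ nxt str stt p x.1 x.2 = none

theorem halt_none {p x} (h : Stop str stt rt p x) (k : ℕ) : Np str stt rt p (x.1 + 1 + k) = none := by
  induction k with
  | zero => rw [add_zero, Np, h.1]; exact h.2
  | succ k ih => rw [← add_assoc, Np, ih]; rfl

theorem halt_le {p x} (h : Stop str stt rt p x) {n X} (hn : Np str stt rt p n = some X) : n ≤ x.1 := by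
  by_contra! hc
  have := halt_none str stt rt h (n - (x.1+1))
  rw [show x.1 + 1 + (n - (x.1+1)) = n by omega, hn] at this
  cases this

theorem halt_unique {p x y} (h : Stop str stt rt p x) (h' : Stop str stt rt p y) : x = y := by
  have e : x.1 = y.1 := le_antisymm (halt_le _ _ _ h' h.1) (halt_le _ _ _ h h'.1)
  have := h.1
  rw [e, h'.1] at this
  exact Prod.ext e (Option.some.inj this).symm

open Classical in
noncomputable def slab (p : Bool → ℝ) : ℕ × (TN Q ⊕ RN Q) → Set I
  | (n, .inl x) => if p true = (stt n x).z then (stt n x).labh (p false) else (stt n x).labv (p true)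
  | (n, .inr x) => (str n x).lab (p (!(str n x).d))

def Fil (p : Bool → ℝ) (t : Set I) : Prop :=
  ∃ N, ∀ n ≥ N, ∀ r, Np str stt rt p n = some (.inr r) → Ty (kTop r.C) (kPb r.C) t ∧ t ⊆ kBot r.C ∧ t ⊆ kPt r.C

open Classical in
noncomputable def tau (p : Bool → ℝ) : Set I :=
  if InT rt.A p then
    if h : ∃ x, Stop str stt rt p x then slab str stt p h.choose else
    if h : ∃ t, Fil str stt rt p t then h.choose else ∅
  else ∅

theorem tau_halt {p x} (hx : Stop str stt rt p x) (hp : InT rt.A p) : tau str stt rt p = slab str stt p x := by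
  have h : ∃ x, Stop str stt rt p x := ⟨x, hx⟩
  rw [tau, if_pos hp, dif_pos h, halt_unique _ _ _ h.choose_spec hx]

theorem tau_fil {p} (hx : ∀ x, ¬ Stop str stt rt p x) (hp : InT rt.A p) (h : ∃ t, Fil str stt rt p t) :
    Fil str stt rt p (tau str stt rt p) := by
  rw [tau, if_pos hp, dif_neg (not_exists.2 hx), dif_pos h]
  exact h.choose_spec

theorem shrink_lemma (w : ℕ → ℝ) (h0 : ∀ n, 0 ≤ w n) (ha : ∀ n, w (n+1) ≤ w n)
    (hh : ∀ N, ∃ n ≥ N, w (n+1) ≤ w n / 2) (ε : ℝ) (hε : 0 < ε) : ∃ N, ∀ n ≥ N, w n < ε := by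
  have ha' : Antitone w := antitone_nat_of_succ_le ha
  have key : ∀ m : ℕ, ∃ n, w n ≤ w 0 * (1/2)^m := by
    intro m
    induction m with
    | zero => exact ⟨0, by simp⟩
    | succ m ih =>
      obtain ⟨n, hn⟩ := ih
      obtain ⟨n', h1, h2⟩ := hh n
      refine ⟨n'+1, h2.trans ?_⟩
      have := ha' h1
      rw [pow_succ]; linarith
  obtain ⟨m, hm⟩ := exists_pow_lt_of_lt_one (show 0 < ε / (w 0 + 1) by have := h0 0; positivity)
    (show (1/2:ℝ) < 1 by norm_num)
  obtain ⟨N, hN⟩ := key m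
  refine ⟨N, fun n hn => ((ha' hn).trans hN).trans_lt ?_⟩
  rw [lt_div_iff₀ (by have := h0 0; positivity)] at hm
  have : (0:ℝ) < (1/2)^m := by positivity
  nlinarith

theorem kch1 {C : Bool → J I → ℝ} {d z} {L : K I → ℝ} (zl : C d lo < z) (zh : z < C d hi)
    (hpv : ∀ i, L (pv i) ≤ L (po i)) (hfv : ∀ i, L (fo i) ≤ L (fv i))
    (c2 : Cst (ch2 C d z L)) :
    kBot (ch1 C d z L) ⊆ kBot C ∧ kPt (ch1 C d z L) ⊆ kPt C ∧ kTop C ⊆ kTop (ch1 C d z L) ∧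
      kPb C ⊆ kPb (ch1 C d z L) := by
  have e1 : ∀ i, C (!d) (fp i) ≤ L (pv i) := fun i => by
    have := c2.pn (!d) i
    simpa [ch2, setNear] using this
  have e2 : ∀ i, C (!d) (ff i) ≤ L (fo i) := fun i => by
    have := c2.fn (!d) i
    simpa [ch2, setNear] using this
  refine ⟨fun i h a => ?_, fun i h a => ?_, ?_, ?_⟩
  · have := h a
    rcases bool_cases a d with rfl | rfl
    · simp only [ch1, if_true, min_eq_left zl.le] at this
      exact this.trans_le (min_le_left _ _)
    · simpa [ch1, setFar] using this
  · have := h a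
    rcases bool_cases a d with rfl | rfl
    · simp only [ch1, if_true, min_eq_right zh.le] at this
      rcases min_lt_iff.1 this with h | h
      · exact h.trans zh
      · exact absurd h (lt_irrefl _)
    · simp only [ch1, Bool.not_eq_self, if_false, setFar] at this
      exact ((e1 i).trans (hpv i)).trans_lt this
  · rintro i ⟨a, h⟩
    refine ⟨a, ?_⟩
    rcases bool_cases a d with rfl | rfl
    · simp only [ch1, if_true]; exact min_le_min_right _ h
    · simp only [ch1, Bool.not_eq_self, if_false, setFar]
      exact h.trans ((e2 i).trans (hfv i))
  · rintro i ⟨a, h⟩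
    refine ⟨a, ?_⟩
    rcases bool_cases a d with rfl | rfl
    · simp only [ch1, if_true]; exact min_le_min_right _ h
    · simpa [ch1, setFar] using h

theorem kch2 {C : Bool → J I → ℝ} {d z} {L : K I → ℝ} (zl : C d lo < z) (zh : z < C d hi)
    (hpv : ∀ i, L (pv i) ≤ L (po i)) (hfv : ∀ i, L (fo i) ≤ L (fv i))
    (c1 : Cst (ch1 C d z L)) :
    kBot (ch2 C d z L) ⊆ kBot C ∧ kPt (ch2 C d z L) ⊆ kPt C ∧ kTop C ⊆ kTop (ch2 C d z L) ∧
      kPb C ⊆ kPb (ch2 C d z L) := by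
  have e1 : ∀ i, L (po i) ≤ C (!d) (np i) := fun i => by
    have := c1.pn (!d) i
    simpa [ch1, setFar] using this
  have e2 : ∀ i, L (fv i) ≤ C (!d) (nf i) := fun i => by
    have := c1.fn (!d) i
    simpa [ch1, setFar] using this
  refine ⟨fun i h a => ?_, fun i h a => ?_, ?_, ?_⟩
  · have := h a
    rcases bool_cases a d with rfl | rfl
    · simp only [ch2, if_true, max_eq_right zl.le] at this
      rcases lt_max_iff.1 this with h | h
      · exact zl.trans h
      · exact absurd h (lt_irrefl _)
    · simp only [ch2, Bool.not_eq_self, if_false, setNear] at this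
      exact this.trans_le ((hfv i).trans (e2 i))
  · have := h a
    rcases bool_cases a d with rfl | rfl
    · simp only [ch2, if_true, max_eq_left zh.le] at this
      exact (le_max_left _ _).trans_lt this
    · simpa [ch2, setNear] using this
  · rintro i ⟨a, h⟩
    refine ⟨a, ?_⟩
    rcases bool_cases a d with rfl | rfl
    · simp only [ch2, if_true]; exact max_le_max_right _ h
    · simpa [ch2, setNear] using h
  · rintro i ⟨a, h⟩
    refine ⟨a, ?_⟩
    rcases bool_cases a d with rfl | rfl
    · simp only [ch2, if_true]; exact max_le_max_right _ h
    · simp only [ch2, Bool.not_eq_self, if_false, setNear]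
      exact ((hpv i).trans (e1 i)).trans h

end
end HP

namespace HP
open J K
section
variable {I : Type} {Ty : Set I → Set I → Set I → Prop} {Q : PSys I}
variable (str : ∀ (_ : ℕ) (x : RN Q), RStep Ty Q x.C x.s) (stt : ∀ (_ : ℕ) (x : TN Q), TStep Ty Q x.A x.s)
  (rt : TN Q) (sched : ℕ → Task I)

theorem RN.cst (G : Good Ty Q) (x : RN Q) : Cst x.C := OEq.cst (fun a => (x.h a).symm) (G.cst x.s)
theorem TN.tcst (G : Good Ty Q) (x : TN Q) : TCst x.A := OEq.tcst x.h.symm (G.tcst x.s)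

theorem stabil [Finite I] (f : ℕ → Set I) (h : ∀ n, f n ⊆ f (n+1)) : ∃ N, ∀ n ≥ N, f n = f N := by
  obtain ⟨N, hN⟩ := WellFoundedGT.monotone_chain_condition (⟨f, monotone_nat_of_le_succ h⟩ : ℕ →o Set I)
  exact ⟨N, fun n hn => (hN n hn).symm⟩

theorem stabil' [Finite I] (f : ℕ → Set I) (h : ∀ n, f (n+1) ⊆ f n) : ∃ N, ∀ n ≥ N, f n = f N := by
  obtain ⟨N, hN⟩ := stabil (fun n => (f n)ᶜ) (fun n => Set.compl_subset_compl.2 (h n))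
  exact ⟨N, fun n hn => compl_injective (hN n hn)⟩

structure Hyp : Prop where
  G : Good Ty Q
  sch : ∀ t N, ∃ n ≥ N, sched n = t
  tr : ∀ n x, TaskOK (sched n) x.C x.s (str n x)
  e1 : ∀ n x, Evolves Ty Q x.s (str n x).s1 (str n x).d true False
  e2 : ∀ n x, Evolves Ty Q x.s (str n x).s2 (str n x).d false False
  tt : ∀ n x, TTaskOK (sched n) x.A x.s (stt n x)

def Path (n0 : ℕ) (r : ℕ → RN Q) : Prop :=
  ∀ k, r (k+1) = r1 str (n0+k) (r k) ∨ r (k+1) = r2 str (n0+k) (r k)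

variable {str stt sched}

theorem Hyp.sch' (H : Hyp str stt sched) (n0 : ℕ) (t : Task I) (K : ℕ) : ∃ k ≥ K, sched (n0 + k) = t := by
  obtain ⟨n, h1, h2⟩ := H.sch t (n0 + K)
  exact ⟨n - n0, by omega, by rw [show n0 + (n - n0) = n by omega]; exact h2⟩

theorem path_mono (H : Hyp str stt sched) {n0 r} (hr : Path str n0 r) (k) :
    kBot (r (k+1)).C ⊆ kBot (r k).C ∧ kPt (r (k+1)).C ⊆ kPt (r k).C ∧ kTop (r k).C ⊆ kTop (r (k+1)).C ∧
      kPb (r k).C ⊆ kPb (r (k+1)).C := by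
  set x := r k
  have st := str (n0+k) x
  have h1 := (r1 str (n0+k) x).cst H.G
  have h2 := (r2 str (n0+k) x).cst H.G
  rcases hr k with h | h
  · rw [h]
    exact kch1 (str (n0+k) x).zlo (str (n0+k) x).zhi (str (n0+k) x).line.pvpo (str (n0+k) x).line.fofv h2
  · rw [h]
    exact kch2 (str (n0+k) x).zlo (str (n0+k) x).zhi (str (n0+k) x).line.pvpo (str (n0+k) x).line.fofv h1

theorem r1_lo (n) (x : RN Q) (a) : (r1 str n x).C a lo = x.C a lo := by
  have zl := (str n x).zlo
  rcases bool_cases a (str n x).d with h | h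
  · rw [h]; simp only [r1, ch1, if_true, min_eq_left zl.le]
  · rw [h]; simp only [r1, ch1, Bool.not_eq_self, if_false, setFar]
theorem r2_hi (n) (x : RN Q) (a) : (r2 str n x).C a hi = x.C a hi := by
  have zl := (str n x).zhi
  rcases bool_cases a (str n x).d with h | h
  · rw [h]; simp only [r2, ch2, if_true, max_eq_left zl.le]
  · rw [h]; simp only [r2, ch2, Bool.not_eq_self, if_false, setNear]
theorem r1_hi (n) (x : RN Q) : (r1 str n x).C (str n x).d hi = (str n x).z := by
  simp only [r1, ch1, if_true, min_eq_right (str n x).zhi.le]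
theorem r2_lo (n) (x : RN Q) : (r2 str n x).C (str n x).d lo = (str n x).z := by
  simp only [r2, ch2, if_true, max_eq_right (str n x).zlo.le]
theorem r1_hi' (n) (x : RN Q) (a) (h : a ≠ (str n x).d) : (r1 str n x).C a hi = x.C a hi := by
  simp only [r1, ch1, if_neg h, setFar]
theorem r2_lo' (n) (x : RN Q) (a) (h : a ≠ (str n x).d) : (r2 str n x).C a lo = x.C a lo := by
  simp only [r2, ch2, if_neg h, setNear]
theorem r1_hi_le (n) (x : RN Q) (a) : (r1 str n x).C a hi ≤ x.C a hi := by
  by_cases h : a = (str n x).d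
  · subst h; rw [r1_hi]; exact (str n x).zhi.le
  · rw [r1_hi' _ _ _ h]
theorem r2_lo_le (n) (x : RN Q) (a) : x.C a lo ≤ (r2 str n x).C a lo := by
  by_cases h : a = (str n x).d
  · subst h; rw [r2_lo]; exact (str n x).zlo.le
  · rw [r2_lo' _ _ _ h]

theorem path_shrink (H : Hyp str stt sched) {n0 r} (hr : Path str n0 r) (a) (ε : ℝ) (hε : 0 < ε) :
    ∃ N, ∀ n ≥ N, (r n).C a hi - (r n).C a lo < ε := by
  refine shrink_lemma (fun n => (r n).C a hi - (r n).C a lo) (fun n => ?_) (fun n => ?_) (fun N => ?_) ε hε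
  · have := ((r n).cst H.G).lh a; linarith
  · show (r (n+1)).C a hi - (r (n+1)).C a lo ≤ _
    rcases hr n with h | h <;> rw [h]
    · rw [r1_lo]; have := r1_hi_le (str := str) (n0+n) (r n) a; linarith
    · rw [r2_hi]; have := r2_lo_le (str := str) (n0+n) (r n) a; linarith
  · obtain ⟨k, hk, hs⟩ := H.sch' n0 (.inl a) N
    refine ⟨k, hk, ?_⟩
    have ht := H.tr (n0+k) (r k)
    rw [hs] at ht
    obtain ⟨h1, h2⟩ := ht
    show (r (k+1)).C a hi - (r (k+1)).C a lo ≤ _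
    rcases hr k with h | h <;> rw [h]
    · rw [r1_lo]
      have := r1_hi (str := str) (n0+k) (r k)
      rw [h1, h2] at this
      rw [this]; apply le_of_eq; ring
    · rw [r2_hi]
      have := r2_lo (str := str) (n0+k) (r k)
      rw [h1, h2] at this
      rw [this]; apply le_of_eq; ring

theorem no_descent (ρ : ℕ → ℕ) (N : ℕ) (h : ∀ n ≥ N, ρ (n+1) ≤ ρ n) (h' : ∀ m, ∃ n ≥ m, ρ (n+1) < ρ n) : False := by
  have key : ∀ v, ∀ n ≥ N, ρ n = v → False := by
    intro v
    induction v using Nat.strong_induction_on with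
    | _ v ih =>
      intro n hn hv
      obtain ⟨m, hm, hlt⟩ := h' n
      have hle : ∀ k, ρ (n + k) ≤ ρ n := by
        intro k
        induction k with
        | zero => exact le_rfl
        | succ k ih => exact (h (n+k) (by omega)).trans ih
      have := hle (m - n)
      rw [show n + (m - n) = m by omega] at this
      exact ih (ρ (m+1)) (by omega) (m+1) (by omega) rfl
  exact key _ N le_rfl rfl

theorem path_fill [Finite I] (H : Hyp str stt sched) {n0 r} (hr : Path str n0 r) (p : Bool → ℝ)
    (hp : ∀ k, InR (r k).C p) : ∃ t N, ∀ n ≥ N, Ty (kTop (r n).C) (kPb (r n).C) t ∧ t ⊆ kBot (r n).C ∧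
      t ⊆ kPt (r n).C := by
  obtain ⟨N1, h1⟩ := stabil' (fun k => kBot (r k).C) (fun k => (path_mono H hr k).1)
  obtain ⟨N2, h2⟩ := stabil' (fun k => kPt (r k).C) (fun k => (path_mono H hr k).2.1)
  obtain ⟨N3, h3⟩ := stabil (fun k => kTop (r k).C) (fun k => (path_mono H hr k).2.2.1)
  obtain ⟨N4, h4⟩ := stabil (fun k => kPb (r k).C) (fun k => (path_mono H hr k).2.2.2)
  set N := N1 + N2 + N3 + N4 with hN
  have hK : ∀ n ≥ N, SameK (r N).C (r n).C := by
    intro n hn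
    exact ⟨(h1 N (by omega)).trans (h1 n (by omega)).symm, (h3 N (by omega)).trans (h3 n (by omega)).symm,
      (h4 N (by omega)).trans (h4 n (by omega)).symm, (h2 N (by omega)).trans (h2 n (by omega)).symm⟩
  by_cases hf : Filled Ty (r N).C
  · obtain ⟨t, a, b, c⟩ := hf
    refine ⟨t, N, fun n hn => ?_⟩
    have := hK n hn
    rw [← this.bot, ← this.top, ← this.pb, ← this.pt]
    exact ⟨a, b, c⟩
  exfalso
  have hf' : ∀ n ≥ N, ¬ Filled Ty (r n).C := fun n hn h => hf (((hK n hn).filled Ty).2 h)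
  have hfc : ∀ n ≥ N, ¬ Filled Ty (Q.cfg (r n).s) := fun n hn h =>
    hf' n hn (((OEq.sameK (r n).h).filled Ty).2 h)
  have hsk : ∀ n ≥ N, SameK (Q.cfg (r n).s) (Q.cfg (r (n+1)).s) := fun n hn =>
    (OEq.sameK (r n).h).symm.trans (((hK n hn).symm.trans (hK (n+1) (by omega))).trans (OEq.sameK (r (n+1)).h))
  have hE : ∀ n ≥ N, ∀ a b, Q.E (r (n+1)).s a b → Q.E (r n).s a b := by
    intro n hn a b h
    have k := hsk n hn
    rcases hr n with e | e <;> rw [e] at h k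
    · exact ((H.e1 _ _ k).1 a b h).1
    · exact ((H.e2 _ _ k).1 a b h).1
  have hE' : ∀ n ≥ N, ∀ m ≥ n, ∀ a b, Q.E (r m).s a b → Q.E (r n).s a b := by
    intro n hn m hm a b
    induction m, hm using Nat.le_induction with
    | base => exact id
    | succ m hm ih => intro h; exact ih (hE m (by omega) a b h)
  have cutHi : ∀ a, ∃ n ≥ N, ¬ Q.E (r n).s a true := by
    intro a
    by_contra! hc
    have cst : ∀ n ≥ N, (r n).C a hi = (r N).C a hi := by
      intro n hn
      induction n, hn using Nat.le_induction with
      | base => rfl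
      | succ m hm ih =>
        rw [← ih]
        have k := hsk m hm
        have h := hc (m+1) (by omega)
        rcases hr m with e | e
        · rw [e] at k h
          rw [e]
          refine r1_hi' _ _ _ fun ha => ((H.e1 _ _ k).1 a true h).2 ⟨ha, rfl⟩
        · rw [e]; exact r2_hi _ _ _
    have := (hp N a).2
    obtain ⟨M, hM⟩ := path_shrink H hr a _ (sub_pos.2 this)
    have h5 := hM (M + N) (by omega)
    rw [cst (M+N) (by omega)] at h5
    have h6 := (hp (M+N) a).1
    linarith
  have cutLo : ∀ a, ∃ n ≥ N, ¬ Q.E (r n).s a false := by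
    intro a
    by_contra! hc
    have cst : ∀ n ≥ N, (r n).C a lo = (r N).C a lo := by
      intro n hn
      induction n, hn using Nat.le_induction with
      | base => rfl
      | succ m hm ih =>
        rw [← ih]
        have k := hsk m hm
        have h := hc (m+1) (by omega)
        rcases hr m with e | e
        · rw [e]; exact r1_lo _ _ _
        · rw [e] at k h
          rw [e]
          refine r2_lo' _ _ _ fun ha => ((H.e2 _ _ k).1 a false h).2 ⟨ha, rfl⟩
    have := (hp N a).1
    obtain ⟨M, hM⟩ := path_shrink H hr a _ (sub_pos.2 this)
    have h5 := hM (M + N) (by omega)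
    rw [cst (M+N) (by omega)] at h5
    have h6 := (hp (M+N) a).2
    linarith
  obtain ⟨a1, b1, c1⟩ := cutHi true
  obtain ⟨a2, b2, c2⟩ := cutHi false
  obtain ⟨a3, b3, c3⟩ := cutLo true
  obtain ⟨a4, b4, c4⟩ := cutLo false
  set M := a1 + a2 + a3 + a4
  have hM : ∀ n ≥ M, ∀ a b, ¬ Q.E (r n).s a b := by
    intro n hn a b h
    rcases a <;> rcases b
    · exact c4 (hE' _ b4 n (by omega) _ _ h)
    · exact c2 (hE' _ b2 n (by omega) _ _ h)
    · exact c3 (hE' _ b3 n (by omega) _ _ h)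
    · exact c1 (hE' _ b1 n (by omega) _ _ h)
  apply no_descent (fun n => Q.ρ (r n).s) M
  · intro n hn
    have k := hsk n (by omega)
    show Q.ρ (r (n+1)).s ≤ _
    rcases hr n with e | e <;> rw [e] at k ⊢
    · exact ((H.e1 _ _ k).2 (hM n hn) (hfc n (by omega))).1
    · exact ((H.e2 _ _ k).2 (hM n hn) (hfc n (by omega))).1
  · intro m
    obtain ⟨n, hn, hs⟩ := H.sch' n0 (.inr (.inr ())) (m + M)
    refine ⟨n, by omega, ?_⟩
    have k := hsk n (by omega)
    have ht := H.tr (n0+n) (r n)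
    rw [hs] at ht
    have hh := hM n (by omega)
    obtain ⟨t1, t2⟩ := ht hh (hf' n (by omega))
    show Q.ρ (r (n+1)).s < _
    rcases hr n with e | e <;> rw [e] at k ⊢
    · exact ((t1 k).2 hh (hfc n (by omega))).2 trivial
    · exact ((t2 k).2 hh (hfc n (by omega))).2 trivial

end
end HP

namespace HP
open J K
section
variable {I : Type} {Ty : Set I → Set I → Set I → Prop} {Q : PSys I}
variable {str : ∀ (_ : ℕ) (x : RN Q), RStep Ty Q x.C x.s} {stt : ∀ (_ : ℕ) (x : TN Q), TStep Ty Q x.A x.s}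
  (rt : TN Q) {sched : ℕ → Task I}

abbrev RT (str : ∀ (_ : ℕ) (x : RN Q), RStep Ty Q x.C x.s)
  (stt : ∀ (_ : ℕ) (x : TN Q), TStep Ty Q x.A x.s) (rt : TN Q) :=
  {x : ℕ × RN Q // Reach str stt rt x.1 (.inr x.2)}
abbrev TT (str : ∀ (_ : ℕ) (x : RN Q), RStep Ty Q x.C x.s)
  (stt : ∀ (_ : ℕ) (x : TN Q), TStep Ty Q x.A x.s) (rt : TN Q) :=
  {x : ℕ × TN Q // Reach str stt rt x.1 (.inl x.2)}

noncomputable def C1 (x : RT str stt rt) : RT str stt rt := ⟨(x.1.1+1, r1 str x.1.1 x.1.2), .r1 x.2⟩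
noncomputable def C2 (x : RT str stt rt) : RT str stt rt := ⟨(x.1.1+1, r2 str x.1.1 x.1.2), .r2 x.2⟩
noncomputable def U1 (x : TT str stt rt) : TT str stt rt := ⟨(x.1.1+1, u1 stt x.1.1 x.1.2), .t1 x.2⟩
noncomputable def U2 (x : TT str stt rt) : TT str stt rt := ⟨(x.1.1+1, u2 stt x.1.1 x.1.2), .t2 x.2⟩
noncomputable def UR (x : TT str stt rt) : RT str stt rt := ⟨(x.1.1+1, ur stt x.1.1 x.1.2), .tr x.2⟩

theorem path_of (s : ℕ → RT str stt rt) (h : ∀ n, s (n+1) = C1 rt (s n) ∨ s (n+1) = C2 rt (s n)) :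
    (∀ k, (s k).1.1 = (s 0).1.1 + k) ∧ Path str (s 0).1.1 (fun k => (s k).1.2) := by
  have h1 : ∀ k, (s k).1.1 = (s 0).1.1 + k := by
    intro k
    induction k with
    | zero => rfl
    | succ k ih => rcases h k with e | e <;> rw [e] <;> simp only [C1, C2, ih] <;> rfl
  refine ⟨h1, fun k => ?_⟩
  show (s (k+1)).1.2 = _ ∨ (s (k+1)).1.2 = _
  rw [← h1 k]
  rcases h k with e | e <;> rw [e]
  · exact Or.inl rfl
  · exact Or.inr rfl

theorem tpath_of (s : ℕ → TT str stt rt) (h : ∀ n, s (n+1) = U1 rt (s n) ∨ s (n+1) = U2 rt (s n)) :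
    (∀ k, (s k).1.1 = (s 0).1.1 + k) := by
  intro k
  induction k with
  | zero => rfl
  | succ k ih => rcases h k with e | e <;> rw [e] <;> simp only [U1, U2, ih] <;> rfl

theorem tau_l (x : RT str stt rt) (p) (hp : InR x.1.2.C p) (hz : p (str x.1.1 x.1.2).d = (str x.1.1 x.1.2).z) :
    tau str stt rt p = (str x.1.1 x.1.2).lab (p (!(str x.1.1 x.1.2).d)) := by
  have hs : Stop str stt rt p (x.1.1, .inr x.1.2) := by
    refine ⟨reach_N _ _ _ p x.2 hp, ?_⟩
    simp only [nxt, hz, lt_irrefl, if_false]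
  rw [tau_halt _ _ _ hs (reach_root _ _ _ p x.2 hp)]; rfl

theorem tau_h (x : TT str stt rt) (p) (hp : InT x.1.2.A p) (hz : p true = (stt x.1.1 x.1.2).z) :
    tau str stt rt p = (stt x.1.1 x.1.2).labh (p false) := by
  have hs : Stop str stt rt p (x.1.1, .inl x.1.2) := by
    refine ⟨reach_N _ _ _ p x.2 hp, ?_⟩
    have h1 : ¬ (stt x.1.1 x.1.2).z < p false := not_lt.2 (hz ▸ hp.2.1).le
    simp only [nxt, hz, lt_irrefl, if_false, and_false, if_neg h1]
  rw [tau_halt _ _ _ hs (reach_root _ _ _ p x.2 hp)]; simp only [slab, if_pos hz]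

theorem tau_v (x : TT str stt rt) (p) (hp : InT x.1.2.A p) (hz : p false = (stt x.1.1 x.1.2).z) :
    tau str stt rt p = (stt x.1.1 x.1.2).labv (p true) := by
  have h1 : (stt x.1.1 x.1.2).z < p true := hz ▸ hp.2.1
  have hs : Stop str stt rt p (x.1.1, .inl x.1.2) := by
    refine ⟨reach_N _ _ _ p x.2 hp, ?_⟩
    simp only [nxt, hz, lt_irrefl, if_false, false_and, if_neg (not_lt.2 h1.le)]
  rw [tau_halt _ _ _ hs (reach_root _ _ _ p x.2 hp)]; simp only [slab, if_neg h1.ne']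

theorem pt_e {α : Type} [LinearOrder α] (e : Bool) (x y : α) : Tr.pt e x y e = x := by simp [Tr.pt]
theorem pt_ne {α : Type} [LinearOrder α] (e : Bool) (x y : α) : Tr.pt e x y (!e) = y := by simp [Tr.pt]

theorem fairF_aux (H : Hyp str stt sched) (s : ℕ → RT str stt rt)
    (h : ∀ n, s (n+1) = C1 rt (s n) ∨ s (n+1) = C2 rt (s n)) (e i o) :
    ∃ n, (s n).1.2.C e lo ≤ yOf o ((s n).1.2.C e lo) → yOf o ((s n).1.2.C e lo) < (s n).1.2.C e (nf i) →
      (s n).1.2.C e (ff i) ≤ yOf o ((s n).1.2.C e lo) →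
      (s n).1.2.C (!e) (ff i) ≤ (s n).1.2.C (!e) lo → ∃ q, InR (s n).1.2.C q ∧
        yOf o ((s n).1.2.C e lo) < q e ∧ i ∈ tau str stt rt q := by
  obtain ⟨h1, _⟩ := path_of rt s h
  obtain ⟨k, -, hk⟩ := H.sch' (s 0).1.1 (.inr (.inl (true, e, i, o))) 0
  rw [← h1] at hk
  have ht := H.tr (s k).1.1 (s k).1.2
  rw [hk] at ht
  refine ⟨k, fun a b c d => ?_⟩
  obtain ⟨hd, y', y1, y2, y3, y4⟩ := ht a b c d
  have zl := (str (s k).1.1 (s k).1.2).zlo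
  have zh := (str (s k).1.1 (s k).1.2).zhi
  have tl := tau_l rt (s k) (Tr.pt e y' (str (s k).1.1 (s k).1.2).z)
  rw [hd, Bool.not_not] at tl
  rw [hd] at zl zh
  have hin : InR (s k).1.2.C (Tr.pt e y' (str (s k).1.1 (s k).1.2).z) := by
    intro a
    rcases bool_cases a e with rfl | rfl
    · rw [pt_e]; exact ⟨y2, y3⟩
    · rw [pt_ne]; exact ⟨zl, zh⟩
  refine ⟨_, hin, by rw [pt_e]; exact y1, ?_⟩
  rw [tl hin (pt_ne _ _ _), pt_e]; exact y4

theorem fairP_aux (H : Hyp str stt sched) (s : ℕ → RT str stt rt)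
    (h : ∀ n, s (n+1) = C1 rt (s n) ∨ s (n+1) = C2 rt (s n)) (e i o) :
    ∃ n, yOf o ((s n).1.2.C e hi) ≤ (s n).1.2.C e hi → (s n).1.2.C e (fp i) < yOf o ((s n).1.2.C e hi) →
      yOf o ((s n).1.2.C e hi) ≤ (s n).1.2.C e (np i) →
      (s n).1.2.C (!e) hi ≤ (s n).1.2.C (!e) (np i) → ∃ q, InR (s n).1.2.C q ∧
        q e < yOf o ((s n).1.2.C e hi) ∧ i ∈ tau str stt rt q := by
  obtain ⟨h1, _⟩ := path_of rt s h
  obtain ⟨k, -, hk⟩ := H.sch' (s 0).1.1 (.inr (.inl (false, e, i, o))) 0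
  rw [← h1] at hk
  have ht := H.tr (s k).1.1 (s k).1.2
  rw [hk] at ht
  refine ⟨k, fun a b c d => ?_⟩
  obtain ⟨hd, y', y1, y2, y3, y4⟩ := ht a b c d
  have zl := (str (s k).1.1 (s k).1.2).zlo
  have zh := (str (s k).1.1 (s k).1.2).zhi
  have tl := tau_l rt (s k) (Tr.pt e y' (str (s k).1.1 (s k).1.2).z)
  rw [hd, Bool.not_not] at tl
  rw [hd] at zl zh
  have hin : InR (s k).1.2.C (Tr.pt e y' (str (s k).1.1 (s k).1.2).z) := by
    intro a
    rcases bool_cases a e with rfl | rfl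
    · rw [pt_e]; exact ⟨y2, y3⟩
    · rw [pt_ne]; exact ⟨zl, zh⟩
  refine ⟨_, hin, by rw [pt_e]; exact y1, ?_⟩
  rw [tl hin (pt_ne _ _ _), pt_e]; exact y4

theorem tfairF_aux (H : Hyp str stt sched) (s : ℕ → TT str stt rt)
    (h : ∀ n, s (n+1) = U1 rt (s n) ∨ s (n+1) = U2 rt (s n)) (i o) :
    ∃ n, (s n).1.2.A lo ≤ yOf o ((s n).1.2.A lo) → yOf o ((s n).1.2.A lo) < (s n).1.2.A (nf i) →
      (s n).1.2.A (ff i) ≤ (s n).1.2.A lo → ∃ q, InT (s n).1.2.A q ∧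
        yOf o ((s n).1.2.A lo) < q true ∧ i ∈ tau str stt rt q := by
  have h1 := tpath_of rt s h
  obtain ⟨k, -, hk⟩ := H.sch' (s 0).1.1 (.inr (.inl (true, true, i, o))) 0
  rw [← h1] at hk
  have ht := H.tt (s k).1.1 (s k).1.2
  rw [hk] at ht
  refine ⟨k, fun a b d => ?_⟩
  obtain ⟨y', y1, y2, y3, y4⟩ := ht a b d
  have zl := (stt (s k).1.1 (s k).1.2).zlo
  have hin : InT (s k).1.2.A (Tr.pt true y' (stt (s k).1.1 (s k).1.2).z) := ⟨zl, y2, y3⟩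
  refine ⟨_, hin, y1, ?_⟩
  rw [tau_v rt (s k) _ hin rfl]; exact y4

theorem tfairP_aux (H : Hyp str stt sched) (s : ℕ → TT str stt rt)
    (h : ∀ n, s (n+1) = U1 rt (s n) ∨ s (n+1) = U2 rt (s n)) (i o) :
    ∃ n, yOf o ((s n).1.2.A hi) ≤ (s n).1.2.A hi → (s n).1.2.A (fp i) < yOf o ((s n).1.2.A hi) →
      (s n).1.2.A hi ≤ (s n).1.2.A (np i) → ∃ q, InT (s n).1.2.A q ∧
        q false < yOf o ((s n).1.2.A hi) ∧ i ∈ tau str stt rt q := by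
  have h1 := tpath_of rt s h
  obtain ⟨k, -, hk⟩ := H.sch' (s 0).1.1 (.inr (.inl (false, true, i, o))) 0
  rw [← h1] at hk
  have ht := H.tt (s k).1.1 (s k).1.2
  rw [hk] at ht
  refine ⟨k, fun a b d => ?_⟩
  obtain ⟨y', y1, y2, y3, y4⟩ := ht a b d
  have zl := (stt (s k).1.1 (s k).1.2).zhi
  have hin : InT (s k).1.2.A (Tr.pt false y' (stt (s k).1.1 (s k).1.2).z) := ⟨y2, y3, zl⟩
  refine ⟨_, hin, y1, ?_⟩
  rw [tau_h rt (s k) _ hin rfl]; exact y4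

theorem limit_aux [Finite I] (H : Hyp str stt sched) (s : ℕ → RT str stt rt) (p : Bool → ℝ)
    (h : ∀ n, s (n+1) = C1 rt (s n) ∨ s (n+1) = C2 rt (s n)) (hp : ∀ n, InR (s n).1.2.C p) :
    (∀ n, tau str stt rt p ⊆ kBot (s n).1.2.C ∧ tau str stt rt p ⊆ kPt (s n).1.2.C) ∧
      ∃ KT KP, Ty KT KP (tau str stt rt p) ∧ ∃ N, ∀ n ≥ N, kTop (s n).1.2.C = KT ∧ kPb (s n).1.2.C = KP := by
  obtain ⟨h1, h2⟩ := path_of rt s h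
  have hN : ∀ k, Np str stt rt p ((s 0).1.1 + k) = some (.inr (s k).1.2) := by
    intro k; rw [← h1 k]; exact reach_N _ _ _ p (s k).2 (hp k)
  have ns : ∀ x, ¬ Stop str stt rt p x := by
    intro x hx
    have := halt_le _ _ _ hx (hN (x.1+1))
    omega
  obtain ⟨t, N, ht⟩ := path_fill H h2 p hp
  have hfil : ∃ t, Fil str stt rt p t := by
    refine ⟨t, (s 0).1.1 + N, fun n hn r hr => ?_⟩
    have := hN (n - (s 0).1.1)
    rw [show (s 0).1.1 + (n - (s 0).1.1) = n by omega, hr] at this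
    cases this
    exact ht _ (by omega)
  obtain ⟨N', hN'⟩ := tau_fil str stt rt ns (reach_root _ _ _ p (s 0).2 (hp 0)) hfil
  have hτ : ∀ k ≥ N', _ := fun k hk => hN' ((s 0).1.1 + k) (by omega) _ (hN k)
  have a1 : ∀ n m, n ≤ m → kBot (s m).1.2.C ⊆ kBot (s n).1.2.C := fun n m hnm =>
    antitone_nat_of_succ_le (f := fun k => kBot (s k).1.2.C) (fun k => (path_mono H h2 k).1) hnm
  have a2 : ∀ n m, n ≤ m → kPt (s m).1.2.C ⊆ kPt (s n).1.2.C := fun n m hnm =>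
    antitone_nat_of_succ_le (f := fun k => kPt (s k).1.2.C) (fun k => (path_mono H h2 k).2.1) hnm
  obtain ⟨N3, h3⟩ := stabil (fun k => kTop (s k).1.2.C) (fun k => (path_mono H h2 k).2.2.1)
  obtain ⟨N4, h4⟩ := stabil (fun k => kPb (s k).1.2.C) (fun k => (path_mono H h2 k).2.2.2)
  refine ⟨fun n => ?_, kTop (s N3).1.2.C, kPb (s N4).1.2.C, ?_, N3 + N4, fun n hn =>
    ⟨h3 n (by omega), h4 n (by omega)⟩⟩
  · have := hτ (n + N') (by omega)
    exact ⟨this.2.1.trans (a1 _ _ (by omega)), this.2.2.trans (a2 _ _ (by omega))⟩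
  · have := hτ (N3 + N4 + N') (by omega)
    rw [← h3 (N3 + N4 + N') (by omega), ← h4 (N3 + N4 + N') (by omega)]
    exact this.1

theorem tshrink_aux (H : Hyp str stt sched) (s : ℕ → TT str stt rt) (p : Bool → ℝ)
    (h : ∀ n, s (n+1) = U1 rt (s n) ∨ s (n+1) = U2 rt (s n)) (hp : ∀ n, InT (s n).1.2.A p) : False := by
  have h1 := tpath_of rt s h
  have key : ∀ n, (s (n+1)).1.2.A hi - (s (n+1)).1.2.A lo ≤ (s n).1.2.A hi - (s n).1.2.A lo ∧
      ((stt (s n).1.1 (s n).1.2).z = ((s n).1.2.A lo + (s n).1.2.A hi)/2 →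
        (s (n+1)).1.2.A hi - (s (n+1)).1.2.A lo ≤ ((s n).1.2.A hi - (s n).1.2.A lo)/2) := by
    intro n
    have zl := (stt (s n).1.1 (s n).1.2).zlo
    have zh := (stt (s n).1.1 (s n).1.2).zhi
    rcases h n with e | e <;> rw [e]
    · simp only [U1, u1, tri1, setFar, min_eq_left zl.le, min_eq_right zh.le]
      exact ⟨by linarith, fun h => by linarith⟩
    · simp only [U2, u2, tri2, setNear, max_eq_right zl.le, max_eq_left zh.le]
      exact ⟨by linarith, fun h => by linarith⟩
  obtain ⟨N, hN⟩ := shrink_lemma (fun n => (s n).1.2.A hi - (s n).1.2.A lo)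
    (fun n => by have := ((s n).1.2.tcst H.G).lh; linarith) (fun n => (key n).1) (fun N => by
      obtain ⟨k, hk1, hk⟩ := H.sch' (s 0).1.1 (.inl true) N
      rw [← h1] at hk
      have ht := H.tt (s k).1.1 (s k).1.2
      rw [hk] at ht
      exact ⟨k, hk1, (key k).2 ht⟩) _ (sub_pos.2 (hp 0).2.1)
  have := hN N le_rfl
  have := hp N
  obtain ⟨q1, q2, q3⟩ := this
  linarith

noncomputable def mkTr [Finite I] (H : Hyp str stt sched) (hF : ∀ i, rt.A (ff i) = rt.A lo)
    (hP : ∀ i, rt.A (np i) = rt.A hi) : Tr I ℝ Ty (Set.range (Rat.cast : ℚ → ℝ)) where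
  R := RT str stt rt
  T := TT str stt rt
  C x := x.1.2.C
  A x := x.1.2.A
  d x := (str x.1.1 x.1.2).d
  z x := (str x.1.1 x.1.2).z
  L x := (str x.1.1 x.1.2).L
  lab x := (str x.1.1 x.1.2).lab
  c1 := C1 rt
  c2 := C2 rt
  w x := (stt x.1.1 x.1.2).z
  Lh x := (stt x.1.1 x.1.2).Lh
  Lv x := (stt x.1.1 x.1.2).Lv
  labh x := (stt x.1.1 x.1.2).labh
  labv x := (stt x.1.1 x.1.2).labv
  t1 := U1 rt
  t2 := U2 rt
  tr := UR rt
  root := ⟨(0, rt), .root⟩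
  τ := tau str stt rt
  cst x := x.1.2.cst H.G
  tcst x := x.1.2.tcst H.G
  zlo x := (str x.1.1 x.1.2).zlo
  zhi x := (str x.1.1 x.1.2).zhi
  wlo x := (stt x.1.1 x.1.2).zlo
  whi x := (stt x.1.1 x.1.2).zhi
  C1 _ := rfl
  C2 _ := rfl
  T1 _ := rfl
  T2 _ := rfl
  TR _ := rfl
  line x := (str x.1.1 x.1.2).line
  lineh x := (stt x.1.1 x.1.2).lineh
  linev x := (stt x.1.1 x.1.2).linev
  τl := tau_l rt
  τh := tau_h rt
  τv := tau_v rt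
  τ0 p i hi := by
    by_contra hc
    rw [tau, if_neg hc] at hi
    exact hi
  rootF := hF
  rootP := hP
  ind PT PR h0 ht hr := by
    have key : ∀ n X, (h : Reach str stt rt n X) → (match X, h with
      | .inl x, h => PT ⟨(n, x), h⟩
      | .inr x, h => PR ⟨(n, x), h⟩) := by
      intro n X h
      induction h with
      | root => exact h0
      | t1 h ih => exact (ht _ ih).1
      | t2 h ih => exact (ht _ ih).2.1
      | tr h ih => exact (ht _ ih).2.2
      | r1 h ih => exact (hr _ ih).1
      | r2 h ih => exact (hr _ ih).2
    exact ⟨fun t => key t.1.1 (.inl t.1.2) t.2, fun t => key t.1.1 (.inr t.1.2) t.2⟩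
  tshrink s p h hp := tshrink_aux rt H s p h hp
  shrinkLo s p h hp a x hx := by
    obtain ⟨h1, h2⟩ := path_of rt s h
    obtain ⟨N, hN⟩ := path_shrink H h2 a _ (sub_pos.2 hx)
    refine ⟨N, fun n hn => ?_⟩
    have := hN n hn
    have := (hp n a).2
    linarith
  shrinkHi s p h hp a x hx := by
    obtain ⟨h1, h2⟩ := path_of rt s h
    obtain ⟨N, hN⟩ := path_shrink H h2 a _ (sub_pos.2 hx)
    refine ⟨N, fun n hn => ?_⟩
    have := hN n hn
    have := (hp n a).1
    linarith
  limit s p h hp := limit_aux rt H s p h hp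
  fairF s h e i y hy := by
    obtain ⟨q, rfl⟩ := hy
    exact fairF_aux rt H s h e i (some q)
  fairP s h e i y hy := by
    obtain ⟨q, rfl⟩ := hy
    exact fairP_aux rt H s h e i (some q)
  fairF0 s h e i := by
    obtain ⟨n, hn⟩ := fairF_aux rt H s h e i none
    refine ⟨n, fun a b c => ?_⟩
    obtain ⟨q, q1, -, q2⟩ := hn le_rfl a b c
    exact ⟨q, q1, q2⟩
  fairP0 s h e i := by
    obtain ⟨n, hn⟩ := fairP_aux rt H s h e i none
    refine ⟨n, fun a b c => ?_⟩
    obtain ⟨q, q1, -, q2⟩ := hn le_rfl a b c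
    exact ⟨q, q1, q2⟩
  tfairF s h i y hy := by
    obtain ⟨q, rfl⟩ := hy
    exact tfairF_aux rt H s h i (some q)
  tfairP s h i y hy := by
    obtain ⟨q, rfl⟩ := hy
    exact tfairP_aux rt H s h i (some q)
  tfairF0 s h i := by
    obtain ⟨n, hn⟩ := tfairF_aux rt H s h i none
    refine ⟨n, fun a b => ?_⟩
    obtain ⟨q, q1, -, q2⟩ := hn le_rfl a b
    exact ⟨q, q1, q2⟩
  tfairP0 s h i := by
    obtain ⟨n, hn⟩ := tfairP_aux rt H s h i none
    refine ⟨n, fun a b => ?_⟩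
    obtain ⟨q, q1, -, q2⟩ := hn le_rfl a b
    exact ⟨q, q1, q2⟩

end
end HP

namespace HP
open J K
section
variable {I : Type} {Ty : Set I → Set I → Set I → Prop} {Q : PSys I}

theorem sys_model [Finite I] (G : Good Ty Q) (θ0 : Q.T) (hF : ∀ i, Q.tcfg θ0 (ff i) = Q.tcfg θ0 lo)
    (hP : ∀ i, Q.tcfg θ0 (np i) = Q.tcfg θ0 hi) (i0 : I) (h : Q.tcfg θ0 lo < Q.tcfg θ0 (nf i0)) :
    ∃ τ : (Bool → ℝ) → Set I, ∃ l u : ℝ, l < u ∧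
      (∀ p i, i ∈ τ p → l < p false ∧ p false < p true ∧ p true < u) ∧
      (∀ p, l < p false → p false < p true → p true < u → Ty (Fo τ p) (Po τ p) (τ p)) ∧
      ∃ q, i0 ∈ τ q := by
  have : Nonempty (Task I) := ⟨.inl true⟩
  obtain ⟨dec, hdec⟩ := exists_surjective_nat (Task I)
  let sched : ℕ → Task I := fun n => dec n.unpair.1
  let rt : TN Q := ⟨fun j => (Q.tcfg θ0 j : ℝ), θ0, fun x y => Nat.cast_lt⟩
  let str : ∀ (_ : ℕ) (x : RN Q), RStep Ty Q x.C x.s :=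
    fun n x => (step_exists G (sched n) x.C x.s x.h).choose
  let stt : ∀ (_ : ℕ) (x : TN Q), TStep Ty Q x.A x.s :=
    fun n x => (tstep_exists G (sched n) x.A x.s x.h).choose
  have H : Hyp str stt sched := by
    refine ⟨G, fun t N => ?_, fun n x => ?_, fun n x => ?_, fun n x => ?_, fun n x => ?_⟩
    · obtain ⟨k, hk⟩ := hdec t
      exact ⟨Nat.pair k N, Nat.right_le_pair k N, by simp [sched, hk]⟩
    · exact (step_exists G (sched n) x.C x.s x.h).choose_spec.1
    · exact (step_exists G (sched n) x.C x.s x.h).choose_spec.2.1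
    · exact (step_exists G (sched n) x.C x.s x.h).choose_spec.2.2
    · exact (tstep_exists G (sched n) x.A x.s x.h).choose_spec
  let S := mkTr rt H (fun i => by simp only [rt, hF]) (fun i => by simp only [rt, hP])
  have hD : ∀ x y : ℝ, x < y → ∃ z ∈ Set.range (Rat.cast : ℚ → ℝ), x < z ∧ z < y := by
    intro x y hxy
    obtain ⟨q, h1, h2⟩ := exists_rat_btwn hxy
    exact ⟨q, ⟨q, rfl⟩, h1, h2⟩
  have hlh := (G.tcst θ0).lh
  refine ⟨S.τ, (Q.tcfg θ0 lo : ℕ), (Q.tcfg θ0 hi : ℕ), by exact_mod_cast hlh, fun p i hi => S.τ0 p i hi,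
    fun p h1 h2 h3 => S.main hD p ⟨h1, h2, h3⟩, ?_⟩
  obtain ⟨q, -, -, hq⟩ := S.nT hD S.root ((S.oAll hD).1 _) i0 (Q.tcfg θ0 lo : ℕ) le_rfl
    (by show (Q.tcfg θ0 lo : ℝ) < (Q.tcfg θ0 (nf i0) : ℝ); exact_mod_cast h)
  exact ⟨q, hq⟩
end
end HP

namespace HP
open J K

/-- positions relative to a finite set: even exactly on members -/
noncomputable def kap (F : Finset ℝ) (y : ℝ) : ℕ :=
  (F.filter (· < y)).card + (F.filter (· ≤ y)).card + 1

section
variable (F : Finset ℝ)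

theorem kap_mono : Monotone (kap F) := by
  intro x y h
  have h1 : (F.filter (· < x)).card ≤ (F.filter (· < y)).card :=
    Finset.card_le_card fun s hs => by
      simp only [Finset.mem_filter] at hs ⊢; exact ⟨hs.1, hs.2.trans_le h⟩
  have h2 : (F.filter (· ≤ x)).card ≤ (F.filter (· ≤ y)).card :=
    Finset.card_le_card fun s hs => by
      simp only [Finset.mem_filter] at hs ⊢; exact ⟨hs.1, hs.2.trans h⟩
  unfold kap; omega

theorem card_le_mem {s : ℝ} (hs : s ∈ F) : (F.filter (· ≤ s)).card = (F.filter (· < s)).card + 1 := by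
  rw [← Finset.card_insert_of_notMem (a := s) (s := F.filter (· < s)) (by simp)]
  congr 1
  ext x
  simp only [Finset.mem_filter, Finset.mem_insert, le_iff_lt_or_eq]
  constructor
  · rintro ⟨h1, h2 | h2⟩
    · exact Or.inr ⟨h1, h2⟩
    · exact Or.inl h2
  · rintro (rfl | ⟨h1, h2⟩)
    · exact ⟨hs, Or.inr rfl⟩
    · exact ⟨h1, Or.inl h2⟩

theorem card_le_notMem {s : ℝ} (hs : s ∉ F) : (F.filter (· ≤ s)).card = (F.filter (· < s)).card := by
  congr 1
  ext x
  simp only [Finset.mem_filter, le_iff_lt_or_eq]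
  constructor
  · rintro ⟨h1, h2 | h2⟩
    · exact ⟨h1, h2⟩
    · exact absurd (h2 ▸ h1) hs
  · rintro ⟨h1, h2⟩
    exact ⟨h1, Or.inl h2⟩

theorem kap_even {s : ℝ} : Even (kap F s) ↔ s ∈ F := by
  by_cases hs : s ∈ F
  · simp only [hs, iff_true, kap, card_le_mem F hs]
    exact ⟨(F.filter (· < s)).card + 1, by ring⟩
  · simp only [hs, iff_false, kap, card_le_notMem F hs, Nat.not_even_iff_odd]
    exact ⟨(F.filter (· < s)).card, by ring⟩

theorem card_sep {y s : ℝ} (h : y < s) : (F.filter (· ≤ y)).card ≤ (F.filter (· < s)).card :=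
  Finset.card_le_card fun x hx => by
      simp only [Finset.mem_filter] at hx ⊢; exact ⟨hx.1, hx.2.trans_lt h⟩

theorem card_lt_le (y : ℝ) : (F.filter (· < y)).card ≤ (F.filter (· ≤ y)).card :=
  Finset.card_le_card fun x hx => by
      simp only [Finset.mem_filter] at hx ⊢; exact ⟨hx.1, hx.2.le⟩

theorem kap_lt {y s : ℝ} (hs : s ∈ F ∨ y ∈ F) : kap F y < kap F s ↔ y < s := by
  constructor
  · intro h
    by_contra hc
    exact absurd (kap_mono F (not_lt.1 hc)) (not_le.2 h)
  · intro h
    have h1 := card_sep F h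
    have h2 := card_lt_le F y
    have h3 := card_lt_le F s
    rcases hs with hs | hs
    · have := card_le_mem F hs
      unfold kap; omega
    · have := card_le_mem F hs
      unfold kap; omega

theorem kap_le {y s : ℝ} (hs : s ∈ F ∨ y ∈ F) : kap F y ≤ kap F s ↔ y ≤ s := by
  rw [← not_lt, ← not_lt, kap_lt F hs.symm]

theorem kap_inj {y s : ℝ} (hs : s ∈ F ∨ y ∈ F) : kap F y = kap F s ↔ y = s := by
  rw [le_antisymm_iff, kap_le F hs, kap_le F hs.symm, ← le_antisymm_iff]

theorem kap_bound (y : ℝ) : kap F y ≤ 2 * F.card + 1 := by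
  have h1 : (F.filter (· < y)).card ≤ F.card := Finset.card_filter_le _ _
  have h2 : (F.filter (· ≤ y)).card ≤ F.card := Finset.card_filter_le _ _
  unfold kap; omega

theorem kap_next {h y : ℝ} (hh : h ∈ F) (hy : kap F y < kap F h) : ∃ y', kap F y' = kap F y + 1 := by
  have hyh : y < h := (kap_lt F (Or.inl hh)).1 hy
  have hne : (F.filter (y < ·)).Nonempty := ⟨h, by simp [hh, hyh]⟩
  set s := (F.filter (y < ·)).min' hne with hs
  have hsm : s ∈ F.filter (y < ·) := Finset.min'_mem _ _
  have hmin : ∀ x ∈ F, y < x → s ≤ x := fun x hx hxy => Finset.min'_le _ _ (by simp [hx, hxy])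
  simp only [Finset.mem_filter] at hsm
  have key : ∀ u, y < u → u ≤ s → F.filter (· < u) = F.filter (· ≤ y) := by
    intro u h1 h2
    ext x
    simp only [Finset.mem_filter]
    constructor
    · rintro ⟨h3, h4⟩
      refine ⟨h3, ?_⟩
      by_contra hc
      have := hmin x h3 (not_le.1 hc)
      linarith
    · rintro ⟨h3, h4⟩
      exact ⟨h3, by linarith⟩
  by_cases hyF : y ∈ F
  · refine ⟨(y + s)/2, ?_⟩
    have hnot : (y + s)/2 ∉ F := fun hc => by
      have := hmin _ hc (by linarith [hsm.2])
      linarith [hsm.2]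
    have h3 := key ((y+s)/2) (by linarith [hsm.2]) (by linarith [hsm.2])
    have h4 := card_le_mem F hyF
    simp only [kap, card_le_notMem F hnot, h3]; omega
  · refine ⟨s, ?_⟩
    have h3 := key s hsm.2 le_rfl
    have h4 := card_le_notMem F hyF
    simp only [kap, card_le_mem F hsm.1, h3]; omega

theorem kap_surj {l h : ℝ} (hl : l ∈ F) (hh : h ∈ F) (k : ℕ) (h1 : kap F l < k) (h2 : k < kap F h) :
    ∃ y, l < y ∧ y < h ∧ kap F y = k := by
  have : ∀ n, kap F l + n ≤ kap F h → ∃ y, kap F y = kap F l + n := by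
    intro n
    induction n with
    | zero => exact fun _ => ⟨l, rfl⟩
    | succ n ih =>
      intro hn
      obtain ⟨y, hy⟩ := ih (by omega)
      obtain ⟨y', hy'⟩ := kap_next F (y := y) hh (by omega)
      exact ⟨y', by omega⟩
  obtain ⟨y, hy⟩ := this (k - kap F l) (by omega)
  refine ⟨y, (kap_lt F (Or.inr hl)).1 (by omega), (kap_lt F (Or.inl hh)).1 (by omega), by omega⟩
end

theorem lemA {I : Type} {Ty : Set I → Set I → Set I → Prop} {l h : ℝ} {exF exP : I → Prop} {L : K I → ℝ}
    {lab : ℝ → Set I} (H : LineR Ty l h exF exP L lab) (F : Finset ℝ) (hl : l ∈ F) (hh : h ∈ F)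
    (hL : ∀ k, L k ∈ F) (req : ℕ → I → Prop)
    (hreq : ∀ k i, req k i → ∃ y0 ∈ F, k = kap F y0 ∧ i ∈ lab y0) :
    LineOK Ty (kap F l) (kap F h) exF exP (fun k => kap F (L k)) req := by
  have hleg : ∀ y, l < y → y < h → Leg Ty (fun k => kap F (L k)) (kap F y) (lab y) := by
    intro y h1 h2
    simp only [Leg, kap_lt F (Or.inl (hL _)), kap_lt F (Or.inr (hL _)), kap_le F (Or.inl (hL _)),
      kap_le F (Or.inr (hL _))]
    exact ⟨H.l1 y h1 h2, fun i hi => ⟨H.l2P y h1 h2 i hi, H.l2F y h1 h2 i hi⟩⟩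
  have hNF : ∀ i, NF Ty exF (fun k => kap F (L k)) i → L (fv i) < h ∧ i ∈ lab (L (fv i)) := by
    rintro i ⟨h1, h2, h3⟩
    beta_reduce at h1
    have e1 := (kap_even F).2 (hL (fo i))
    have e2 := (kap_even F).2 (hL (fv i))
    obtain ⟨c1, e1⟩ := e1
    obtain ⟨c2, e2⟩ := e2
    obtain ⟨y, hy1, hy2, hy3⟩ := kap_surj F (hL (fo i)) (hL (fv i)) (kap F (L (fv i)) - 1) (by omega) (by omega)
    rcases H.wF i y ((H.cl _).trans hy1.le) hy1.le hy2 with hc | ⟨y', q1, q2, q3⟩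
    · exact absurd hc h2
    · have ly' : l < y' := ((H.cl _).trans_lt hy1).trans q1
      have q4 := H.l2F y' ly' q2 i q3
      rcases q4.eq_or_lt with q4 | q4
      · rw [← q4]; exact ⟨q2, q3⟩
      · refine absurd ⟨lab y', ?_, q3⟩ h3
        have q5 := kap_mono F q1.le
        have q6 := (kap_lt F (Or.inl (hL (fv i)))).2 q4
        show Leg _ _ (kap F (L (fv i)) - 1) _
        rw [show kap F (L (fv i)) - 1 = kap F y' by omega]
        exact hleg y' ly' q2
  have hNP : ∀ i, NP Ty exP (fun k => kap F (L k)) i → l < L (pv i) ∧ i ∈ lab (L (pv i)) := by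
    rintro i ⟨h1, h2, h3⟩
    beta_reduce at h1
    have e1 := (kap_even F).2 (hL (po i))
    have e2 := (kap_even F).2 (hL (pv i))
    obtain ⟨c1, e1⟩ := e1
    obtain ⟨c2, e2⟩ := e2
    obtain ⟨y, hy1, hy2, hy3⟩ := kap_surj F (hL (pv i)) (hL (po i)) (kap F (L (pv i)) + 1) (by omega) (by omega)
    rcases H.wP i y (hy2.le.trans (H.cu _)) hy2.le hy1 with hc | ⟨y', q1, q2, q3⟩
    · exact absurd hc h2
    · have ly' : y' < h := q2.trans (hy2.trans_le (H.cu _))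
      have q4 := H.l2P y' q1 ly' i q3
      rcases q4.eq_or_lt with q4 | q4
      · rw [q4]; exact ⟨q1, q3⟩
      · refine absurd ⟨lab y', ?_, q3⟩ h3
        have q5 := kap_mono F q2.le
        have q6 := (kap_lt F (Or.inr (hL (pv i)))).2 q4
        show Leg _ _ (kap F (L (pv i)) + 1) _
        rw [show kap F (L (pv i)) + 1 = kap F y' by omega]
        exact hleg y' q1 ly'
  refine ⟨fun k => (kap_even F).2 (hL k), fun i => kap_mono F (H.fofv i), fun i => kap_mono F (H.pvpo i),
    fun k => kap_mono F (H.cl k), fun k => kap_mono F (H.cu k), fun k h1 h2 => ?_, fun i hi hc => ?_,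
    fun i hi hc => ?_⟩
  · obtain ⟨y, y1, y2, rfl⟩ := kap_surj F hl hh k h1 h2
    refine ⟨lab y, hleg y y1 y2, fun i hi hk => ?_, fun i hi hk => ?_, fun i hr => ?_⟩
    · rw [← (kap_inj F (Or.inr (hL _))).1 hk]; exact (hNF i hi).2
    · rw [← (kap_inj F (Or.inr (hL _))).1 hk]; exact (hNP i hi).2
    · obtain ⟨y0, a, b, c⟩ := hreq _ i hr
      rw [(kap_inj F (Or.inl a)).1 b]; exact c
  · exact (hNF i hi).1.ne ((kap_inj F (Or.inr (hL _))).1 hc)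
  · exact (hNP i hi).1.ne' ((kap_inj F (Or.inr (hL _))).1 hc)
end HP

namespace HP
open J K

noncomputable def clip (l h x : ℝ) : ℝ := max l (min h x)

theorem le_clip (l h x : ℝ) : l ≤ clip l h x := le_max_left _ _
theorem clip_le {l h : ℝ} (x : ℝ) (hl : l ≤ h) : clip l h x ≤ h := max_le hl (min_le_left _ _)
theorem lt_clip {l h x y : ℝ} (h1 : l ≤ y) : y < clip l h x ↔ y < h ∧ y < x := by
  simp only [clip, lt_max_iff, lt_min_iff]
  constructor
  · rintro (h | h)
    · exact absurd h1 (not_le.2 h)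
    · exact h
  · exact Or.inr
theorem clip_lt {l h x y : ℝ} (h1 : y ≤ h) : clip l h x < y ↔ l < y ∧ x < y := by
  simp only [clip, max_lt_iff, min_lt_iff]
  constructor
  · rintro ⟨h0, h | h⟩
    · exact absurd h1 (not_le.2 h)
    · exact ⟨h0, h⟩
  · rintro ⟨h0, h⟩; exact ⟨h0, Or.inr h⟩
theorem clip_mono {l h x y : ℝ} (h1 : x ≤ y) : clip l h x ≤ clip l h y :=
  max_le_max le_rfl (min_le_min le_rfl h1)
theorem clip_min {l h z x : ℝ} (h1 : l ≤ z) (h2 : z ≤ h) : min (clip l h x) z = clip l z x := by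
  simp only [clip]
  rw [min_comm, min_max_distrib_left, ← min_assoc, min_eq_left h2, min_eq_right h1]
theorem clip_max {l h z x : ℝ} (h1 : l ≤ z) : max (clip l h x) z = clip z h x := by
  simp only [clip]
  rw [max_comm, ← max_assoc, max_eq_left h1]

section
variable {I : Type} (τ : (Bool → ℝ) → Set I)

noncomputable def FO (d : Bool) (z : ℝ) (i : I) : ℝ := sSup (insert 0 {x | ∃ q, i ∈ τ q ∧ z < q d ∧ q (!d) = x})
noncomputable def FV (d : Bool) (z : ℝ) (i : I) : ℝ := sSup (insert 0 {x | ∃ q, i ∈ τ q ∧ z ≤ q d ∧ q (!d) = x})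
noncomputable def PO (d : Bool) (z : ℝ) (i : I) : ℝ := sInf (insert 1 {x | ∃ q, i ∈ τ q ∧ q d < z ∧ q (!d) = x})
noncomputable def PV (d : Bool) (z : ℝ) (i : I) : ℝ := sInf (insert 1 {x | ∃ q, i ∈ τ q ∧ q d ≤ z ∧ q (!d) = x})

structure Mod (Ty : Set I → Set I → Set I → Prop) : Prop where
  sup : ∀ p i, i ∈ τ p → 0 < p false ∧ p false < p true ∧ p true < 1
  ty : ∀ p, 0 < p false → p false < p true → p true < 1 → Ty (Fo τ p) (Po τ p) (τ p)

variable {τ} {Ty : Set I → Set I → Set I → Prop} (M : Mod τ Ty)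
include M

theorem Mod.pos {q i} (h : i ∈ τ q) (a : Bool) : 0 < q a := by
  obtain ⟨h1, h2, h3⟩ := M.sup q i h
  cases a <;> linarith
theorem Mod.lt1 {q i} (h : i ∈ τ q) (a : Bool) : q a < 1 := by
  obtain ⟨h1, h2, h3⟩ := M.sup q i h
  cases a <;> linarith

theorem Mod.bddA (d : Bool) (R : ℝ → Prop) (i : I) :
    BddAbove (insert 0 {x | ∃ q, i ∈ τ q ∧ R (q d) ∧ q (!d) = x}) := by
  refine ⟨1, ?_⟩
  rintro x (rfl | ⟨q, h1, h2, rfl⟩)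
  · exact zero_le_one
  · exact (M.lt1 h1 _).le
theorem Mod.bddB (d : Bool) (R : ℝ → Prop) (i : I) :
    BddBelow (insert 1 {x | ∃ q, i ∈ τ q ∧ R (q d) ∧ q (!d) = x}) := by
  refine ⟨0, ?_⟩
  rintro x (rfl | ⟨q, h1, h2, rfl⟩)
  · exact zero_le_one
  · exact (M.pos h1 _).le

theorem Mod.lt_FO {d z i x} (hx : 0 ≤ x) : x < FO τ d z i ↔ ∃ q, i ∈ τ q ∧ z < q d ∧ x < q (!d) := by
  rw [FO, lt_csSup_iff (M.bddA d (z < ·) i) ⟨0, Or.inl rfl⟩]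
  constructor
  · rintro ⟨b, rfl | ⟨q, h1, h2, rfl⟩, hb⟩
    · exact absurd hx (not_le.2 hb)
    · exact ⟨q, h1, h2, hb⟩
  · rintro ⟨q, h1, h2, h3⟩
    exact ⟨_, Or.inr ⟨q, h1, h2, rfl⟩, h3⟩
theorem Mod.lt_FV {d z i x} (hx : 0 ≤ x) : x < FV τ d z i ↔ ∃ q, i ∈ τ q ∧ z ≤ q d ∧ x < q (!d) := by
  rw [FV, lt_csSup_iff (M.bddA d (z ≤ ·) i) ⟨0, Or.inl rfl⟩]
  constructor
  · rintro ⟨b, rfl | ⟨q, h1, h2, rfl⟩, hb⟩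
    · exact absurd hx (not_le.2 hb)
    · exact ⟨q, h1, h2, hb⟩
  · rintro ⟨q, h1, h2, h3⟩
    exact ⟨_, Or.inr ⟨q, h1, h2, rfl⟩, h3⟩
theorem Mod.PO_lt {d z i x} (hx : x ≤ 1) : PO τ d z i < x ↔ ∃ q, i ∈ τ q ∧ q d < z ∧ q (!d) < x := by
  rw [PO, csInf_lt_iff (M.bddB d (· < z) i) ⟨1, Or.inl rfl⟩]
  constructor
  · rintro ⟨b, rfl | ⟨q, h1, h2, rfl⟩, hb⟩
    · exact absurd hx (not_le.2 hb)
    · exact ⟨q, h1, h2, hb⟩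
  · rintro ⟨q, h1, h2, h3⟩
    exact ⟨_, Or.inr ⟨q, h1, h2, rfl⟩, h3⟩
theorem Mod.PV_lt {d z i x} (hx : x ≤ 1) : PV τ d z i < x ↔ ∃ q, i ∈ τ q ∧ q d ≤ z ∧ q (!d) < x := by
  rw [PV, csInf_lt_iff (M.bddB d (· ≤ z) i) ⟨1, Or.inl rfl⟩]
  constructor
  · rintro ⟨b, rfl | ⟨q, h1, h2, rfl⟩, hb⟩
    · exact absurd hx (not_le.2 hb)
    · exact ⟨q, h1, h2, hb⟩
  · rintro ⟨q, h1, h2, h3⟩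
    exact ⟨_, Or.inr ⟨q, h1, h2, rfl⟩, h3⟩

theorem Mod.le_FO {d z i q} (h : i ∈ τ q) (hz : z < q d) : q (!d) ≤ FO τ d z i :=
  le_csSup (M.bddA d (z < ·) i) (Or.inr ⟨q, h, hz, rfl⟩)
theorem Mod.le_FV {d z i q} (h : i ∈ τ q) (hz : z ≤ q d) : q (!d) ≤ FV τ d z i :=
  le_csSup (M.bddA d (z ≤ ·) i) (Or.inr ⟨q, h, hz, rfl⟩)
theorem Mod.PO_le {d z i q} (h : i ∈ τ q) (hz : q d < z) : PO τ d z i ≤ q (!d) :=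
  csInf_le (M.bddB d (· < z) i) (Or.inr ⟨q, h, hz, rfl⟩)
theorem Mod.PV_le {d z i q} (h : i ∈ τ q) (hz : q d ≤ z) : PV τ d z i ≤ q (!d) :=
  csInf_le (M.bddB d (· ≤ z) i) (Or.inr ⟨q, h, hz, rfl⟩)

theorem Mod.FO_FV (d : Bool) {z z' : ℝ} (i) (h : z ≤ z') : FO τ d z' i ≤ FV τ d z i := by
  refine csSup_le_csSup (M.bddA d (z ≤ ·) i) ⟨0, Or.inl rfl⟩ ?_
  rintro x (rfl | ⟨q, h1, h2, rfl⟩)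
  · exact Or.inl rfl
  · exact Or.inr ⟨q, h1, h.trans h2.le, rfl⟩
theorem Mod.FV_FO (d : Bool) {z z' : ℝ} (i) (h : z < z') : FV τ d z' i ≤ FO τ d z i := by
  refine csSup_le_csSup (M.bddA d (z < ·) i) ⟨0, Or.inl rfl⟩ ?_
  rintro x (rfl | ⟨q, h1, h2, rfl⟩)
  · exact Or.inl rfl
  · exact Or.inr ⟨q, h1, h.trans_le h2, rfl⟩
theorem Mod.PV_PO (d : Bool) {z z' : ℝ} (i) (h : z ≤ z') : PV τ d z' i ≤ PO τ d z i := by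
  refine csInf_le_csInf (M.bddB d (· ≤ z') i) ⟨1, Or.inl rfl⟩ ?_
  rintro x (rfl | ⟨q, h1, h2, rfl⟩)
  · exact Or.inl rfl
  · exact Or.inr ⟨q, h1, h2.le.trans h, rfl⟩
theorem Mod.PO_PV (d : Bool) {z z' : ℝ} (i) (h : z < z') : PO τ d z' i ≤ PV τ d z i := by
  refine csInf_le_csInf (M.bddB d (· < z') i) ⟨1, Or.inl rfl⟩ ?_
  rintro x (rfl | ⟨q, h1, h2, rfl⟩)
  · exact Or.inl rfl
  · exact Or.inr ⟨q, h1, h2.trans_lt h, rfl⟩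

omit M
variable (τ)
/-- configuration of a rectangle `B axis side` -/
noncomputable def cfgOf (B : Bool → Bool → ℝ) (a : Bool) : J I → ℝ
  | .lo => B a false
  | .hi => B a true
  | .nf i => clip (B a false) (B a true) (FO τ (!a) (B (!a) false) i)
  | .ff i => clip (B a false) (B a true) (FV τ (!a) (B (!a) true) i)
  | .np i => clip (B a false) (B a true) (PV τ (!a) (B (!a) false) i)
  | .fp i => clip (B a false) (B a true) (PO τ (!a) (B (!a) true) i)

noncomputable def tcOf (l h : ℝ) : J I → ℝ
  | .lo => l
  | .hi => h
  | .nf i => clip l h (FO τ false l i)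
  | .ff i => clip l h (FV τ true h i)
  | .np i => clip l h (PV τ false l i)
  | .fp i => clip l h (PO τ true h i)

noncomputable def lnOf (d : Bool) (z l h : ℝ) : K I → ℝ
  | .fo i => clip l h (FO τ d z i)
  | .fv i => clip l h (FV τ d z i)
  | .po i => clip l h (PO τ d z i)
  | .pv i => clip l h (PV τ d z i)

structure Alive (B : Bool → Bool → ℝ) : Prop where
  l0 : 0 ≤ B false false
  lx : B false false < B false true
  xy : B false true ≤ B true false
  ly : B true false < B true true
  u1 : B true true ≤ 1
variable {τ}

theorem Alive.lt {B} (h : Alive B) (a) : B a false < B a true := by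
  cases a
  · exact h.lx
  · exact h.ly
theorem Alive.ge0 {B} (h : Alive B) (a b) : 0 ≤ B a b := by
  obtain ⟨h1, h2, h3, h4, h5⟩ := h
  cases a <;> cases b <;> linarith
theorem Alive.le1 {B} (h : Alive B) (a b) : B a b ≤ 1 := by
  obtain ⟨h1, h2, h3, h4, h5⟩ := h
  cases a <;> cases b <;> linarith

include M
theorem cfg_cst {B} (h : Alive B) : Cst (cfgOf τ B) := by
  have hl := fun a => (h.lt a).le
  refine ⟨h.lt, fun a j => ?_, fun a j => ?_, fun a i => ?_, fun a i => ?_, fun a i ha => ?_, fun a i ha => ?_,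
    fun a i ha => ?_, fun a i ha => ?_⟩
  · cases j <;> first | exact le_rfl | exact hl a | exact le_clip _ _ _
  · cases j <;> first | exact le_rfl | exact hl a | exact clip_le _ (hl a)
  · exact clip_mono (M.FV_FO _ i (h.lt _))
  · exact clip_mono (M.PO_PV _ i (h.lt _))
  · obtain ⟨-, h1⟩ := (lt_clip le_rfl).1 ha
    obtain ⟨q, q1, q2, q3⟩ := (M.lt_FV (h.ge0 _ _)).1 h1
    rw [Bool.not_not] at q3
    refine le_antisymm (clip_le _ (hl _)) ?_
    simp only [cfgOf, Bool.not_not]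
    exact le_max_of_le_right (le_min le_rfl (q2.trans (M.le_FO q1 q3)))
  · obtain ⟨-, h1⟩ := (clip_lt le_rfl).1 ha
    obtain ⟨q, q1, q2, q3⟩ := (M.PV_lt (h.le1 _ _)).1 h1
    rw [Bool.not_not] at q3
    refine le_antisymm ?_ (le_clip _ _ _)
    simp only [cfgOf, Bool.not_not]
    exact max_le le_rfl ((min_le_right _ _).trans ((M.PO_le q1 q3).trans q2))
  · obtain ⟨-, h1⟩ := (lt_clip le_rfl).1 ha
    obtain ⟨q, q1, q2, q3⟩ := (M.lt_FO (h.ge0 _ _)).1 h1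
    rw [Bool.not_not] at q3
    simp only [cfgOf, Bool.not_not]
    exact (lt_clip le_rfl).2 ⟨h.lt _, (M.lt_FO (h.ge0 _ _)).2 ⟨q, q1, q3, q2⟩⟩
  · obtain ⟨-, h1⟩ := (clip_lt le_rfl).1 ha
    obtain ⟨q, q1, q2, q3⟩ := (M.PO_lt (h.le1 _ _)).1 h1
    rw [Bool.not_not] at q3
    simp only [cfgOf, Bool.not_not]
    exact (clip_lt le_rfl).2 ⟨h.lt _, (M.PO_lt (h.le1 _ _)).2 ⟨q, q1, q3, q2⟩⟩

theorem tc_tcst {l h : ℝ} (h0 : 0 ≤ l) (hl : l < h) (h1 : h ≤ 1) : TCst (tcOf τ l h) := by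
  refine ⟨hl, fun j => ?_, fun j => ?_, fun i ha => ?_, fun i ha => ?_⟩
  · cases j <;> first | exact le_rfl | exact hl.le | exact le_clip _ _ _
  · cases j <;> first | exact le_rfl | exact hl.le | exact clip_le _ hl.le
  · obtain ⟨-, h2⟩ := (lt_clip le_rfl).1 ha
    obtain ⟨q, q1, q2, q3⟩ := (M.lt_FV h0).1 h2
    refine le_antisymm (clip_le _ hl.le) ?_
    exact le_max_of_le_right (le_min le_rfl (q2.trans (M.le_FO (d := false) q1 q3)))
  · obtain ⟨-, h2⟩ := (clip_lt le_rfl).1 ha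
    obtain ⟨q, q1, q2, q3⟩ := (M.PV_lt h1).1 h2
    refine le_antisymm ?_ (le_clip _ _ _)
    exact max_le le_rfl ((min_le_right _ _).trans ((M.PO_le (d := true) q1 q3).trans q2))

theorem pt_eta (d : Bool) (q : Bool → ℝ) : Tr.pt d (q d) (q (!d)) = q := by
  funext a
  rcases bool_cases a d with rfl | rfl
  · rw [pt_e]
  · rw [pt_ne]

theorem line_gen {d : Bool} {z l h : ℝ} (h0 : 0 ≤ l) (hl : l < h) (h1 : h ≤ 1)
    (hin : ∀ y, l < y → y < h → InT (tcOf τ 0 1) (Tr.pt d z y)) (exF exP : I → Prop)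
    (hF : ∀ i q, i ∈ τ q → q d = z → h ≤ q (!d) → exF i)
    (hP : ∀ i q, i ∈ τ q → q d = z → q (!d) ≤ l → exP i) :
    LineR Ty l h exF exP (lnOf τ d z l h) (fun y => τ (Tr.pt d z y)) := by
  refine ⟨fun i => clip_mono (M.FO_FV _ i le_rfl), fun i => clip_mono (M.PV_PO _ i le_rfl), fun k => ?_,
    fun k => ?_, fun y y1 y2 => ?_, fun y y1 y2 i hi => ?_, fun y y1 y2 i hi => ?_,
    fun i y y1 y2 y3 => ?_, fun i y y1 y2 y3 => ?_⟩
  · cases k <;> exact le_clip _ _ _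
  · cases k <;> exact clip_le _ hl.le
  · have := M.ty _ (hin y y1 y2).1 (hin y y1 y2).2.1 (hin y y1 y2).2.2
    convert this using 1
    · ext i
      simp only [lnOf, Set.mem_ofPred_eq, lt_clip y1.le, y2, true_and, M.lt_FO (h0.trans y1.le), Fo]
      constructor
      · rintro ⟨q, q1, q2, q3⟩
        refine ⟨q, fun a => ?_, q1⟩
        rcases bool_cases a d with rfl | rfl
        · rwa [pt_e]
        · rwa [pt_ne]
      · rintro ⟨q, q2, q1⟩
        exact ⟨q, q1, by simpa [pt_e] using q2 d, by simpa [pt_ne] using q2 (!d)⟩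
    · ext i
      simp only [lnOf, Set.mem_ofPred_eq, clip_lt y2.le, y1, true_and, M.PO_lt (y2.le.trans h1), Po]
      constructor
      · rintro ⟨q, q1, q2, q3⟩
        refine ⟨q, fun a => ?_, q1⟩
        rcases bool_cases a d with rfl | rfl
        · rwa [pt_e]
        · rwa [pt_ne]
      · rintro ⟨q, q2, q1⟩
        exact ⟨q, q1, by simpa [pt_e] using q2 d, by simpa [pt_ne] using q2 (!d)⟩
  · have := M.le_FV (d := d) (z := z) hi (by rw [pt_e])
    rw [pt_ne] at this
    exact le_max_of_le_right (le_min y2.le this)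
  · have := M.PV_le (d := d) (z := z) hi (by rw [pt_e])
    rw [pt_ne] at this
    exact max_le y1.le ((min_le_right _ _).trans this)
  · obtain ⟨yh, y4⟩ := (lt_clip y1).1 y3
    obtain ⟨q, q1, q2, q3⟩ := (M.lt_FV (h0.trans y1)).1 y4
    have hq : q d = z := by
      refine le_antisymm ?_ q2
      by_contra hc
      exact absurd y2 (not_le.2 ((lt_clip y1).2 ⟨yh, (M.lt_FO (h0.trans y1)).2 ⟨q, q1, not_le.1 hc, q3⟩⟩))
    by_cases hh : q (!d) < h
    · refine Or.inr ⟨q (!d), q3, hh, ?_⟩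
      rw [← hq, pt_eta M]; exact q1
    · exact Or.inl (hF i q q1 hq (not_lt.1 hh))
  · obtain ⟨yh, y4⟩ := (clip_lt y1).1 y3
    obtain ⟨q, q1, q2, q3⟩ := (M.PV_lt (y1.trans h1)).1 y4
    have hq : q d = z := by
      refine le_antisymm q2 ?_
      by_contra hc
      exact absurd y2 (not_le.2 ((clip_lt y1).2 ⟨yh, (M.PO_lt (y1.trans h1)).2 ⟨q, q1, not_le.1 hc, q3⟩⟩))
    by_cases hh : l < q (!d)
    · refine Or.inr ⟨q (!d), hh, q3, ?_⟩
      rw [← hq, pt_eta M]; exact q1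
    · exact Or.inl (hP i q q1 hq (not_lt.1 hh))

theorem line_rect {B} (hB : Alive B) {d : Bool} {z : ℝ} (z1 : B d false < z) (z2 : z < B d true) :
    LineR Ty (B (!d) false) (B (!d) true) (fun i => z ≤ cfgOf τ B d (ff i)) (fun i => cfgOf τ B d (np i) ≤ z)
      (lnOf τ d z (B (!d) false) (B (!d) true)) (fun y => τ (Tr.pt d z y)) := by
  refine line_gen M (hB.ge0 _ _) (hB.lt _) (hB.le1 _ _) (fun y y1 y2 => ?_) _ _ (fun i q q1 q2 q3 => ?_)
    (fun i q q1 q2 q3 => ?_)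
  · obtain ⟨a1, a2, a3, a4, a5⟩ := hB
    cases d
    · refine ⟨?_, ?_, ?_⟩ <;> simp [Tr.pt, tcOf] at * <;> linarith
    · refine ⟨?_, ?_, ?_⟩ <;> simp [Tr.pt, tcOf] at * <;> linarith
  · have := M.le_FV (d := !d) q1 q3
    rw [Bool.not_not, q2] at this
    exact le_max_of_le_right (le_min z2.le this)
  · have := M.PV_le (d := !d) q1 q3
    rw [Bool.not_not, q2] at this
    exact max_le z1.le ((min_le_right _ _).trans this)

theorem line_h {l h z : ℝ} (h0 : 0 ≤ l) (h1 : h ≤ 1) (z1 : l < z) (z2 : z < h) :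
    LineR Ty l z (fun _ => False) (fun i => tcOf τ l h (np i) ≤ z) (lnOf τ true z l z)
      (fun y => τ (Tr.pt true z y)) := by
  refine line_gen M h0 z1 (z2.le.trans h1) (fun y y1 y2 => ?_) _ _ (fun i q q1 q2 q3 => ?_)
    (fun i q q1 q2 q3 => ?_)
  · refine ⟨?_, ?_, ?_⟩ <;> simp [Tr.pt, tcOf] at * <;> linarith
  · have := (M.sup q i q1).2.1
    simp only [Bool.not_true] at q3; linarith
  · have := M.PV_le (d := false) q1 q3
    rw [Bool.not_false, q2] at this
    exact max_le z1.le ((min_le_right _ _).trans this)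

theorem line_v {l h z : ℝ} (h0 : 0 ≤ l) (h1 : h ≤ 1) (z1 : l < z) (z2 : z < h) :
    LineR Ty z h (fun i => z ≤ tcOf τ l h (ff i)) (fun _ => False) (lnOf τ false z z h)
      (fun y => τ (Tr.pt false z y)) := by
  refine line_gen M (h0.trans z1.le) z2 h1 (fun y y1 y2 => ?_) _ _ (fun i q q1 q2 q3 => ?_)
    (fun i q q1 q2 q3 => ?_)
  · refine ⟨?_, ?_, ?_⟩ <;> simp [Tr.pt, tcOf] at * <;> linarith
  · have := M.le_FV (d := true) q1 q3
    rw [Bool.not_true, q2] at this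
    exact le_max_of_le_right (le_min z2.le this)
  · have := (M.sup q i q1).2.1
    simp only [Bool.not_false] at q3; linarith
omit M

/-- change one side of a rectangle -/
noncomputable def upd (B : Bool → Bool → ℝ) (d side : Bool) (z : ℝ) : Bool → Bool → ℝ :=
  fun a b => if a = d ∧ b = side then z else B a b

theorem upd_alive {B} (hB : Alive B) {d : Bool} {z : ℝ} (side : Bool) (z1 : B d false < z) (z2 : z < B d true) :
    Alive (upd B d side z) := by
  obtain ⟨a1, a2, a3, a4, a5⟩ := hB
  cases d <;> cases side <;> refine ⟨?_, ?_, ?_, ?_, ?_⟩ <;> simp [upd] <;> linarith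

theorem ch1_cfg {B} {d : Bool} {z : ℝ} (z1 : B d false < z) (z2 : z < B d true) :
    ch1 (cfgOf τ B) d z (lnOf τ d z (B (!d) false) (B (!d) true)) = cfgOf τ (upd B d true z) := by
  funext a j
  rcases bool_cases a d with rfl | rfl
  · cases j <;> simp [ch1, cfgOf, upd, clip_min z1.le z2.le, z1.le, z2.le]
  · cases j <;> simp [ch1, cfgOf, upd, setFar, lnOf]

theorem ch2_cfg {B} {d : Bool} {z : ℝ} (z1 : B d false < z) (z2 : z < B d true) :
    ch2 (cfgOf τ B) d z (lnOf τ d z (B (!d) false) (B (!d) true)) = cfgOf τ (upd B d false z) := by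
  funext a j
  rcases bool_cases a d with rfl | rfl
  · cases j <;> simp [ch2, cfgOf, upd, clip_max z1.le, z1.le, z2.le]
  · cases j <;> simp [ch2, cfgOf, upd, setNear, lnOf]

theorem tri1_cfg {l h z : ℝ} (z1 : l < z) (z2 : z < h) :
    tri1 (tcOf τ l h) z (lnOf τ true z l z) = tcOf τ l z := by
  funext j
  cases j <;> simp [tri1, tcOf, setFar, lnOf, clip_min z1.le z2.le, z1.le, z2.le]
theorem tri2_cfg {l h z : ℝ} (z1 : l < z) (z2 : z < h) :
    tri2 (tcOf τ l h) z (lnOf τ false z z h) = tcOf τ z h := by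
  funext j
  cases j <;> simp [tri2, tcOf, setNear, lnOf, clip_max z1.le, z1.le, z2.le]

def rectT (l z h : ℝ) (a b : Bool) : ℝ := if a then (if b then h else z) else (if b then z else l)

theorem triR_cfg {l h z : ℝ} (z1 : l < z) (z2 : z < h) :
    triR (tcOf τ l h) z (lnOf τ true z l z) (lnOf τ false z z h) = cfgOf τ (rectT l z h) := by
  funext a j
  cases a
  · cases j <;> simp [triR, tcOf, cfgOf, rectT, setNear, lnOf, clip_min z1.le z2.le, z1.le, z2.le]
  · cases j <;> simp [triR, tcOf, cfgOf, rectT, setFar, lnOf, clip_max z1.le, z1.le, z2.le]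

end
end HP

namespace HP
open J K
section
variable {I : Type} (τ : (Bool → ℝ) → Set I)

def Sub (B' B : Bool → Bool → ℝ) : Prop := ∀ a, B a false ≤ B' a false ∧ B' a true ≤ B a true

def Brk (r : ℕ) (B : Bool → Bool → ℝ) : Prop :=
  ∃ δ : ℝ, 0 < δ ∧ ∃ n : Bool → ℕ, n false + n true ≤ r ∧ (∀ a, B a true - B a false ≤ n a * δ) ∧
    ∀ B', Alive B' → Sub B' B → (∀ a, B' a true - B' a false ≤ δ) → ¬ SameK (cfgOf τ B) (cfgOf τ B')

variable {τ} {Ty : Set I → Set I → Set I → Prop}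

theorem brk_sub {r B B'} (h : Brk τ r B) (hs : Sub B' B) (hk : SameK (cfgOf τ B) (cfgOf τ B')) : Brk τ r B' := by
  obtain ⟨δ, h1, n, h2, h3, h4⟩ := h
  refine ⟨δ, h1, n, h2, fun a => ?_, fun B1 b1 b2 b3 b4 => ?_⟩
  · have := h3 a
    have := hs a
    linarith
  · exact h4 B1 b1 (fun a => ⟨(hs a).1.trans (b2 a).1, (b2 a).2.trans (hs a).2⟩) b3 (hk.trans b4)

theorem upd_sub {B : Bool → Bool → ℝ} {d : Bool} {z : ℝ} (side : Bool) (z1 : B d false < z) (z2 : z < B d true) :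
    Sub (upd B d side z) B := by
  intro a
  cases a <;> cases d <;> cases side <;> simp [upd] <;> linarith

theorem brk_split {r B} (hB : Alive B) (h : Brk τ r B) : ∃ d z, B d false < z ∧ z < B d true ∧
    ∀ side, SameK (cfgOf τ B) (cfgOf τ (upd B d side z)) → ∃ r' < r, Brk τ r' (upd B d side z) := by
  obtain ⟨δ, h1, n, h2, h3, h4⟩ := h
  have hex : ∃ d, δ < B d true - B d false := by
    by_contra hc
    push Not at hc
    exact h4 B hB (fun a => ⟨le_rfl, le_rfl⟩) hc ⟨rfl, rfl, rfl, rfl⟩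
  obtain ⟨d, hd⟩ := hex
  have z1 : B d false < B d false + δ := by linarith
  have z2 : B d false + δ < B d true := by linarith
  have hn : 2 ≤ n d := by
    by_contra hc
    have h5 : ((n d : ℕ) : ℝ) ≤ 1 := by exact_mod_cast (by omega : n d ≤ 1)
    have := h3 d
    nlinarith
  refine ⟨d, B d false + δ, z1, z2, fun side hk => ?_⟩
  refine ⟨r - 1, by cases d <;> omega, δ, h1, fun a => if a = d then n d - 1 else n a, ?_, fun a => ?_, ?_⟩
  · cases d <;> simp <;> omega
  · have hc : ((n d - 1 : ℕ) : ℝ) = n d - 1 := by rw [Nat.cast_sub (by omega)]; simp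
    have h2n : (2:ℝ) ≤ n d := by exact_mod_cast hn
    have h3a := h3 a
    rcases bool_cases a d with rfl | rfl
    · simp only [if_true, hc]
      cases side
      · simp [upd]; linarith
      · simp [upd]; nlinarith
    · simpa [upd] using h3a
  · intro B1 b1 b2 b3 b4
    have hs := upd_sub side z1 z2
    exact h4 B1 b1 (fun a => ⟨(hs a).1.trans (b2 a).1, (b2 a).2.trans (hs a).2⟩) b3 (hk.trans b4)

variable (M : Mod τ Ty)
include M

theorem filled_of_limit {B0} (h0 : Alive B0) (v : Bool → ℝ) (hv : ∀ a, B0 a false < v a ∧ v a < B0 a true)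
    (hl : ∀ ε > 0, ∃ B', Alive B' ∧ SameK (cfgOf τ B0) (cfgOf τ B') ∧
      ∀ a b, |B' a b - v a| < ε) : Filled Ty (cfgOf τ B0) := by
  have hT : kTop (cfgOf τ B0) = Fo τ v := by
    apply Set.Subset.antisymm
    · rintro i ⟨a, ha⟩
      have h1 := (hv a).2.trans_le ha
      obtain ⟨-, h2⟩ := (lt_clip (hv a).1.le).1 h1
      obtain ⟨q, q1, q2, q3⟩ := (M.lt_FV ((h0.ge0 _ _).trans (hv a).1.le)).1 h2
      refine ⟨q, fun b => ?_, q1⟩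
      rcases bool_cases b a with rfl | rfl
      · simpa using q3
      · exact (hv _).2.trans_le q2
    · rintro i ⟨q, q2, q1⟩
      obtain ⟨B', b1, b2, b3⟩ := hl (min (q false - v false) (q true - v true))
        (lt_min (sub_pos.2 (q2 _)) (sub_pos.2 (q2 _)))
      rw [b2.top]
      have hq : ∀ a, B' a true ≤ q a := by
        intro a
        have h1 := (abs_lt.1 (b3 a true)).2
        have h2 : min (q false - v false) (q true - v true) ≤ q a - v a := by
          cases a
          · exact min_le_left _ _
          · exact min_le_right _ _
        linarith
      refine ⟨false, ?_⟩
      exact le_max_of_le_right (le_min le_rfl ((hq false).trans (M.le_FV (d := true) q1 (hq true))))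
  have hP : kPb (cfgOf τ B0) = Po τ v := by
    apply Set.Subset.antisymm
    · rintro i ⟨a, ha⟩
      have h1 := ha.trans_lt (hv a).1
      obtain ⟨-, h2⟩ := (clip_lt (hv a).2.le).1 h1
      obtain ⟨q, q1, q2, q3⟩ := (M.PV_lt ((hv a).2.le.trans (h0.le1 _ _))).1 h2
      refine ⟨q, fun b => ?_, q1⟩
      rcases bool_cases b a with rfl | rfl
      · simpa using q3
      · exact q2.trans_lt (hv _).1
    · rintro i ⟨q, q2, q1⟩
      obtain ⟨B', b1, b2, b3⟩ := hl (min (v false - q false) (v true - q true))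
        (lt_min (sub_pos.2 (q2 _)) (sub_pos.2 (q2 _)))
      rw [b2.pb]
      have hq : ∀ a, q a ≤ B' a false := by
        intro a
        have h1 := (abs_lt.1 (b3 a false)).1
        have h2 : min (v false - q false) (v true - q true) ≤ v a - q a := by
          cases a
          · exact min_le_left _ _
          · exact min_le_right _ _
        linarith
      refine ⟨false, ?_⟩
      exact max_le le_rfl ((min_le_right _ _).trans ((M.PV_le (d := true) q1 (hq true)).trans (hq false)))
  refine ⟨τ v, ?_, fun i hi a => ?_, fun i hi a => ?_⟩
  · rw [hT, hP]
    obtain ⟨a1, a2, a3, a4, a5⟩ := h0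
    have := hv false
    have := hv true
    exact M.ty v (by linarith) (by linarith) (by linarith)
  · refine (lt_clip le_rfl).2 ⟨h0.lt a, (M.lt_FO (h0.ge0 _ _)).2 ⟨v, hi, (hv _).1, ?_⟩⟩
    simpa using (hv a).1
  · refine (clip_lt le_rfl).2 ⟨h0.lt a, (M.PO_lt (h0.le1 _ _)).2 ⟨v, hi, (hv _).2, ?_⟩⟩
    simpa using (hv a).2

theorem brk_exists {B B0} (h0 : Alive B0) (hs : ∀ a, B0 a false < B a false ∧ B a true < B0 a true)
    (hk : SameK (cfgOf τ B) (cfgOf τ B0)) (hf : ¬ Filled Ty (cfgOf τ B)) : ∃ r, Brk τ r B := by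
  have hδ : ∃ δ : ℝ, 0 < δ ∧ ∀ B', Alive B' → Sub B' B → (∀ a, B' a true - B' a false ≤ δ) →
      ¬ SameK (cfgOf τ B) (cfgOf τ B') := by
    by_contra hc
    push Not at hc
    refine hf (((hk.symm.filled Ty)).1 ?_)
    choose D d1 d2 d3 d4 using fun n : ℕ => hc (1/((n:ℝ)+1)) (by positivity)
    obtain ⟨v, v1, φ, v2, v3⟩ := (isCompact_Icc (a := fun a => B a false) (b := fun a => B a true)).tendsto_subseq
      (x := fun n a => D n a false) (fun n => ⟨fun a => (d2 n a).1, fun a => ((d1 n).lt a).le.trans (d2 n a).2⟩)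
    have v1l := v1.1
    have v1u := v1.2
    refine filled_of_limit M h0 v (fun a => ⟨(hs a).1.trans_le (v1l a), (v1u a).trans_lt (hs a).2⟩) ?_
    intro ε hε
    rw [tendsto_pi_nhds] at v3
    have e1 : ∀ a, ∀ᶠ n in Filter.atTop, |D (φ n) a false - v a| < ε/2 := by
      intro a
      have := (Metric.tendsto_nhds.1 (v3 a)) (ε/2) (by linarith)
      simpa [Real.dist_eq] using this
    have e2 : ∀ᶠ n in Filter.atTop, 1/(((φ n : ℕ):ℝ)+1) < ε/2 := by
      have := (tendsto_one_div_add_atTop_nhds_zero_nat (𝕜 := ℝ)).comp v2.tendsto_atTop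
      exact this.eventually (gt_mem_nhds (by linarith : (0:ℝ) < ε/2))
    obtain ⟨n, n1, n2, n3⟩ := ((e1 false).and ((e1 true).and e2)).exists
    refine ⟨D (φ n), d1 _, hk.symm.trans (d4 _), fun a b => ?_⟩
    have h1 : |D (φ n) a false - v a| < ε/2 := by
      cases a
      · exact n1
      · exact n2
    have h2 := d3 (φ n) a
    have h3 := (d1 (φ n)).lt a
    rw [abs_lt] at h1 ⊢
    cases b
    · constructor <;> linarith
    · constructor <;> linarith
  obtain ⟨δ, h1, h2⟩ := hδ
  have hn : ∀ a, ∃ n : ℕ, B a true - B a false ≤ n * δ := fun a => by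
    obtain ⟨n, hn⟩ := exists_nat_ge ((B a true - B a false)/δ)
    exact ⟨n, by rwa [div_le_iff₀ h1] at hn⟩
  choose n hn using hn
  exact ⟨_, δ, h1, n, le_rfl, hn, h2⟩
end
end HP

namespace HP
open J K

abbrev Code (I : Type) := (Bool → J I → ℕ) × (Bool → Bool → Prop)

def mkQ {I : Type} (MR : Set (Code I)) (MT : Set (J I → ℕ)) (ρ : Code I → ℕ) : PSys I where
  S := MR
  T := MT
  cfg s := s.1.1
  E s := s.1.2
  ρ s := ρ s.1
  tcfg s := s.1

/-- bounded version of `Good` -/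
structure BGood {I : Type} (N : ℕ) (Ty : Set I → Set I → Set I → Prop) (Q : PSys I) : Prop where
  bd : ∀ s a j, Q.cfg s a j < N
  tbd : ∀ s j, Q.tcfg s j < N
  ev : ∀ s a j, Even (Q.cfg s a j)
  tev : ∀ s j, Even (Q.tcfg s j)
  cst : ∀ s, Cst (Q.cfg s)
  tcst : ∀ s, TCst (Q.tcfg s)
  rv : ∀ s d k, Q.cfg s d lo < k → k < Q.cfg s d hi → ∃ C z L, (∀ a j, C a j < N) ∧
    RPos (Q.cfg s d) k (C d) z ∧ Split Ty Q s d C z L noReq False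
  rcf : ∀ s e i k, Q.cfg s e lo ≤ k → k < Q.cfg s e (nf i) → Q.cfg s e (ff i) ≤ k →
    Q.cfg s (!e) (ff i) ≤ Q.cfg s (!e) lo → ∃ C z L k' k0, (∀ a j, C a j < N) ∧ RPos (Q.cfg s e) k (C e) k' ∧
      Even k0 ∧ k' < k0 ∧ k0 < C e hi ∧ Split Ty Q s (!e) C z L (oneReq k0 i) False
  rcp : ∀ s e i k, k ≤ Q.cfg s e hi → Q.cfg s e (fp i) < k → k ≤ Q.cfg s e (np i) →
    Q.cfg s (!e) hi ≤ Q.cfg s (!e) (np i) → ∃ C z L k' k0, (∀ a j, C a j < N) ∧ k' < N ∧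
      RPos (Q.cfg s e) k (C e) k' ∧
      Even k0 ∧ k0 < k' ∧ C e lo < k0 ∧ Split Ty Q s (!e) C z L (oneReq k0 i) False
  rr : ∀ s, ¬ Filled Ty (Q.cfg s) → (∀ a b, ¬ Q.E s a b) → ∃ d C z L, (∀ a j, C a j < N) ∧
    Split Ty Q s d C z L noReq True
  tv : ∀ s k, Q.tcfg s lo < k → k < Q.tcfg s hi → ∃ C z Lh Lv, (∀ j, C j < N) ∧ RPos (Q.tcfg s) k C z ∧
    TSplit Ty Q s C z Lh Lv noReq noReq
  tcf : ∀ s i k, Q.tcfg s lo ≤ k → k < Q.tcfg s (nf i) → Q.tcfg s (ff i) ≤ Q.tcfg s lo →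
    ∃ C z Lh Lv k' k0, (∀ j, C j < N) ∧ RPos (Q.tcfg s) k C k' ∧ Even k0 ∧ k' < k0 ∧ z < k0 ∧ k0 < C hi ∧
      TSplit Ty Q s C z Lh Lv noReq (oneReq k0 i)
  tcp : ∀ s i k, k ≤ Q.tcfg s hi → Q.tcfg s (fp i) < k → Q.tcfg s hi ≤ Q.tcfg s (np i) →
    ∃ C z Lh Lv k' k0, (∀ j, C j < N) ∧ k' < N ∧ RPos (Q.tcfg s) k C k' ∧ Even k0 ∧ k0 < k' ∧ C lo < k0 ∧
      k0 < z ∧ TSplit Ty Q s C z Lh Lv (oneReq k0 i) noReq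

theorem BGood.good {I : Type} {N : ℕ} {Ty : Set I → Set I → Set I → Prop} {Q : PSys I} (G : BGood N Ty Q) :
    Good Ty Q where
  ev := G.ev
  tev := G.tev
  cst := G.cst
  tcst := G.tcst
  rv s d k h1 h2 := by
    obtain ⟨C, z, L, -, h⟩ := G.rv s d k h1 h2
    exact ⟨C, z, L, h⟩
  rcf s e i k h1 h2 h3 h4 := by
    obtain ⟨C, z, L, k', k0, -, h⟩ := G.rcf s e i k h1 h2 h3 h4
    exact ⟨C, z, L, k', k0, h⟩
  rcp s e i k h1 h2 h3 h4 := by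
    obtain ⟨C, z, L, k', k0, -, -, h⟩ := G.rcp s e i k h1 h2 h3 h4
    exact ⟨C, z, L, k', k0, h⟩
  rr s h1 h2 := by
    obtain ⟨d, C, z, L, -, h⟩ := G.rr s h1 h2
    exact ⟨d, C, z, L, h⟩
  tv s k h1 h2 := by
    obtain ⟨C, z, Lh, Lv, -, h⟩ := G.tv s k h1 h2
    exact ⟨C, z, Lh, Lv, h⟩
  tcf s i k h1 h2 h3 := by
    obtain ⟨C, z, Lh, Lv, k', k0, -, h⟩ := G.tcf s i k h1 h2 h3
    exact ⟨C, z, Lh, Lv, k', k0, h⟩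
  tcp s i k h1 h2 h3 := by
    obtain ⟨C, z, Lh, Lv, k', k0, -, -, h⟩ := G.tcp s i k h1 h2 h3
    exact ⟨C, z, Lh, Lv, k', k0, h⟩

section maps
variable {I : Type}

theorem ch1_map {g : ℝ → ℕ} (hg : Monotone g) (C : Bool → J I → ℝ) (d z) (L : K I → ℝ) (a j) :
    ch1 (fun a j => g (C a j)) d (g z) (fun k => g (L k)) a j = g (ch1 C d z L a j) := by
  rcases bool_cases a d with rfl | rfl
  · simp only [ch1, if_true, hg.map_min]
  · simp only [ch1, Bool.not_eq_self, if_false, setFar_map]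
theorem ch2_map {g : ℝ → ℕ} (hg : Monotone g) (C : Bool → J I → ℝ) (d z) (L : K I → ℝ) (a j) :
    ch2 (fun a j => g (C a j)) d (g z) (fun k => g (L k)) a j = g (ch2 C d z L a j) := by
  rcases bool_cases a d with rfl | rfl
  · simp only [ch2, if_true, hg.map_max]
  · simp only [ch2, Bool.not_eq_self, if_false, setNear_map]
theorem tri1_map {g : ℝ → ℕ} (hg : Monotone g) (A : J I → ℝ) (z) (L : K I → ℝ) (j) :
    tri1 (fun j => g (A j)) (g z) (fun k => g (L k)) j = g (tri1 A z L j) := by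
  simp only [tri1, ← hg.map_min, setFar_map]
theorem tri2_map {g : ℝ → ℕ} (hg : Monotone g) (A : J I → ℝ) (z) (L : K I → ℝ) (j) :
    tri2 (fun j => g (A j)) (g z) (fun k => g (L k)) j = g (tri2 A z L j) := by
  simp only [tri2, ← hg.map_max, setNear_map]
theorem triR_map {g : ℝ → ℕ} (hg : Monotone g) (A : J I → ℝ) (z) (L L' : K I → ℝ) (a j) :
    triR (fun j => g (A j)) (g z) (fun k => g (L k)) (fun k => g (L' k)) a j = g (triR A z L L' a j) := by
  cases a
  · simp only [triR, ← hg.map_min, Bool.false_eq_true, if_false, setNear_map]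
  · simp only [triR, ← hg.map_max, if_true, setFar_map]

theorem min_mem {F : Finset ℝ} {x y : ℝ} (h1 : x ∈ F) (h2 : y ∈ F) : min x y ∈ F := by
  rcases min_choice x y with h | h <;> rw [h] <;> assumption
theorem max_mem {F : Finset ℝ} {x y : ℝ} (h1 : x ∈ F) (h2 : y ∈ F) : max x y ∈ F := by
  rcases max_choice x y with h | h <;> rw [h] <;> assumption
theorem setFar_mem {F : Finset ℝ} {A : J I → ℝ} {L : K I → ℝ} (h1 : ∀ j, A j ∈ F) (h2 : ∀ k, L k ∈ F) (j) :
    setFar A L j ∈ F := by cases j <;> simp only [setFar, h1, h2]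
theorem setNear_mem {F : Finset ℝ} {A : J I → ℝ} {L : K I → ℝ} (h1 : ∀ j, A j ∈ F) (h2 : ∀ k, L k ∈ F) (j) :
    setNear A L j ∈ F := by cases j <;> simp only [setNear, h1, h2]
theorem ch1_mem {F : Finset ℝ} {C : Bool → J I → ℝ} {d z} {L : K I → ℝ} (h1 : ∀ a j, C a j ∈ F) (hz : z ∈ F)
    (h2 : ∀ k, L k ∈ F) (a j) : ch1 C d z L a j ∈ F := by
  unfold ch1; split_ifs
  · exact min_mem (h1 _ _) hz
  · exact setFar_mem (h1 _) h2 j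
theorem ch2_mem {F : Finset ℝ} {C : Bool → J I → ℝ} {d z} {L : K I → ℝ} (h1 : ∀ a j, C a j ∈ F) (hz : z ∈ F)
    (h2 : ∀ k, L k ∈ F) (a j) : ch2 C d z L a j ∈ F := by
  unfold ch2; split_ifs
  · exact max_mem (h1 _ _) hz
  · exact setNear_mem (h1 _) h2 j
theorem tri1_mem {F : Finset ℝ} {A : J I → ℝ} {z} {L : K I → ℝ} (h1 : ∀ j, A j ∈ F) (hz : z ∈ F)
    (h2 : ∀ k, L k ∈ F) (j) : tri1 A z L j ∈ F := setFar_mem (fun j => min_mem (h1 j) hz) h2 j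
theorem tri2_mem {F : Finset ℝ} {A : J I → ℝ} {z} {L : K I → ℝ} (h1 : ∀ j, A j ∈ F) (hz : z ∈ F)
    (h2 : ∀ k, L k ∈ F) (j) : tri2 A z L j ∈ F := setNear_mem (fun j => max_mem (h1 j) hz) h2 j
theorem triR_mem {F : Finset ℝ} {A : J I → ℝ} {z} {L L' : K I → ℝ} (h1 : ∀ j, A j ∈ F) (hz : z ∈ F)
    (h2 : ∀ k, L k ∈ F) (h3 : ∀ k, L' k ∈ F) (a j) : triR A z L L' a j ∈ F := by
  cases a
  · exact setNear_mem (fun j => min_mem (h1 j) hz) h2 j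
  · exact setFar_mem (fun j => max_mem (h1 j) hz) h3 j

theorem kap_oeq {ι : Type} {F : Finset ℝ} {A : ι → ℝ} (h : ∀ x, A x ∈ F) : OEq A (fun x => kap F (A x)) :=
  fun _ y => (kap_lt F (Or.inl (h y))).symm
theorem kap_rpos {ι : Type} {F : Finset ℝ} {A : ι → ℝ} (h : ∀ x, A x ∈ F) (y : ℝ) :
    RPos A y (fun x => kap F (A x)) (kap F y) :=
  fun x => ⟨(kap_lt F (Or.inr (h x))).symm, (kap_lt F (Or.inl (h x))).symm⟩
end maps

section
variable {I : Type} (τ : (Bool → ℝ) → Set I) (Ty : Set I → Set I → Set I → Prop) (N : ℕ)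

def Sem (c : Code I) (r : ℕ) : Prop := ∃ B B0, Alive B ∧ Alive B0 ∧ (∀ a, OEq (cfgOf τ B a) (c.1 a)) ∧
  SameK (cfgOf τ B) (cfgOf τ B0) ∧ Sub B B0 ∧ (∀ a b, ¬ c.2 a b → B a b ≠ B0 a b) ∧
  ((∀ a b, ¬ c.2 a b) → ¬ Filled Ty (cfgOf τ B) → Brk τ r B)

def MR : Set (Code I) := {c | (∀ a j, Even (c.1 a j) ∧ c.1 a j < N) ∧ ∃ r, Sem τ Ty c r}
def MT : Set (J I → ℕ) := {A | (∀ j, Even (A j) ∧ A j < N) ∧ ∃ l h, 0 ≤ l ∧ l < h ∧ h ≤ 1 ∧ OEq (tcOf τ l h) A}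
noncomputable def rk (c : Code I) : ℕ := sInf {r | Sem τ Ty c r}

noncomputable abbrev QQ : PSys I := mkQ (MR τ Ty N) (MT τ N) (rk τ Ty)

variable {τ Ty N}

theorem rk_sem {c : Code I} (h : ∃ r, Sem τ Ty c r) : Sem τ Ty c (rk τ Ty c) := Nat.sInf_mem h
theorem rk_le {c : Code I} {r} (h : Sem τ Ty c r) : rk τ Ty c ≤ r := Nat.sInf_le h

variable (M : Mod τ Ty)
include M

theorem child {B B0 : Bool → Bool → ℝ} {E : Bool → Bool → Prop} {r : ℕ} (hB : Alive B) (hB0 : Alive B0)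
    (hk : SameK (cfgOf τ B) (cfgOf τ B0)) (hs : Sub B B0) (hE : ∀ a b, ¬ E a b → B a b ≠ B0 a b)
    (hr : (∀ a b, ¬ E a b) → ¬ Filled Ty (cfgOf τ B) → Brk τ r B)
    {d z} (z1 : B d false < z) (z2 : z < B d true) (side : Bool) (strict : Prop)
    (hst : strict → SameK (cfgOf τ B) (cfgOf τ (upd B d side z)) → ∃ r' < r, Brk τ r' (upd B d side z))
    (C : Bool → J I → ℕ) (hC : ∀ a, OEq (cfgOf τ (upd B d side z) a) (C a)) :
    ∃ E', (∃ r', Sem τ Ty (C, E') r') ∧ (SameK (cfgOf τ B) (cfgOf τ (upd B d side z)) →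
      (∀ a b, E' a b → E a b ∧ ¬ (a = d ∧ b = side)) ∧
      ((∀ a b, ¬ E a b) → ¬ Filled Ty (cfgOf τ B) → Sem τ Ty (C, E') r ∧
        (strict → ∃ r' < r, Sem τ Ty (C, E') r'))) := by
  set B' := upd B d side z with hB'
  have al : Alive B' := upd_alive hB side z1 z2
  have sb : Sub B' B := upd_sub side z1 z2
  by_cases hsk : SameK (cfgOf τ B) (cfgOf τ B')
  · have key : ∀ a b, ¬ (E a b ∧ ¬ (a = d ∧ b = side)) → B' a b ≠ B0 a b := by
      intro a b h
      by_cases hab : a = d ∧ b = side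
      · obtain ⟨rfl, rfl⟩ := hab
        have : B' a b = z := by simp [hB', upd]
        rw [this]
        have := hs a
        cases b
        · exact ((hs a).1.trans_lt z1).ne'
        · exact (z2.trans_le (hs a).2).ne
      · have : B' a b = B a b := by simp only [hB', upd, if_neg hab]
        rw [this]
        exact hE a b (fun h' => h ⟨h', hab⟩)
    have sb0 : Sub B' B0 := fun a => ⟨(hs a).1.trans (sb a).1, (sb a).2.trans (hs a).2⟩
    have mk : ∀ r', Brk τ r' B' → Sem τ Ty (C, fun a b => E a b ∧ ¬ (a = d ∧ b = side)) r' := fun r' h =>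
      ⟨B', B0, al, hB0, hC, hsk.symm.trans hk, sb0, key, fun _ _ => h⟩
    refine ⟨fun a b => E a b ∧ ¬ (a = d ∧ b = side), ?_, fun _ => ⟨fun a b h => h, fun h1 h2 => ⟨?_, fun h3 => ?_⟩⟩⟩
    · by_cases hc : (∀ a b, ¬ (E a b ∧ ¬ (a = d ∧ b = side))) ∧ ¬ Filled Ty (cfgOf τ B')
      · obtain ⟨r', hr'⟩ := brk_exists M (B := B') hB0 (fun a =>
          ⟨lt_of_le_of_ne (sb0 a).1 (key _ _ (hc.1 a false)).symm, lt_of_le_of_ne (sb0 a).2 (key _ _ (hc.1 a true))⟩)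
          (hsk.symm.trans hk) hc.2
        exact ⟨r', mk r' hr'⟩
      · exact ⟨0, B', B0, al, hB0, hC, hsk.symm.trans hk, sb0, key, fun h1 h2 => absurd ⟨h1, h2⟩ hc⟩
    · exact mk r (brk_sub (hr h1 h2) sb hsk)
    · obtain ⟨r', q1, q2⟩ := hst h3 hsk
      exact ⟨r', q1, mk r' q2⟩
  · refine ⟨fun _ _ => True, ⟨0, B', B', al, al, hC, ⟨rfl, rfl, rfl, rfl⟩, fun a => ⟨le_rfl, le_rfl⟩,
      fun a b h => absurd trivial h, fun h => absurd trivial (h true true)⟩, fun h => absurd h hsk⟩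

theorem rsplit (s : (QQ τ Ty N).S) {B B0 : Bool → Bool → ℝ} (hB : Alive B) (hB0 : Alive B0)
    (ho : ∀ a, OEq (cfgOf τ B a) (s.1.1 a))
    (hk : SameK (cfgOf τ B) (cfgOf τ B0)) (hs : Sub B B0) (hE : ∀ a b, ¬ s.1.2 a b → B a b ≠ B0 a b)
    (hr : (∀ a b, ¬ s.1.2 a b) → ¬ Filled Ty (cfgOf τ B) → Brk τ (rk τ Ty s.1) B)
    {d z} (z1 : B d false < z) (z2 : z < B d true) (strict : Prop)
    (hst : strict → ∀ side, SameK (cfgOf τ B) (cfgOf τ (upd B d side z)) →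
      ∃ r' < rk τ Ty s.1, Brk τ r' (upd B d side z))
    (F : Finset ℝ) (hF : ∀ a j, cfgOf τ B a j ∈ F) (hz : z ∈ F)
    (hL : ∀ k, lnOf τ d z (B (!d) false) (B (!d) true) k ∈ F) (hN : 2 * F.card + 1 < N) (req : ℕ → I → Prop)
    (hreq : ∀ k i, req k i → ∃ y0 ∈ F, k = kap F y0 ∧ i ∈ τ (Tr.pt d z y0)) :
    Split Ty (QQ τ Ty N) s d (fun a j => kap F (cfgOf τ B a j)) (kap F z)
      (fun k => kap F (lnOf τ d z (B (!d) false) (B (!d) true) k)) req strict := by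
  have hb : ∀ y, kap F y < N := fun y => (kap_bound F y).trans_lt hN
  have mkc : ∀ side : Bool, (∀ a j, cfgOf τ (upd B d side z) a j ∈ F) →
      ∃ s1 : (QQ τ Ty N).S, (QQ τ Ty N).cfg s1 = (fun a j => kap F (cfgOf τ (upd B d side z) a j)) ∧
        Evolves Ty (QQ τ Ty N) s s1 d side strict := by
    intro side hm
    obtain ⟨E', h1, h2⟩ := child M hB hB0 hk hs hE hr z1 z2 side strict (fun h => hst h side)
      (fun a j => kap F (cfgOf τ (upd B d side z) a j)) (fun a => kap_oeq (hm a))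
    refine ⟨⟨(_, E'), fun a j => ⟨(kap_even F).2 (hm a j), hb _⟩, h1⟩, rfl, fun hsk => ?_⟩
    have hsk' : SameK (cfgOf τ B) (cfgOf τ (upd B d side z)) :=
      (OEq.sameK ho).trans (hsk.trans (OEq.sameK (fun a => (kap_oeq (hm a)).symm)))
    obtain ⟨h3, h4⟩ := h2 hsk'
    refine ⟨h3, fun h5 h6 => ?_⟩
    obtain ⟨h7, h8⟩ := h4 h5 (fun hf => h6 (((OEq.sameK ho).filled Ty).1 hf))
    refine ⟨rk_le h7, fun hstr => ?_⟩
    obtain ⟨r', q1, q2⟩ := h8 hstr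
    exact (rk_le q2).trans_lt q1
  refine ⟨fun a => (ho a).symm.trans (kap_oeq (hF a)), fun a j => (kap_even F).2 (hF a j), ?_, ?_, ?_, ?_⟩
  · exact (kap_lt F (Or.inl hz)).2 z1
  · exact (kap_lt F (Or.inr hz)).2 z2
  · have := lemA (line_rect M hB z1 z2) F (hF (!d) lo) (hF (!d) hi) hL req hreq
    simp only [kap_le F (Or.inr hz), kap_le F (Or.inl hz)]; exact this
  · obtain ⟨s1, a1, b1⟩ := mkc true (fun a j => by rw [← ch1_cfg z1 z2]; exact ch1_mem hF hz hL a j)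
    obtain ⟨s2, a2, b2⟩ := mkc false (fun a j => by rw [← ch2_cfg z1 z2]; exact ch2_mem hF hz hL a j)
    refine ⟨s1, s2, ⟨?_, b1⟩, ?_, b2⟩
    · rw [a1]; funext a j; rw [ch1_map (kap_mono F), ch1_cfg z1 z2]
    · rw [a2]; funext a j; rw [ch2_map (kap_mono F), ch2_cfg z1 z2]

theorem tsplit (s : (QQ τ Ty N).T) {l h z : ℝ} (h0 : 0 ≤ l) (h1 : h ≤ 1) (ho : OEq (tcOf τ l h) s.1)
    (z1 : l < z) (z2 : z < h) (F : Finset ℝ) (hF : ∀ j, tcOf τ l h j ∈ F) (hz : z ∈ F)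
    (hL : ∀ k, lnOf τ true z l z k ∈ F) (hL' : ∀ k, lnOf τ false z z h k ∈ F)
    (hN : 2 * F.card + 1 < N) (reqh reqv : ℕ → I → Prop)
    (hreqh : ∀ k i, reqh k i → ∃ y0 ∈ F, k = kap F y0 ∧ i ∈ τ (Tr.pt true z y0))
    (hreqv : ∀ k i, reqv k i → ∃ y0 ∈ F, k = kap F y0 ∧ i ∈ τ (Tr.pt false z y0)) :
    TSplit Ty (QQ τ Ty N) s (fun j => kap F (tcOf τ l h j)) (kap F z)
      (fun k => kap F (lnOf τ true z l z k)) (fun k => kap F (lnOf τ false z z h k)) reqh reqv := by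
  have hb : ∀ y, kap F y < N := fun y => (kap_bound F y).trans_lt hN
  refine ⟨ho.symm.trans (kap_oeq hF), fun j => (kap_even F).2 (hF j), (kap_even F).2 hz, ?_, ?_, ?_, ?_, ?_⟩
  · exact (kap_lt F (Or.inl hz)).2 z1
  · exact (kap_lt F (Or.inr hz)).2 z2
  · have := lemA (line_h M h0 h1 z1 z2) F (hF lo) hz hL reqh hreqh
    simp only [kap_le F (Or.inr hz), kap_le F (Or.inl hz)]; exact this
  · have := lemA (line_v M h0 h1 z1 z2) F hz (hF hi) hL' reqv hreqv
    simp only [kap_le F (Or.inr hz), kap_le F (Or.inl hz)]; exact this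
  · have m1 := fun j => tri1_mem hF hz hL j
    have m2 := fun j => tri2_mem hF hz hL' j
    have m3 := fun a j => triR_mem hF hz hL hL' a j
    have al : Alive (rectT l z h) := ⟨h0, z1, le_rfl, z2, h1⟩
    refine ⟨⟨fun j => kap F (tcOf τ l z j), fun j => ⟨(kap_even F).2 ?_, hb _⟩, l, z, h0, z1, z2.le.trans h1, kap_oeq ?_⟩,
      ⟨fun j => kap F (tcOf τ z h j), fun j => ⟨(kap_even F).2 ?_, hb _⟩, z, h, h0.trans z1.le, z2, h1, kap_oeq ?_⟩,
      ⟨(fun a j => kap F (cfgOf τ (rectT l z h) a j), fun _ _ => True), fun a j => ⟨(kap_even F).2 ?_, hb _⟩,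
        0, rectT l z h, rectT l z h, al, al, fun a => kap_oeq ?_, ⟨rfl, rfl, rfl, rfl⟩, fun a => ⟨le_rfl, le_rfl⟩,
        fun a b h => absurd trivial h, fun h => absurd trivial (h true true)⟩, ?_, ?_, ?_⟩
    · rw [← tri1_cfg z1 z2]; exact m1 j
    · rw [← tri1_cfg z1 z2]; exact m1
    · rw [← tri2_cfg z1 z2]; exact m2 j
    · rw [← tri2_cfg z1 z2]; exact m2
    · rw [← triR_cfg z1 z2]; exact m3 a j
    · rw [← triR_cfg z1 z2]; exact m3 a
    · funext j; exact (congrArg (kap F) (congrFun (tri1_cfg z1 z2) j)).symm.trans (tri1_map (kap_mono F) _ _ _ j).symm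
    · funext j; exact (congrArg (kap F) (congrFun (tri2_cfg z1 z2) j)).symm.trans (tri2_map (kap_mono F) _ _ _ j).symm
    · funext a j; exact (congrArg (kap F) (congrFun (congrFun (triR_cfg z1 z2) a) j)).symm.trans (triR_map (kap_mono F) _ _ _ _ a j).symm
end
end HP

namespace HP
open J K

theorem pull {ι : Type} [Finite ι] {A : ι → ℝ} {B : ι → ℕ} (h : OEq A B) (k : ℕ) : ∃ y : ℝ, RPos B k A y := by
  obtain ⟨g, hg, e⟩ := exists_ext A B h
  refine ⟨g k, fun j => ?_⟩
  rw [← e j]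
  exact ⟨hg.lt_iff_lt.symm, hg.lt_iff_lt.symm⟩

def NBig (I : Type) (N : ℕ) : Prop := ∀ (f : Bool → J I → ℝ) (g g' : K I → ℝ) (x y z : ℝ),
  ∃ F : Finset ℝ, (∀ a j, f a j ∈ F) ∧ (∀ k, g k ∈ F) ∧ (∀ k, g' k ∈ F) ∧ x ∈ F ∧ y ∈ F ∧ z ∈ F ∧ 2 * F.card + 1 < N

section
variable {I : Type} [Finite I] {τ : (Bool → ℝ) → Set I} {Ty : Set I → Set I → Set I → Prop} {N : ℕ}
variable (M : Mod τ Ty) (hN : NBig I N)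
include M hN

theorem bsys : BGood N Ty (QQ τ Ty N) := by
  refine ⟨fun s a j => (s.2.1 a j).2, fun s j => (s.2.1 j).2, fun s a j => (s.2.1 a j).1, fun s j => (s.2.1 j).1,
    ?_, ?_, ?_, ?_, ?_, ?_, ?_, ?_, ?_⟩
  · intro s
    obtain ⟨B, B0, hB, hB0, ho, -⟩ := rk_sem s.2.2
    exact OEq.cst ho (cfg_cst M hB)
  · intro s
    obtain ⟨l, h, h0, hl, h1, ho⟩ := s.2.2
    exact OEq.tcst ho (tc_tcst M h0 hl h1)
  · intro s d k h1 h2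
    obtain ⟨B, B0, hB, hB0, ho, hk, hs, hE, hr⟩ := rk_sem s.2.2
    obtain ⟨y, hy⟩ := pull (ho d) k
    obtain ⟨F, f1, f2, -, f3, -, -, f4⟩ := hN (cfgOf τ B) (lnOf τ d y (B (!d) false) (B (!d) true))
      (lnOf τ d y (B (!d) false) (B (!d) true)) y y y
    exact ⟨_, _, _, fun a j => (kap_bound F _).trans_lt f4, hy.trans' (kap_rpos (f1 d) y),
      rsplit M s hB hB0 ho hk hs hE hr ((hy lo).1.1 h1) ((hy hi).2.1 h2) False (fun h => h.elim) F f1 f3 f2 f4 noReq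
      (fun k i h => h.elim)⟩
  · intro s e i k h1 h2 h3 h4
    obtain ⟨B, B0, hB, hB0, ho, hk, hs, hE, hr⟩ := rk_sem s.2.2
    obtain ⟨y, hy⟩ := pull (ho e) k
    have g1 : B e false ≤ y := not_lt.1 fun h => absurd ((hy lo).2.2 h) (not_lt.2 h1)
    have g2 : y < cfgOf τ B e (nf i) := (hy _).2.1 h2
    have g3 : cfgOf τ B e (ff i) ≤ y := not_lt.1 fun h => absurd ((hy _).2.2 h) (not_lt.2 h3)
    have g4 : cfgOf τ B (!e) (ff i) ≤ B (!e) false := not_lt.1 fun h => absurd ((ho (!e) lo _).1 h) (not_lt.2 h4)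
    obtain ⟨g5, g6⟩ := (lt_clip g1).1 g2
    obtain ⟨q, q1, q2, q3⟩ := (M.lt_FO ((hB.ge0 _ _).trans g1)).1 g6
    have g7 : q (!e) < B (!e) true := by
      by_contra hc
      have := M.le_FV q1 (not_lt.1 hc)
      exact absurd ((lt_clip g1).2 ⟨g5, q3.trans_le this⟩) (not_lt.2 g3)
    rw [Bool.not_not] at q3
    have g8 : q e < B e true := by
      by_contra hc
      have := M.le_FV (d := e) q1 (not_lt.1 hc)
      refine absurd ((lt_clip le_rfl).2 ⟨hB.lt _, ?_⟩) (not_lt.2 g4)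
      rw [Bool.not_not]
      exact q2.trans_le this
    obtain ⟨F, f1, f2, -, f3, f5, -, f4⟩ := hN (cfgOf τ B) (lnOf τ (!e) (q (!e)) (B (!!e) false) (B (!!e) true))
      (lnOf τ (!e) (q (!e)) (B (!!e) false) (B (!!e) true)) (q (!e)) (q e) y
    refine ⟨_, _, _, kap F y, kap F (q e), fun a j => (kap_bound F _).trans_lt f4, hy.trans' (kap_rpos (f1 e) y),
      (kap_even F).2 f5, (kap_lt F (Or.inl f5)).2 q3, (kap_lt F (Or.inr f5)).2 g8,
      rsplit M s hB hB0 ho hk hs hE hr q2 g7 False (fun h => h.elim) F f1 f3 f2 f4 _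
      ?_⟩
    rintro k i ⟨rfl, rfl⟩
    refine ⟨q e, f5, rfl, ?_⟩
    have := pt_eta M (!e) q
    rw [Bool.not_not] at this
    rw [this]; exact q1
  · intro s e i k h1 h2 h3 h4
    obtain ⟨B, B0, hB, hB0, ho, hk, hs, hE, hr⟩ := rk_sem s.2.2
    obtain ⟨y, hy⟩ := pull (ho e) k
    have g1 : y ≤ B e true := not_lt.1 fun h => absurd ((hy hi).1.2 h) (not_lt.2 h1)
    have g2 : cfgOf τ B e (fp i) < y := (hy _).1.1 h2
    have g3 : y ≤ cfgOf τ B e (np i) := not_lt.1 fun h => absurd ((hy _).1.2 h) (not_lt.2 h3)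
    have g4 : B (!e) true ≤ cfgOf τ B (!e) (np i) := not_lt.1 fun h => absurd ((ho (!e) _ hi).1 h) (not_lt.2 h4)
    obtain ⟨g5, g6⟩ := (clip_lt g1).1 g2
    obtain ⟨q, q1, q2, q3⟩ := (M.PO_lt (g1.trans (hB.le1 _ _))).1 g6
    have g7 : B (!e) false < q (!e) := by
      by_contra hc
      have := M.PV_le q1 (not_lt.1 hc)
      exact absurd ((clip_lt g1).2 ⟨g5, this.trans_lt q3⟩) (not_lt.2 g3)
    rw [Bool.not_not] at q3
    have g8 : B e false < q e := by
      by_contra hc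
      have := M.PV_le (d := e) q1 (not_lt.1 hc)
      refine absurd ((clip_lt le_rfl).2 ⟨hB.lt _, ?_⟩) (not_lt.2 g4)
      rw [Bool.not_not]
      exact this.trans_lt q2
    obtain ⟨F, f1, f2, -, f3, f5, f6, f4⟩ := hN (cfgOf τ B) (lnOf τ (!e) (q (!e)) (B (!!e) false) (B (!!e) true))
      (lnOf τ (!e) (q (!e)) (B (!!e) false) (B (!!e) true)) (q (!e)) (q e) y
    refine ⟨_, _, _, kap F y, kap F (q e), fun a j => (kap_bound F _).trans_lt f4, (kap_bound F _).trans_lt f4,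
      hy.trans' (kap_rpos (f1 e) y),
      (kap_even F).2 f5, (kap_lt F (Or.inr f5)).2 q3, (kap_lt F (Or.inl f5)).2 g8,
      rsplit M s hB hB0 ho hk hs hE hr g7 q2 False (fun h => h.elim) F f1 f3 f2 f4 _
      ?_⟩
    rintro k i ⟨rfl, rfl⟩
    refine ⟨q e, f5, rfl, ?_⟩
    have := pt_eta M (!e) q
    rw [Bool.not_not] at this
    rw [this]; exact q1
  · intro s h1 h2
    obtain ⟨B, B0, hB, hB0, ho, hk, hs, hE, hr⟩ := rk_sem s.2.2
    obtain ⟨d, z, z1, z2, hz⟩ := brk_split hB (hr h2 (fun hf => h1 (((OEq.sameK ho).filled Ty).1 hf)))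
    obtain ⟨F, f1, f2, -, f3, -, -, f4⟩ := hN (cfgOf τ B) (lnOf τ d z (B (!d) false) (B (!d) true))
      (lnOf τ d z (B (!d) false) (B (!d) true)) z z z
    exact ⟨d, _, _, _, fun a j => (kap_bound F _).trans_lt f4,
      rsplit M s hB hB0 ho hk hs hE hr z1 z2 True (fun _ => hz) F f1 f3 f2 f4 noReq (fun k i h => h.elim)⟩
  · intro s k h1 h2
    obtain ⟨l, h, a0, al, a1, ho⟩ := s.2.2
    obtain ⟨y, hy⟩ := pull ho k
    obtain ⟨F, f1, f2, f2', f3, -, -, f4⟩ := hN (fun _ => tcOf τ l h) (lnOf τ true y l y) (lnOf τ false y y h) y y y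
    exact ⟨_, _, _, _, fun j => (kap_bound F _).trans_lt f4, hy.trans' (kap_rpos (f1 true) y),
      tsplit M s a0 a1 ho ((hy lo).1.1 h1) ((hy hi).2.1 h2) F (f1 true) f3 f2 f2' f4 noReq noReq
        (fun k i h => h.elim) (fun k i h => h.elim)⟩
  · intro s i k h1 h2 h3
    obtain ⟨l, h, a0, al, a1, ho⟩ := s.2.2
    obtain ⟨y, hy⟩ := pull ho k
    have g1 : l ≤ y := not_lt.1 fun h => absurd ((hy lo).2.2 h) (not_lt.2 h1)
    have g2 : y < tcOf τ l h (nf i) := (hy _).2.1 h2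
    have g4 : tcOf τ l h (ff i) ≤ l := not_lt.1 fun h => absurd ((ho lo _).1 h) (not_lt.2 h3)
    obtain ⟨g5, g6⟩ := (lt_clip g1).1 g2
    obtain ⟨q, q1, q2, q3⟩ := (M.lt_FO (a0.trans g1)).1 g6
    simp only [Bool.not_false] at q3
    have g8 : q true < h := by
      by_contra hc
      have := M.le_FV (d := true) q1 (not_lt.1 hc)
      exact absurd ((lt_clip le_rfl).2 ⟨al, q2.trans_le this⟩) (not_lt.2 g4)
    obtain ⟨F, f1, f2, f2', f3, f5, -, f4⟩ := hN (fun _ => tcOf τ l h) (lnOf τ true (q false) l (q false))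
      (lnOf τ false (q false) (q false) h) (q false) (q true) y
    have hq := (M.sup _ _ q1).2.1
    refine ⟨_, _, _, _, kap F y, kap F (q true), fun j => (kap_bound F _).trans_lt f4,
      hy.trans' (kap_rpos (f1 true) y), (kap_even F).2 f5, (kap_lt F (Or.inl f5)).2 q3, (kap_lt F (Or.inl f5)).2 hq,
      (kap_lt F (Or.inr f5)).2 g8,
      tsplit M s a0 a1 ho q2 (hq.trans g8) F (f1 true) f3 f2 f2' f4 noReq _ (fun k i h => h.elim) ?_⟩
    rintro k i ⟨rfl, rfl⟩
    refine ⟨q true, f5, rfl, ?_⟩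
    have := pt_eta M false q
    rw [Bool.not_false] at this
    rw [this]; exact q1
  · intro s i k h1 h2 h3
    obtain ⟨l, h, a0, al, a1, ho⟩ := s.2.2
    obtain ⟨y, hy⟩ := pull ho k
    have g1 : y ≤ h := not_lt.1 fun h => absurd ((hy hi).1.2 h) (not_lt.2 h1)
    have g2 : tcOf τ l h (fp i) < y := (hy _).1.1 h2
    have g4 : h ≤ tcOf τ l h (np i) := not_lt.1 fun h => absurd ((ho _ hi).1 h) (not_lt.2 h3)
    obtain ⟨g5, g6⟩ := (clip_lt g1).1 g2
    obtain ⟨q, q1, q2, q3⟩ := (M.PO_lt (g1.trans a1)).1 g6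
    simp only [Bool.not_true] at q3
    have g8 : l < q false := by
      by_contra hc
      have := M.PV_le (d := false) q1 (not_lt.1 hc)
      exact absurd ((clip_lt le_rfl).2 ⟨al, this.trans_lt q2⟩) (not_lt.2 g4)
    obtain ⟨F, f1, f2, f2', f3, f5, -, f4⟩ := hN (fun _ => tcOf τ l h) (lnOf τ true (q true) l (q true))
      (lnOf τ false (q true) (q true) h) (q true) (q false) y
    have hq := (M.sup _ _ q1).2.1
    refine ⟨_, _, _, _, kap F y, kap F (q false), fun j => (kap_bound F _).trans_lt f4, (kap_bound F _).trans_lt f4,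
      hy.trans' (kap_rpos (f1 true) y), (kap_even F).2 f5, (kap_lt F (Or.inr f5)).2 q3, (kap_lt F (Or.inl f5)).2 g8,
      (kap_lt F (Or.inr f5)).2 hq,
      tsplit M s a0 a1 ho (g8.trans hq) q2 F (f1 true) f3 f2 f2' f4 _ noReq ?_ (fun k i h => h.elim)⟩
    rintro k i ⟨rfl, rfl⟩
    refine ⟨q false, f5, rfl, ?_⟩
    have := pt_eta M true q
    rw [Bool.not_true] at this
    rw [this]; exact q1

theorem broot {i0 : I} {q : Bool → ℝ} (hq : i0 ∈ τ q) : ∃ A ∈ MT τ N, (∀ i, A (ff i) = A lo) ∧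
    (∀ i, A (np i) = A hi) ∧ A lo < A (nf i0) := by
  obtain ⟨F, f1, -, -, -, -, -, f4⟩ := hN (fun _ => tcOf τ 0 1) (fun _ => 0) (fun _ => 0) 0 0 0
  refine ⟨fun j => kap F (tcOf τ 0 1 j), ⟨fun j => ⟨(kap_even F).2 (f1 true j), (kap_bound F _).trans_lt f4⟩, 0, 1, le_rfl,
    zero_lt_one, le_rfl, kap_oeq (f1 true)⟩, fun i => congrArg (kap F) ?_, fun i => congrArg (kap F) ?_,
    (kap_lt F (Or.inl (f1 true _))).2 ?_⟩
  · refine le_antisymm (not_lt.1 fun h => ?_) (le_clip _ _ _)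
    obtain ⟨q, q1, q2, q3⟩ := (M.lt_FV le_rfl).1 ((lt_clip le_rfl).1 h).2
    exact absurd (M.lt1 q1 true) (not_lt.2 q2)
  · refine le_antisymm (clip_le _ zero_le_one) (not_lt.1 fun h => ?_)
    obtain ⟨q, q1, q2, q3⟩ := (M.PV_lt le_rfl).1 ((clip_lt le_rfl).1 h).2
    exact absurd (M.pos q1 false) (not_lt.2 q2)
  · exact (lt_clip le_rfl).2 ⟨zero_lt_one, (M.lt_FO le_rfl).2 ⟨q, hq, M.pos hq _, M.pos hq _⟩⟩
end
end HP

namespace HP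

/-! ### Primitive recursiveness by instance search -/
class PR {α β : Type} [Primcodable α] [Primcodable β] (f : α → β) : Prop where
  h : Primrec f
class PP {α : Type} [Primcodable α] (p : α → Prop) : Prop where
  h : PrimrecPred p

section
variable {α β γ : Type} [Primcodable α] [Primcodable β] [Primcodable γ]

instance : PR (fun x : α => x) := ⟨Primrec.id⟩
instance (c : β) : PR (fun _ : α => c) := ⟨Primrec.const c⟩
instance {f : α → β × γ} [h : PR f] : PR (fun x => (f x).1) := ⟨Primrec.fst.comp h.h⟩
instance {f : α → β × γ} [h : PR f] : PR (fun x => (f x).2) := ⟨Primrec.snd.comp h.h⟩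
instance {f : α → β} {g : α → γ} [hf : PR f] [hg : PR g] : PR (fun x => (f x, g x)) := ⟨hf.h.pair hg.h⟩

variable {a b c : α → ℕ} {p q : α → Prop}
section
variable [ha : PR a] [hb : PR b]
instance : PR (fun x => a x + b x) := ⟨Primrec.nat_add.comp ha.h hb.h⟩
instance : PR (fun x => a x - b x) := ⟨Primrec.nat_sub.comp ha.h hb.h⟩
instance : PR (fun x => a x * b x) := ⟨Primrec.nat_mul.comp ha.h hb.h⟩
instance : PR (fun x => a x / b x) := ⟨Primrec.nat_div.comp ha.h hb.h⟩
instance : PR (fun x => a x % b x) := ⟨Primrec.nat_mod.comp ha.h hb.h⟩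
instance : PR (fun x => min (a x) (b x)) := ⟨Primrec.nat_min.comp ha.h hb.h⟩
instance : PR (fun x => max (a x) (b x)) := ⟨Primrec.nat_max.comp ha.h hb.h⟩
instance : PR (fun x => Nat.pair (a x) (b x)) := ⟨Primrec₂.natPair.comp ha.h hb.h⟩
instance : PP (fun x => a x < b x) := ⟨Primrec.nat_lt.comp ha.h hb.h⟩
instance : PP (fun x => a x ≤ b x) := ⟨Primrec.nat_le.comp ha.h hb.h⟩
instance : PR (fun x => a x ^ b x) := by
  constructor
  have : Primrec₂ fun (n k : ℕ) => (n ^ k : ℕ) := by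
    have h : Primrec₂ fun (n k : ℕ) => (Nat.rec 1 (fun _ ih => ih * n) k : ℕ) :=
      Primrec.nat_rec (f := fun _ => 1) (g := fun n p => p.2 * n) (Primrec.const 1)
        (Primrec.nat_mul.comp (Primrec.snd.comp Primrec.snd) Primrec.fst)
    refine h.of_eq fun n k => ?_
    induction k with
    | zero => rfl
    | succ k ih => simp only [pow_succ] at ih ⊢; rw [← ih]
  exact this.comp ha.h hb.h
end
instance {a b : α → β} [ha : PR a] [hb : PR b] : PP (fun x => a x = b x) := ⟨Primrec.eq.comp ha.h hb.h⟩
instance {a : α → Bool} [ha : PR a] : PR (fun x => !(a x)) := ⟨Primrec.not.comp ha.h⟩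
instance {a b : α → β} [DecidablePred p] [hp : PP p] [ha : PR a] [hb : PR b] :
    PR (fun x => if p x then a x else b x) := ⟨Primrec.ite hp.h ha.h hb.h⟩

instance (c : Prop) : PP (fun _ : α => c) := by
  constructor
  by_cases h : c
  · exact (Primrec.eq.comp (Primrec.const 0) (Primrec.const 0) : PrimrecPred fun _ : α => (0:ℕ) = 0).of_eq (by simp [h])
  · exact (Primrec.eq.comp (Primrec.const 0) (Primrec.const 1) : PrimrecPred fun _ : α => (0:ℕ) = 1).of_eq (by simp [h])
section
variable [hp : PP p] [hq : PP q]
instance : PP (fun x => p x ∧ q x) := ⟨hp.h.and hq.h⟩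
instance : PP (fun x => p x ∨ q x) := ⟨hp.h.or hq.h⟩
instance : PP (fun x => p x → q x) := ⟨(hp.h.not.or hq.h).of_eq fun x => by tauto⟩
instance : PP (fun x => p x ↔ q x) := ⟨((hp.h.not.or hq.h).and (hq.h.not.or hp.h)).of_eq fun x => by tauto⟩
omit hq in
instance : PP (fun x => ¬ p x) := ⟨hp.h.not⟩
end

instance {R : α → ℕ → Prop} [ha : PR a] [hR : PP (fun p : α × ℕ => R p.1 p.2)] : PP (fun x => ∀ y < a x, R x y) := by
  have : PrimrecRel fun (y : ℕ) (x : α) => R x y := hR.h.comp (Primrec.snd.pair Primrec.fst)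
  exact ⟨(this.forall_mem_list.comp (Primrec.list_range.comp ha.h) Primrec.id).of_eq (by simp)⟩
instance {R : α → ℕ → Prop} [ha : PR a] [hR : PP (fun p : α × ℕ => R p.1 p.2)] : PP (fun x => ∃ y < a x, R x y) := by
  have : PrimrecRel fun (y : ℕ) (x : α) => R x y := hR.h.comp (Primrec.snd.pair Primrec.fst)
  exact ⟨(this.exists_mem_list.comp (Primrec.list_range.comp ha.h) Primrec.id).of_eq (by simp)⟩
instance {R : α → Bool → Prop} [h1 : PP (fun p => R p true)] [h2 : PP (fun p => R p false)] :
    PP (fun x => ∀ y, R x y) := ⟨(h1.h.and h2.h).of_eq fun x => by simp [and_comm]⟩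
instance {R : α → Bool → Prop} [h1 : PP (fun p => R p true)] [h2 : PP (fun p => R p false)] :
    PP (fun x => ∃ y, R x y) := ⟨(h1.h.or h2.h).of_eq fun x => by simp [or_comm]⟩

theorem app1 {f : α → β} (h : PR f) {δ : Type} [Primcodable δ] (g : δ → α) [hg : PR g] : PR (fun y => f (g y)) :=
  ⟨h.h.comp hg.h⟩
theorem app {A : α → β → γ} (h : PR (fun p : α × β => A p.1 p.2)) {δ : Type} [Primcodable δ] (f : δ → α) (g : δ → β)
    [hf : PR f] [hg : PR g] : PR (fun y => A (f y) (g y)) := ⟨h.h.comp (hf.h.pair hg.h)⟩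
theorem app2 {ε : Type} [Primcodable ε] {A : α → β → γ → ε} (h : PR (fun p : (α × β) × γ => A p.1.1 p.1.2 p.2)) {δ : Type} [Primcodable δ]
    (f : δ → α) (g : δ → β) (k : δ → γ)
    [hf : PR f] [hg : PR g] [hk : PR k] : PR (fun y => A (f y) (g y) (k y)) := ⟨h.h.comp ((hf.h.pair hg.h).pair hk.h)⟩
theorem appP {A : α → β → Prop} (h : PP (fun p : α × β => A p.1 p.2)) {δ : Type} [Primcodable δ] (f : δ → α) (g : δ → β)
    [hf : PR f] [hg : PR g] : PP (fun y => A (f y) (g y)) := ⟨h.h.comp (hf.h.pair hg.h)⟩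
end

/-! digits -/
def dig (b c k : ℕ) : ℕ := c / b ^ k % b
instance {α : Type} [Primcodable α] {a b c : α → ℕ} [PR a] [PR b] [PR c] : PR (fun x => dig (a x) (b x) (c x)) := by
  unfold dig; infer_instance

def OEqN (w : ℕ) (A B : ℕ → ℕ) : Prop := ∀ x < w, ∀ y < w, A x < A y ↔ B x < B y
instance {α : Type} [Primcodable α] {w : α → ℕ} {A B : α → ℕ → ℕ} [hw : PR w] [hA : PR (fun p : α × ℕ => A p.1 p.2)]
    [hB : PR (fun p : α × ℕ => B p.1 p.2)] : PP (fun x => OEqN (w x) (A x) (B x)) := by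
  have := @app1 _ _ _ _ _ hw; have := @app _ _ _ _ _ _ _ hA; have := @app _ _ _ _ _ _ _ hB
  unfold OEqN
  infer_instance
end HP

namespace HP
open J K

/-! ### Arithmetical twins -/
def TyN (m : ℕ) (F P t : ℕ → Prop) : Prop := ∀ j < m,
  (∀ k < m, Nat.pair 2 (Nat.pair j k) < m → (t (Nat.pair 2 (Nat.pair j k)) ↔ t j ∨ t k)) ∧
  (Nat.pair 1 j < m → (t (Nat.pair 1 j) ↔ ¬ t j)) ∧
  (Nat.pair 3 j < m → (t (Nat.pair 3 j) ↔ t j ∨ F j)) ∧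
  (Nat.pair 4 j < m → (t (Nat.pair 4 j) ↔ t j ∨ P j))

def extS {m : ℕ} (S : Set (Fin m)) (k : ℕ) : Prop := ∃ h : k < m, (⟨k, h⟩ : Fin m) ∈ S
def TyS (m : ℕ) (F P t : Set (Fin m)) : Prop := TyN m (extS F) (extS P) (extS t)

theorem TyN_congr {m : ℕ} {F P t F' P' t' : ℕ → Prop} (h1 : ∀ i < m, F i ↔ F' i) (h2 : ∀ i < m, P i ↔ P' i)
    (h3 : ∀ i < m, t i ↔ t' i) : TyN m F P t ↔ TyN m F' P' t' := by
  unfold TyN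
  refine forall₂_congr fun j hj => and_congr (forall₃_congr fun k hk hp => ?_)
    (and_congr (forall_congr' fun hp => ?_) (and_congr (forall_congr' fun hp => ?_) (forall_congr' fun hp => ?_)))
  · rw [h3 _ hp, h3 _ hj, h3 _ hk]
  · rw [h3 _ hp, h3 _ hj]
  · rw [h3 _ hp, h3 _ hj, h1 _ hj]
  · rw [h3 _ hp, h3 _ hj, h2 _ hj]

theorem TyS_iff {m : ℕ} {F P t : ℕ → Prop} :
    TyS m {i | F i.1} {i | P i.1} {i | t i.1} ↔ TyN m F P t := by
  apply TyN_congr <;> intro i hi <;> exact ⟨fun ⟨_, h⟩ => h, fun h => ⟨hi, h⟩⟩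

def idx {m : ℕ} : J (Fin m) → ℕ
  | .lo => 0 | .hi => 1 | .nf i => 2 + 4 * i.1 | .ff i => 3 + 4 * i.1 | .np i => 4 + 4 * i.1 | .fp i => 5 + 4 * i.1
def kdx {m : ℕ} : K (Fin m) → ℕ
  | .fo i => 4 * i.1 | .fv i => 4 * i.1 + 1 | .pv i => 4 * i.1 + 2 | .po i => 4 * i.1 + 3

theorem idx_lt {m : ℕ} (j : J (Fin m)) : idx j < 2 + 4 * m := by
  cases j <;> simp only [idx] <;> omega
theorem kdx_lt {m : ℕ} (j : K (Fin m)) : kdx j < 4 * m := by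
  cases j <;> simp only [kdx] <;> omega
theorem idx_surj {m k : ℕ} (h : k < 2 + 4 * m) : ∃ j : J (Fin m), idx j = k := by
  by_cases h0 : k = 0
  · exact ⟨lo, h0.symm⟩
  by_cases h1 : k = 1
  · exact ⟨J.hi, h1.symm⟩
  have hi : (k - 2) / 4 < m := by omega
  have : (k-2) % 4 = 0 ∨ (k-2)%4 = 1 ∨ (k-2)%4=2 ∨ (k-2)%4=3 := by omega
  rcases this with h | h | h | h
  · exact ⟨nf ⟨_, hi⟩, by simp only [idx]; omega⟩
  · exact ⟨ff ⟨_, hi⟩, by simp only [idx]; omega⟩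
  · exact ⟨np ⟨_, hi⟩, by simp only [idx]; omega⟩
  · exact ⟨fp ⟨_, hi⟩, by simp only [idx]; omega⟩
theorem kdx_surj {m k : ℕ} (h : k < 4 * m) : ∃ j : K (Fin m), kdx j = k := by
  have hi : k / 4 < m := by omega
  have : k % 4 = 0 ∨ k%4 = 1 ∨ k%4=2 ∨ k%4=3 := by omega
  rcases this with h | h | h | h
  · exact ⟨fo ⟨_, hi⟩, by simp only [kdx]; omega⟩
  · exact ⟨fv ⟨_, hi⟩, by simp only [kdx]; omega⟩
  · exact ⟨pv ⟨_, hi⟩, by simp only [kdx]; omega⟩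
  · exact ⟨po ⟨_, hi⟩, by simp only [kdx]; omega⟩
theorem forall_J {m : ℕ} {P : ℕ → Prop} : (∀ j : J (Fin m), P (idx j)) ↔ ∀ k < 2 + 4 * m, P k :=
  ⟨fun h k hk => by obtain ⟨j, rfl⟩ := idx_surj hk; exact h j, fun h j => h _ (idx_lt j)⟩
theorem forall_K {m : ℕ} {P : ℕ → Prop} : (∀ j : K (Fin m), P (kdx j)) ↔ ∀ k < 4 * m, P k :=
  ⟨fun h k hk => by obtain ⟨j, rfl⟩ := kdx_surj hk; exact h j, fun h j => h _ (kdx_lt j)⟩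
theorem forall_F {m : ℕ} {P : ℕ → Prop} : (∀ i : Fin m, P i.1) ↔ ∀ i < m, P i :=
  ⟨fun h k hk => h ⟨k, hk⟩, fun h i => h _ i.2⟩

theorem dig_lt {b : ℕ} (hb : 0 < b) (c k : ℕ) : dig b c k < b := Nat.mod_lt _ hb

theorem enc_dig {b : ℕ} (w : ℕ) (f : ℕ → ℕ) (hf : ∀ k < w, f k < b) : ∃ c < b ^ w, ∀ k < w, dig b c k = f k := by
  induction w generalizing f with
  | zero => exact ⟨0, by simp, fun k hk => absurd hk (Nat.not_lt_zero k)⟩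
  | succ w ih =>
    obtain ⟨c, hc, h⟩ := ih (fun k => f (k + 1)) (fun k hk => hf _ (by omega))
    have hb : 0 < b := lt_of_le_of_lt (Nat.zero_le _) (hf 0 (by omega))
    refine ⟨f 0 + b * c, ?_, fun k hk => ?_⟩
    · rw [pow_succ]
      have : b * (c + 1) ≤ b * b ^ w := Nat.mul_le_mul_left b hc
      have := hf 0 (by omega)
      rw [mul_comm (b ^ w)]
      rw [mul_add] at *
      omega
    · cases k with
      | zero => simp only [dig, pow_zero, Nat.div_one, Nat.add_mul_mod_self_left]; exact Nat.mod_eq_of_lt (hf 0 (by omega))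
      | succ k =>
        rw [← h k (by omega), dig, dig, pow_succ, mul_comm (b ^ k), ← Nat.div_div_eq_div_mul,
          Nat.add_mul_div_left _ _ hb, Nat.div_eq_of_lt (hf 0 (by omega)), zero_add]

theorem exists_set {m : ℕ} {P : Set (Fin m) → Prop} : (∃ t, P t) ↔ ∃ u < 2 ^ m, P {i | dig 2 u i.1 = 1} := by
  classical
  constructor
  · rintro ⟨t, ht⟩
    obtain ⟨u, h1, h2⟩ := enc_dig (b := 2) m (fun k => if h : k < m then (if (⟨k, h⟩ : Fin m) ∈ t then 1 else 0) else 0)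
      (fun k hk => by simp only [hk, dite_true]; split_ifs <;> omega)
    refine ⟨u, h1, ?_⟩
    have : {i : Fin m | dig 2 u i.1 = 1} = t := by
      ext i
      rw [Set.mem_ofPred_eq, h2 i.1 i.2]
      simp
    rwa [this]
  · rintro ⟨u, -, h⟩; exact ⟨_, h⟩

def LegN (m : ℕ) (L : ℕ → ℕ) (k u : ℕ) : Prop :=
  TyN m (fun i => k < L (4 * i)) (fun i => L (4 * i + 3) < k) (fun i => dig 2 u i = 1) ∧
    ∀ i < m, dig 2 u i = 1 → L (4 * i + 2) ≤ k ∧ k ≤ L (4 * i + 1)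
def NFN (m : ℕ) (exF : ℕ → Prop) (L : ℕ → ℕ) (i : ℕ) : Prop :=
  L (4 * i) < L (4 * i + 1) ∧ ¬ exF i ∧ ¬ ∃ u < 2 ^ m, LegN m L (L (4 * i + 1) - 1) u ∧ dig 2 u i = 1
def NPN (m : ℕ) (exP : ℕ → Prop) (L : ℕ → ℕ) (i : ℕ) : Prop :=
  L (4 * i + 2) < L (4 * i + 3) ∧ ¬ exP i ∧ ¬ ∃ u < 2 ^ m, LegN m L (L (4 * i + 2) + 1) u ∧ dig 2 u i = 1
def LineOKN (m l h : ℕ) (exF exP : ℕ → Prop) (L : ℕ → ℕ) (k0 i0 : ℕ) : Prop :=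
  (∀ k < 4 * m, L k % 2 = 0) ∧ (∀ i < m, L (4 * i) ≤ L (4 * i + 1)) ∧ (∀ i < m, L (4 * i + 2) ≤ L (4 * i + 3)) ∧
  (∀ k < 4 * m, l ≤ L k) ∧ (∀ k < 4 * m, L k ≤ h) ∧
  (∀ k < h, l < k → ∃ u < 2 ^ m, LegN m L k u ∧ (∀ i < m, NFN m exF L i → L (4 * i + 1) = k → dig 2 u i = 1) ∧
    (∀ i < m, NPN m exP L i → L (4 * i + 2) = k → dig 2 u i = 1) ∧ ∀ i < m, k = k0 ∧ i = i0 → dig 2 u i = 1) ∧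
  (∀ i < m, NFN m exF L i → L (4 * i + 1) ≠ h) ∧ (∀ i < m, NPN m exP L i → L (4 * i + 2) ≠ l)

section
variable {m : ℕ}
theorem leg_iff {L : ℕ → ℕ} {k u : ℕ} :
    Leg (TyS m) (fun j => L (kdx j)) k {i | dig 2 u i.1 = 1} ↔ LegN m L k u := by
  unfold Leg LegN
  refine and_congr (TyS_iff (F := fun i => k < L (4 * i)) (P := fun i => L (4 * i + 3) < k) (t := fun i => dig 2 u i = 1)) ?_
  exact forall_F (P := fun i => dig 2 u i = 1 → L (4 * i + 2) ≤ k ∧ k ≤ L (4 * i + 1))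
theorem nf_iff {exF : ℕ → Prop} {L : ℕ → ℕ} (i : Fin m) :
    NF (TyS m) (fun i => exF i.1) (fun j => L (kdx j)) i ↔ NFN m exF L i.1 := by
  unfold NF NFN
  rw [exists_set]; simp only [leg_iff]; rfl
theorem np_iff {exF : ℕ → Prop} {L : ℕ → ℕ} (i : Fin m) :
    NP (TyS m) (fun i => exF i.1) (fun j => L (kdx j)) i ↔ NPN m exF L i.1 := by
  unfold NP NPN
  rw [exists_set]; simp only [leg_iff]; rfl
theorem line_iff {l h : ℕ} {exF exP : ℕ → Prop} {L : ℕ → ℕ} {k0 i0 : ℕ} :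
    LineOK (TyS m) l h (fun i => exF i.1) (fun i => exP i.1) (fun j => L (kdx j)) (fun k i => k = k0 ∧ i.1 = i0) ↔
      LineOKN m l h exF exP L k0 i0 := by
  constructor
  · rintro ⟨h1, h2, h3, h4, h5, h6, h7, h8⟩
    refine ⟨forall_K.1 fun k => Nat.even_iff.1 (h1 k), fun i hi => h2 ⟨i, hi⟩, fun i hi => h3 ⟨i, hi⟩, forall_K.1 h4,
      forall_K.1 h5, fun k a1 a2 => ?_, fun i hi hn => h7 ⟨i, hi⟩ ((nf_iff ⟨i, hi⟩).2 hn),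
      fun i hi hn => h8 ⟨i, hi⟩ ((np_iff ⟨i, hi⟩).2 hn)⟩
    have := h6 k a2 a1
    rw [exists_set] at this
    obtain ⟨u, hu, b1, b2, b3, b4⟩ := this
    exact ⟨u, hu, leg_iff.1 b1, fun i hi hn => b2 ⟨i, hi⟩ ((nf_iff ⟨i, hi⟩).2 hn),
      fun i hi hn => b3 ⟨i, hi⟩ ((np_iff ⟨i, hi⟩).2 hn), fun i hi => b4 ⟨i, hi⟩⟩
  · rintro ⟨h1, h2, h3, h4, h5, h6, h7, h8⟩
    refine ⟨fun k => Nat.even_iff.2 (h1 _ (kdx_lt k)), fun i => h2 _ i.2, fun i => h3 _ i.2, fun k => h4 _ (kdx_lt k),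
      fun k => h5 _ (kdx_lt k), fun k a1 a2 => ?_, fun i hi => h7 i i.2 ((nf_iff i).1 hi),
      fun i hi => h8 i i.2 ((np_iff i).1 hi)⟩
    obtain ⟨u, hu, b1, b2, b3, b4⟩ := h6 k a2 a1
    exact ⟨_, leg_iff.2 b1, fun i hi => b2 i i.2 ((nf_iff i).1 hi), fun i hi => b3 i i.2 ((np_iff i).1 hi), fun i => b4 i i.2⟩
end

def SameKN (m : ℕ) (C C' : Bool → ℕ → ℕ) : Prop := ∀ i < m,
  ((∀ a, C a 0 < C a (2 + 4 * i)) ↔ ∀ a, C' a 0 < C' a (2 + 4 * i)) ∧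
  ((∃ a, C a 1 ≤ C a (3 + 4 * i)) ↔ ∃ a, C' a 1 ≤ C' a (3 + 4 * i)) ∧
  ((∃ a, C a (4 + 4 * i) ≤ C a 0) ↔ ∃ a, C' a (4 + 4 * i) ≤ C' a 0) ∧
  ((∀ a, C a (5 + 4 * i) < C a 1) ↔ ∀ a, C' a (5 + 4 * i) < C' a 1)
def FilledN (m : ℕ) (C : Bool → ℕ → ℕ) : Prop := ∃ u < 2 ^ m,
  TyN m (fun i => ∃ a, C a 1 ≤ C a (3 + 4 * i)) (fun i => ∃ a, C a (4 + 4 * i) ≤ C a 0) (fun i => dig 2 u i = 1) ∧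
  (∀ i < m, dig 2 u i = 1 → ∀ a, C a 0 < C a (2 + 4 * i)) ∧ (∀ i < m, dig 2 u i = 1 → ∀ a, C a (5 + 4 * i) < C a 1)
def CstN (m : ℕ) (C : Bool → ℕ → ℕ) : Prop :=
  (∀ a, C a 0 < C a 1) ∧ (∀ a, ∀ j < 2 + 4 * m, C a 0 ≤ C a j) ∧ (∀ a, ∀ j < 2 + 4 * m, C a j ≤ C a 1) ∧
  (∀ a, ∀ i < m, C a (3 + 4 * i) ≤ C a (2 + 4 * i)) ∧ (∀ a, ∀ i < m, C a (5 + 4 * i) ≤ C a (4 + 4 * i)) ∧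
  (∀ a, ∀ i < m, C a 0 < C a (3 + 4 * i) → C (!a) (2 + 4 * i) = C (!a) 1) ∧
  (∀ a, ∀ i < m, C a (4 + 4 * i) < C a 1 → C (!a) (5 + 4 * i) = C (!a) 0) ∧
  (∀ a, ∀ i < m, C a 0 < C a (2 + 4 * i) → C (!a) 0 < C (!a) (2 + 4 * i)) ∧
  (∀ a, ∀ i < m, C a (5 + 4 * i) < C a 1 → C (!a) (5 + 4 * i) < C (!a) 1)
def TCstN (m : ℕ) (A : ℕ → ℕ) : Prop :=
  A 0 < A 1 ∧ (∀ j < 2 + 4 * m, A 0 ≤ A j) ∧ (∀ j < 2 + 4 * m, A j ≤ A 1) ∧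
  (∀ i < m, A 0 < A (3 + 4 * i) → A (2 + 4 * i) = A 1) ∧ (∀ i < m, A (4 + 4 * i) < A 1 → A (5 + 4 * i) = A 0)
def RPosN (w : ℕ) (A : ℕ → ℕ) (x : ℕ) (B : ℕ → ℕ) (y : ℕ) : Prop := ∀ j < w, (A j < x ↔ B j < y) ∧ (x < A j ↔ y < B j)

section
variable {m : ℕ}
theorem oeq_iff {A B : ℕ → ℕ} : OEq (fun j : J (Fin m) => A (idx j)) (fun j => B (idx j)) ↔ OEqN (2 + 4 * m) A B := by
  unfold OEq OEqN; simp only [← forall_J]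
theorem rpos_iff {A B : ℕ → ℕ} {x y : ℕ} :
    RPos (fun j : J (Fin m) => A (idx j)) x (fun j => B (idx j)) y ↔ RPosN (2 + 4 * m) A x B y := by
  unfold RPos RPosN; simp only [← forall_J]
theorem sameK_iff {C C' : Bool → ℕ → ℕ} : SameK (fun a (j : J (Fin m)) => C a (idx j)) (fun a j => C' a (idx j)) ↔
    SameKN m C C' := by
  unfold SameKN
  simp only [← forall_F]
  constructor
  · rintro ⟨h1, h2, h3, h4⟩ i
    exact ⟨Set.ext_iff.1 h1 i, Set.ext_iff.1 h2 i, Set.ext_iff.1 h3 i, Set.ext_iff.1 h4 i⟩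
  · intro h
    exact ⟨Set.ext fun i => (h i).1, Set.ext fun i => (h i).2.1, Set.ext fun i => (h i).2.2.1, Set.ext fun i => (h i).2.2.2⟩
theorem filled_iff {C : Bool → ℕ → ℕ} : Filled (TyS m) (fun a (j : J (Fin m)) => C a (idx j)) ↔ FilledN m C := by
  unfold Filled FilledN
  rw [exists_set]
  refine exists_congr fun u => and_congr Iff.rfl (and_congr (TyS_iff (F := fun i => ∃ a, C a 1 ≤ C a (3 + 4 * i))
    (P := fun i => ∃ a, C a (4 + 4 * i) ≤ C a 0) (t := fun i => dig 2 u i = 1)) ?_)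
  exact ⟨fun ⟨h1, h2⟩ => ⟨fun i hi hu => h1 (a := ⟨i, hi⟩) hu, fun i hi hu => h2 (a := ⟨i, hi⟩) hu⟩,
    fun ⟨h1, h2⟩ => ⟨fun i => h1 i i.2, fun i => h2 i i.2⟩⟩
theorem cst_iff {C : Bool → ℕ → ℕ} : Cst (fun a (j : J (Fin m)) => C a (idx j)) ↔ CstN m C := by
  constructor
  · rintro ⟨h1, h2, h3, h4, h5, h6, h7, h8, h9⟩
    exact ⟨h1, fun a => forall_J.1 (h2 a), fun a => forall_J.1 (h3 a), fun a i hi => h4 a ⟨i, hi⟩, fun a i hi => h5 a ⟨i, hi⟩,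
      fun a i hi => h6 a ⟨i, hi⟩, fun a i hi => h7 a ⟨i, hi⟩, fun a i hi => h8 a ⟨i, hi⟩, fun a i hi => h9 a ⟨i, hi⟩⟩
  · rintro ⟨h1, h2, h3, h4, h5, h6, h7, h8, h9⟩
    exact ⟨h1, fun a j => h2 a _ (idx_lt j), fun a j => h3 a _ (idx_lt j), fun a i => h4 a i i.2, fun a i => h5 a i i.2,
      fun a i => h6 a i i.2, fun a i => h7 a i i.2, fun a i => h8 a i i.2, fun a i => h9 a i i.2⟩
theorem tcst_iff {A : ℕ → ℕ} : TCst (fun (j : J (Fin m)) => A (idx j)) ↔ TCstN m A := by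
  constructor
  · rintro ⟨h1, h2, h3, h4, h5⟩
    exact ⟨h1, forall_J.1 h2, forall_J.1 h3, fun i hi => h4 ⟨i, hi⟩, fun i hi => h5 ⟨i, hi⟩⟩
  · rintro ⟨h1, h2, h3, h4, h5⟩
    exact ⟨h1, fun j => h2 _ (idx_lt j), fun j => h3 _ (idx_lt j), fun i => h4 i i.2, fun i => h5 i i.2⟩
end
end HP

namespace HP
open J K
set_option synthInstance.maxSize 100000
set_option synthInstance.maxHeartbeats 400000

/-! ### Primitive recursiveness of the twins -/
section
variable {α : Type} [Primcodable α] {m k u z l h k0 i0 : α → ℕ} {F P t : α → ℕ → Prop} {L L' A B : α → ℕ → ℕ}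
  {C C' : α → Bool → ℕ → ℕ} {d : α → Bool}

instance [hm : PR m] [hF : PP (fun p : α × ℕ => F p.1 p.2)] [hP : PP (fun p : α × ℕ => P p.1 p.2)]
    [ht : PP (fun p : α × ℕ => t p.1 p.2)] : PP (fun x => TyN (m x) (F x) (P x) (t x)) := by
  have := @app1 _ _ _ _ _ hm; have := @appP _ _ _ _ _ hF; have := @appP _ _ _ _ _ hP; have := @appP _ _ _ _ _ ht
  unfold TyN
  infer_instance
instance [hm : PR m] [hL : PR (fun p : α × ℕ => L p.1 p.2)] [hk : PR k] [hu : PR u] :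
    PP (fun x => LegN (m x) (L x) (k x) (u x)) := by
  have := @app1 _ _ _ _ _ hm; have := @app _ _ _ _ _ _ _ hL; have := @app1 _ _ _ _ _ hk; have := @app1 _ _ _ _ _ hu
  unfold LegN
  infer_instance
instance [hm : PR m] [hF : PP (fun p : α × ℕ => F p.1 p.2)] [hL : PR (fun p : α × ℕ => L p.1 p.2)] [hk : PR k] :
    PP (fun x => NFN (m x) (F x) (L x) (k x)) := by
  have := @app1 _ _ _ _ _ hm; have := @app _ _ _ _ _ _ _ hL; have := @app1 _ _ _ _ _ hk; have := @appP _ _ _ _ _ hF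
  unfold NFN
  infer_instance
instance [hm : PR m] [hF : PP (fun p : α × ℕ => F p.1 p.2)] [hL : PR (fun p : α × ℕ => L p.1 p.2)] [hk : PR k] :
    PP (fun x => NPN (m x) (F x) (L x) (k x)) := by
  have := @app1 _ _ _ _ _ hm; have := @app _ _ _ _ _ _ _ hL; have := @app1 _ _ _ _ _ hk; have := @appP _ _ _ _ _ hF
  unfold NPN
  infer_instance
instance [hm : PR m] [hl : PR l] [hh : PR h] [hF : PP (fun p : α × ℕ => F p.1 p.2)] [hP : PP (fun p : α × ℕ => P p.1 p.2)]
    [hL : PR (fun p : α × ℕ => L p.1 p.2)] [hk : PR k0] [hi : PR i0] :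
    PP (fun x => LineOKN (m x) (l x) (h x) (F x) (P x) (L x) (k0 x) (i0 x)) := by
  have := @app1 _ _ _ _ _ hm; have := @app _ _ _ _ _ _ _ hL; have := @app1 _ _ _ _ _ hk; have := @appP _ _ _ _ _ hF
  have := @appP _ _ _ _ _ hP; have := @app1 _ _ _ _ _ hi; have := @app1 _ _ _ _ _ hl; have := @app1 _ _ _ _ _ hh
  unfold LineOKN
  infer_instance
instance [hm : PR m] [hC : PR (fun p : (α × Bool) × ℕ => C p.1.1 p.1.2 p.2)]
    [hC' : PR (fun p : (α × Bool) × ℕ => C' p.1.1 p.1.2 p.2)] : PP (fun x => SameKN (m x) (C x) (C' x)) := by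
  have := @app1 _ _ _ _ _ hm; have := @app2 _ _ _ _ _ _ _ _ _ hC; have := @app2 _ _ _ _ _ _ _ _ _ hC'
  unfold SameKN
  infer_instance
instance [hm : PR m] [hC : PR (fun p : (α × Bool) × ℕ => C p.1.1 p.1.2 p.2)] : PP (fun x => FilledN (m x) (C x)) := by
  have := @app1 _ _ _ _ _ hm; have := @app2 _ _ _ _ _ _ _ _ _ hC
  unfold FilledN
  infer_instance
instance [hm : PR m] [hC : PR (fun p : (α × Bool) × ℕ => C p.1.1 p.1.2 p.2)] : PP (fun x => CstN (m x) (C x)) := by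
  have := @app1 _ _ _ _ _ hm; have := @app2 _ _ _ _ _ _ _ _ _ hC
  unfold CstN
  infer_instance
instance [hm : PR m] [hA : PR (fun p : α × ℕ => A p.1 p.2)] : PP (fun x => TCstN (m x) (A x)) := by
  have := @app1 _ _ _ _ _ hm; have := @app _ _ _ _ _ _ _ hA
  unfold TCstN
  infer_instance
instance [hm : PR m] [hA : PR (fun p : α × ℕ => A p.1 p.2)] [hk : PR k] [hB : PR (fun p : α × ℕ => B p.1 p.2)] [hz : PR z] :
    PP (fun x => RPosN (m x) (A x) (k x) (B x) (z x)) := by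
  have := @app1 _ _ _ _ _ hm; have := @app _ _ _ _ _ _ _ hA; have := @app1 _ _ _ _ _ hk
  have := @app1 _ _ _ _ _ hz; have := @app _ _ _ _ _ _ _ hB
  unfold RPosN
  infer_instance
end

def setFarN (A L : ℕ → ℕ) (k : ℕ) : ℕ := if 2 ≤ k ∧ k % 2 = 1 then L (k - 2) else A k
def setNearN (A L : ℕ → ℕ) (k : ℕ) : ℕ := if 2 ≤ k ∧ k % 2 = 0 then L (k - 2) else A k
def ch1N (C : Bool → ℕ → ℕ) (d : Bool) (z : ℕ) (L : ℕ → ℕ) (a : Bool) (k : ℕ) : ℕ :=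
  if a = d then min (C a k) z else setFarN (C a) L k
def ch2N (C : Bool → ℕ → ℕ) (d : Bool) (z : ℕ) (L : ℕ → ℕ) (a : Bool) (k : ℕ) : ℕ :=
  if a = d then max (C a k) z else setNearN (C a) L k
def tri1N (A : ℕ → ℕ) (z : ℕ) (Lh : ℕ → ℕ) : ℕ → ℕ := setFarN (fun j => min (A j) z) Lh
def tri2N (A : ℕ → ℕ) (z : ℕ) (Lv : ℕ → ℕ) : ℕ → ℕ := setNearN (fun j => max (A j) z) Lv
def triRN (A : ℕ → ℕ) (z : ℕ) (Lh Lv : ℕ → ℕ) (a : Bool) (k : ℕ) : ℕ :=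
  if a = true then setFarN (fun j => max (A j) z) Lv k else setNearN (fun j => min (A j) z) Lh k

section
variable {m : ℕ} 
theorem setFarN_eq (A L : ℕ → ℕ) (j : J (Fin m)) :
    setFar (fun j => A (idx j)) (fun k => L (kdx k)) j = setFarN A L (idx j) := by
  cases j <;> simp only [setFar, idx, kdx] <;> unfold setFarN
  all_goals first | (rw [if_neg (by omega)]) | (rw [if_pos (by omega)]; congr 1; omega)
theorem setNearN_eq (A L : ℕ → ℕ) (j : J (Fin m)) :
    setNear (fun j => A (idx j)) (fun k => L (kdx k)) j = setNearN A L (idx j) := by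
  cases j <;> simp only [setNear, idx, kdx] <;> unfold setNearN
  all_goals first | (rw [if_neg (by omega)]) | (rw [if_pos (by omega)]; congr 1; omega)
theorem ch1N_eq (C d z) (L : ℕ → ℕ) (a) (j : J (Fin m)) :
    ch1 (fun a j => C a (idx j)) d z (fun k => L (kdx k)) a j = ch1N C d z L a (idx j) := by
  unfold ch1 ch1N; rw [setFarN_eq]
theorem ch2N_eq (C d z) (L : ℕ → ℕ) (a) (j : J (Fin m)) :
    ch2 (fun a j => C a (idx j)) d z (fun k => L (kdx k)) a j = ch2N C d z L a (idx j) := by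
  unfold ch2 ch2N; rw [setNearN_eq]
theorem tri1N_eq (A z) (L : ℕ → ℕ) (j : J (Fin m)) :
    tri1 (fun j => A (idx j)) z (fun k => L (kdx k)) j = tri1N A z L (idx j) :=
  setFarN_eq (fun j => min (A j) z) L j
theorem tri2N_eq (A z) (L : ℕ → ℕ) (j : J (Fin m)) :
    tri2 (fun j => A (idx j)) z (fun k => L (kdx k)) j = tri2N A z L (idx j) :=
  setNearN_eq (fun j => max (A j) z) L j
theorem triRN_eq (A z) (L L' : ℕ → ℕ) (a) (j : J (Fin m)) :
    triR (fun j => A (idx j)) z (fun k => L (kdx k)) (fun k => L' (kdx k)) a j = triRN A z L L' a (idx j) := by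
  cases a
  · exact setNearN_eq (fun j => min (A j) z) L j
  · exact setFarN_eq (fun j => max (A j) z) L' j
end

section
variable {α : Type} [Primcodable α] {k z : α → ℕ} {L L' A : α → ℕ → ℕ} {C : α → Bool → ℕ → ℕ} {d a : α → Bool}
instance [hA : PR (fun p : α × ℕ => A p.1 p.2)] [hL : PR (fun p : α × ℕ => L p.1 p.2)] [hk : PR k] :
    PR (fun x => setFarN (A x) (L x) (k x)) := by
  have := @app _ _ _ _ _ _ _ hL; have := @app1 _ _ _ _ _ hk; have := @app _ _ _ _ _ _ _ hA
  unfold setFarN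
  infer_instance
instance [hA : PR (fun p : α × ℕ => A p.1 p.2)] [hL : PR (fun p : α × ℕ => L p.1 p.2)] [hk : PR k] :
    PR (fun x => setNearN (A x) (L x) (k x)) := by
  have := @app _ _ _ _ _ _ _ hL; have := @app1 _ _ _ _ _ hk; have := @app _ _ _ _ _ _ _ hA
  unfold setNearN
  infer_instance
instance [hC : PR (fun p : (α × Bool) × ℕ => C p.1.1 p.1.2 p.2)] [hd : PR d] [hz : PR z]
    [hL : PR (fun p : α × ℕ => L p.1 p.2)] [ha : PR a] [hk : PR k] : PR (fun x => ch1N (C x) (d x) (z x) (L x) (a x) (k x)) := by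
  have := @app _ _ _ _ _ _ _ hL; have := @app1 _ _ _ _ _ hk; have := @app2 _ _ _ _ _ _ _ _ _ hC
  have := @app1 _ _ _ _ _ hz; have := @app1 _ _ _ _ _ ha; have := @app1 _ _ _ _ _ hd
  unfold ch1N
  infer_instance
instance [hC : PR (fun p : (α × Bool) × ℕ => C p.1.1 p.1.2 p.2)] [hd : PR d] [hz : PR z]
    [hL : PR (fun p : α × ℕ => L p.1 p.2)] [ha : PR a] [hk : PR k] : PR (fun x => ch2N (C x) (d x) (z x) (L x) (a x) (k x)) := by
  have := @app _ _ _ _ _ _ _ hL; have := @app1 _ _ _ _ _ hk; have := @app2 _ _ _ _ _ _ _ _ _ hC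
  have := @app1 _ _ _ _ _ hz; have := @app1 _ _ _ _ _ ha; have := @app1 _ _ _ _ _ hd
  unfold ch2N
  infer_instance
instance [hA : PR (fun p : α × ℕ => A p.1 p.2)] [hz : PR z] [hL : PR (fun p : α × ℕ => L p.1 p.2)] [hk : PR k] :
    PR (fun x => tri1N (A x) (z x) (L x) (k x)) := by
  have := @app _ _ _ _ _ _ _ hL; have := @app1 _ _ _ _ _ hk; have := @app _ _ _ _ _ _ _ hA; have := @app1 _ _ _ _ _ hz
  unfold tri1N
  infer_instance
instance [hA : PR (fun p : α × ℕ => A p.1 p.2)] [hz : PR z] [hL : PR (fun p : α × ℕ => L p.1 p.2)] [hk : PR k] :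
    PR (fun x => tri2N (A x) (z x) (L x) (k x)) := by
  have := @app _ _ _ _ _ _ _ hL; have := @app1 _ _ _ _ _ hk; have := @app _ _ _ _ _ _ _ hA; have := @app1 _ _ _ _ _ hz
  unfold tri2N
  infer_instance
instance [hA : PR (fun p : α × ℕ => A p.1 p.2)] [hz : PR z] [hL : PR (fun p : α × ℕ => L p.1 p.2)]
    [hL' : PR (fun p : α × ℕ => L' p.1 p.2)] [ha : PR a] [hk : PR k] :
    PR (fun x => triRN (A x) (z x) (L x) (L' x) (a x) (k x)) := by
  have := @app _ _ _ _ _ _ _ hL; have := @app1 _ _ _ _ _ hk; have := @app _ _ _ _ _ _ _ hA; have := @app1 _ _ _ _ _ hz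
  have := @app _ _ _ _ _ _ _ hL'; have := @app1 _ _ _ _ _ ha
  unfold triRN
  infer_instance
end
end HP

namespace HP
open J K
set_option synthInstance.maxSize 100000
set_option synthInstance.maxHeartbeats 400000

def cell (m b c : ℕ) (d : Bool) (k : ℕ) : ℕ := dig b c ((if d = true then 2 + 4 * m else 0) + k)
def flag (m b c : ℕ) (a s : Bool) : Prop :=
  dig b c (2 * (2 + 4 * m) + ((if a = true then 2 else 0) + (if s = true then 1 else 0))) ≠ 0
def Wd (m b : ℕ) : ℕ := b ^ (2 * (2 + 4 * m) + 4)
def rkN (m b r s : ℕ) : ℕ := dig (Wd m b + 2) r s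

def EvolvesN (m b r s s1 : ℕ) (d side : Bool) (strict : Prop) : Prop :=
  SameKN m (cell m b s) (cell m b s1) →
    (∀ a e : Bool, flag m b s1 a e → flag m b s a e ∧ ¬ (a = d ∧ e = side)) ∧
    ((∀ a e : Bool, ¬ flag m b s a e) → ¬ FilledN m (cell m b s) → rkN m b r s1 ≤ rkN m b r s ∧
      (strict → rkN m b r s1 < rkN m b r s))

def SplitN (m b r s : ℕ) (d : Bool) (c z l k0 i0 : ℕ) (strict : Prop) : Prop :=
  (∀ a : Bool, OEqN (2 + 4 * m) (cell m b s a) (cell m b c a)) ∧ (∀ a : Bool, ∀ k < 2 + 4 * m, cell m b c a k % 2 = 0) ∧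
  cell m b c d 0 < z ∧ z < cell m b c d 1 ∧
  LineOKN m (cell m b c (!d) 0) (cell m b c (!d) 1) (fun i => z ≤ cell m b c d (3 + 4 * i))
    (fun i => cell m b c d (4 + 4 * i) ≤ z) (dig b l) k0 i0 ∧
  ∃ s1 < Wd m b, ∃ s2 < Wd m b, rkN m b r s1 ≠ 0 ∧ rkN m b r s2 ≠ 0 ∧
    (∀ a : Bool, ∀ k < 2 + 4 * m, cell m b s1 a k = ch1N (cell m b c) d z (dig b l) a k) ∧ EvolvesN m b r s s1 d true strict ∧
    (∀ a : Bool, ∀ k < 2 + 4 * m, cell m b s2 a k = ch2N (cell m b c) d z (dig b l) a k) ∧ EvolvesN m b r s s2 d false strict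

def TSplitN (m b r t θ c z l l' k1 i1 k2 i2 : ℕ) : Prop :=
  OEqN (2 + 4 * m) (dig b θ) (dig b c) ∧ (∀ k < 2 + 4 * m, dig b c k % 2 = 0) ∧ z % 2 = 0 ∧ dig b c 0 < z ∧ z < dig b c 1 ∧
  LineOKN m (dig b c 0) z (fun _ => False) (fun i => dig b c (4 + 4 * i) ≤ z) (dig b l) k1 i1 ∧
  LineOKN m z (dig b c 1) (fun i => z ≤ dig b c (3 + 4 * i)) (fun _ => False) (dig b l') k2 i2 ∧
  ∃ θ1 < b ^ (2 + 4 * m), ∃ θ2 < b ^ (2 + 4 * m), ∃ s < Wd m b, dig 2 t θ1 = 1 ∧ dig 2 t θ2 = 1 ∧ rkN m b r s ≠ 0 ∧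
    (∀ k < 2 + 4 * m, dig b θ1 k = tri1N (dig b c) z (dig b l) k) ∧
    (∀ k < 2 + 4 * m, dig b θ2 k = tri2N (dig b c) z (dig b l') k) ∧
    (∀ a : Bool, ∀ k < 2 + 4 * m, cell m b s a k = triRN (dig b c) z (dig b l) (dig b l') a k)

def RvN (m b r s : ℕ) (d : Bool) (k : ℕ) : Prop := ∃ c < Wd m b, ∃ z < b, ∃ l < b ^ (4 * m),
    RPosN (2 + 4 * m) (cell m b s d) k (cell m b c d) z ∧ SplitN m b r s d c z l 0 m False
def RcfI (m b r s : ℕ) (e : Bool) (i k c z l : ℕ) : Prop :=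
  ∃ k' < b, ∃ k0 < b,
      RPosN (2 + 4 * m) (cell m b s e) k (cell m b c e) k' ∧ k0 % 2 = 0 ∧ k' < k0 ∧ k0 < cell m b c e 1 ∧
      SplitN m b r s (!e) c z l k0 i False
def RcfN (m b r s : ℕ) (e : Bool) (i k : ℕ) : Prop := ∃ c < Wd m b, ∃ z < b, ∃ l < b ^ (4 * m), RcfI m b r s e i k c z l
def RcpI (m b r s : ℕ) (e : Bool) (i k c z l : ℕ) : Prop :=
  ∃ k' < b, ∃ k0 < b,
      RPosN (2 + 4 * m) (cell m b s e) k (cell m b c e) k' ∧ k0 % 2 = 0 ∧ k0 < k' ∧ cell m b c e 0 < k0 ∧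
      SplitN m b r s (!e) c z l k0 i False
def RcpN (m b r s : ℕ) (e : Bool) (i k : ℕ) : Prop := ∃ c < Wd m b, ∃ z < b, ∃ l < b ^ (4 * m), RcpI m b r s e i k c z l
def RrN (m b r s : ℕ) (d : Bool) : Prop := ∃ c < Wd m b, ∃ z < b, ∃ l < b ^ (4 * m), SplitN m b r s d c z l 0 m True
def TvN (m b r t s k : ℕ) : Prop := ∃ c < b ^ (2 + 4 * m), ∃ z < b, ∃ l < b ^ (4 * m), ∃ l' < b ^ (4 * m),
    RPosN (2 + 4 * m) (dig b s) k (dig b c) z ∧ TSplitN m b r t s c z l l' 0 m 0 m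
def TcfI (m b r t s i k c z l l' : ℕ) : Prop :=
  ∃ k' < b, ∃ k0 < b,
      RPosN (2 + 4 * m) (dig b s) k (dig b c) k' ∧ k0 % 2 = 0 ∧ k' < k0 ∧ z < k0 ∧ k0 < dig b c 1 ∧
      TSplitN m b r t s c z l l' 0 m k0 i
def TcfN (m b r t s i k : ℕ) : Prop :=
    ∃ c < b ^ (2 + 4 * m), ∃ z < b, ∃ l < b ^ (4 * m), ∃ l' < b ^ (4 * m), TcfI m b r t s i k c z l l'
def TcpI (m b r t s i k c z l l' : ℕ) : Prop :=
  ∃ k' < b, ∃ k0 < b,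
      RPosN (2 + 4 * m) (dig b s) k (dig b c) k' ∧ k0 % 2 = 0 ∧ k0 < k' ∧ dig b c 0 < k0 ∧ k0 < z ∧
      TSplitN m b r t s c z l l' k0 i 0 m

def TcpN (m b r t s i k : ℕ) : Prop :=
    ∃ c < b ^ (2 + 4 * m), ∃ z < b, ∃ l < b ^ (4 * m), ∃ l' < b ^ (4 * m), TcpI m b r t s i k c z l l'
def ChkR (m b r s : ℕ) : Prop :=
  (∀ a : Bool, ∀ k < 2 + 4 * m, cell m b s a k % 2 = 0) ∧ CstN m (cell m b s) ∧
  (∀ d : Bool, ∀ k < b, cell m b s d 0 < k → k < cell m b s d 1 → RvN m b r s d k) ∧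
  (∀ e : Bool, ∀ i < m, ∀ k < b, cell m b s e 0 ≤ k → k < cell m b s e (2 + 4 * i) → cell m b s e (3 + 4 * i) ≤ k →
    cell m b s (!e) (3 + 4 * i) ≤ cell m b s (!e) 0 → RcfN m b r s e i k) ∧
  (∀ e : Bool, ∀ i < m, ∀ k < b, k ≤ cell m b s e 1 → cell m b s e (5 + 4 * i) < k → k ≤ cell m b s e (4 + 4 * i) →
    cell m b s (!e) 1 ≤ cell m b s (!e) (4 + 4 * i) → RcpN m b r s e i k) ∧
  (¬ FilledN m (cell m b s) → (∀ a e : Bool, ¬ flag m b s a e) → ∃ d : Bool, RrN m b r s d)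

def ChkT (m b r t s : ℕ) : Prop :=
  (∀ k < 2 + 4 * m, dig b s k % 2 = 0) ∧ TCstN m (dig b s) ∧
  (∀ k < b, dig b s 0 < k → k < dig b s 1 → TvN m b r t s k) ∧
  (∀ i < m, ∀ k < b, dig b s 0 ≤ k → k < dig b s (2 + 4 * i) → dig b s (3 + 4 * i) ≤ dig b s 0 → TcfN m b r t s i k) ∧
  (∀ i < m, ∀ k < b, k ≤ dig b s 1 → dig b s (5 + 4 * i) < k → dig b s 1 ≤ dig b s (4 + 4 * i) → TcpN m b r t s i k)

def CheckN (m b r t : ℕ) : Prop :=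
  (∀ s < Wd m b, rkN m b r s ≠ 0 → ChkR m b r s) ∧ (∀ s < b ^ (2 + 4 * m), dig 2 t s = 1 → ChkT m b r t s)

def RootN (m b t i0 : ℕ) : Prop := ∃ θ < b ^ (2 + 4 * m), dig 2 t θ = 1 ∧ (∀ i < m, dig b θ (3 + 4 * i) = dig b θ 0) ∧
  (∀ i < m, dig b θ (4 + 4 * i) = dig b θ 1) ∧ dig b θ 0 < dig b θ (2 + 4 * i0)

section
variable {α : Type} [Primcodable α] {m b r s s1 c k z l k0 i0 t θ l' k1 i1 k2 i2 : α → ℕ} {d a : α → Bool} {st : Prop}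
instance [PR m] [PR b] [PR c] [PR d] [PR k] : PR (fun x => cell (m x) (b x) (c x) (d x) (k x)) := by
  unfold cell; infer_instance
instance [PR m] [PR b] [PR c] [PR d] [PR a] : PP (fun x => flag (m x) (b x) (c x) (d x) (a x)) := by
  unfold flag; infer_instance
instance [PR m] [PR b] : PR (fun x => Wd (m x) (b x)) := by unfold Wd; infer_instance
instance [PR m] [PR b] [PR r] [PR s] : PR (fun x => rkN (m x) (b x) (r x) (s x)) := by unfold rkN; infer_instance
instance [hm : PR m] [hb : PR b] [hr : PR r] [hs : PR s] [hs1 : PR s1] [hd : PR d] [ha : PR a] :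
    PP (fun x => EvolvesN (m x) (b x) (r x) (s x) (s1 x) (d x) (a x) st) := by
  have := @app1 _ _ _ _ _ hm; have := @app1 _ _ _ _ _ hb; have := @app1 _ _ _ _ _ hr; have := @app1 _ _ _ _ _ hs
  have := @app1 _ _ _ _ _ hs1; have := @app1 _ _ _ _ _ hd; have := @app1 _ _ _ _ _ ha
  unfold EvolvesN; infer_instance
instance [hm : PR m] [hb : PR b] [hr : PR r] [hs : PR s] [hd : PR d] [hc : PR c] [hz : PR z] [hl : PR l] [hk : PR k0]
    [hi : PR i0] : PP (fun x => SplitN (m x) (b x) (r x) (s x) (d x) (c x) (z x) (l x) (k0 x) (i0 x) st) := by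
  have := @app1 _ _ _ _ _ hm; have := @app1 _ _ _ _ _ hb; have := @app1 _ _ _ _ _ hr; have := @app1 _ _ _ _ _ hs
  have := @app1 _ _ _ _ _ hd; have := @app1 _ _ _ _ _ hc; have := @app1 _ _ _ _ _ hz; have := @app1 _ _ _ _ _ hl
  have := @app1 _ _ _ _ _ hk; have := @app1 _ _ _ _ _ hi
  unfold SplitN; infer_instance
instance [hm : PR m] [hb : PR b] [hr : PR r] [ht : PR t] [hs : PR θ] [hc : PR c] [hz : PR z] [hl : PR l] [hl' : PR l'] [hk : PR k1]
    [hi : PR i1] [hk2 : PR k2] [hi2 : PR i2] : PP (fun x => TSplitN (m x) (b x) (r x) (t x) (θ x) (c x) (z x) (l x) (l' x)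
      (k1 x) (i1 x) (k2 x) (i2 x)) := by
  have := @app1 _ _ _ _ _ hm; have := @app1 _ _ _ _ _ hb; have := @app1 _ _ _ _ _ hr; have := @app1 _ _ _ _ _ hs
  have := @app1 _ _ _ _ _ ht; have := @app1 _ _ _ _ _ hc; have := @app1 _ _ _ _ _ hz; have := @app1 _ _ _ _ _ hl
  have := @app1 _ _ _ _ _ hk; have := @app1 _ _ _ _ _ hi; have := @app1 _ _ _ _ _ hk2; have := @app1 _ _ _ _ _ hi2
  have := @app1 _ _ _ _ _ hl'
  unfold TSplitN; infer_instance
instance [hm : PR m] [hb : PR b] [hr : PR r] [hs : PR s] [hd : PR d] [hi : PR i0] [hk : PR k] [hc : PR c] [hz : PR z] [hl : PR l] :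
    PP (fun x => RcfI (m x) (b x) (r x) (s x) (d x) (i0 x) (k x) (c x) (z x) (l x)) := by
  have := @app1 _ _ _ _ _ hm
  have := @app1 _ _ _ _ _ hb
  have := @app1 _ _ _ _ _ hr
  have := @app1 _ _ _ _ _ hs
  have := @app1 _ _ _ _ _ hd
  have := @app1 _ _ _ _ _ hi
  have := @app1 _ _ _ _ _ hk
  have := @app1 _ _ _ _ _ hc
  have := @app1 _ _ _ _ _ hz
  have := @app1 _ _ _ _ _ hl
  unfold RcfI; infer_instance
instance [hm : PR m] [hb : PR b] [hr : PR r] [hs : PR s] [hd : PR d] [hi : PR i0] [hk : PR k] [hc : PR c] [hz : PR z] [hl : PR l] :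
    PP (fun x => RcpI (m x) (b x) (r x) (s x) (d x) (i0 x) (k x) (c x) (z x) (l x)) := by
  have := @app1 _ _ _ _ _ hm
  have := @app1 _ _ _ _ _ hb
  have := @app1 _ _ _ _ _ hr
  have := @app1 _ _ _ _ _ hs
  have := @app1 _ _ _ _ _ hd
  have := @app1 _ _ _ _ _ hi
  have := @app1 _ _ _ _ _ hk
  have := @app1 _ _ _ _ _ hc
  have := @app1 _ _ _ _ _ hz
  have := @app1 _ _ _ _ _ hl
  unfold RcpI; infer_instance
instance [hm : PR m] [hb : PR b] [hr : PR r] [ht : PR t] [hs : PR s] [hi : PR i0] [hk : PR k] [hc : PR c] [hz : PR z] [hl : PR l] [hl' : PR l'] :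
    PP (fun x => TcfI (m x) (b x) (r x) (t x) (s x) (i0 x) (k x) (c x) (z x) (l x) (l' x)) := by
  have := @app1 _ _ _ _ _ hm
  have := @app1 _ _ _ _ _ hb
  have := @app1 _ _ _ _ _ hr
  have := @app1 _ _ _ _ _ ht
  have := @app1 _ _ _ _ _ hs
  have := @app1 _ _ _ _ _ hi
  have := @app1 _ _ _ _ _ hk
  have := @app1 _ _ _ _ _ hc
  have := @app1 _ _ _ _ _ hz
  have := @app1 _ _ _ _ _ hl
  have := @app1 _ _ _ _ _ hl'
  unfold TcfI; infer_instance
instance [hm : PR m] [hb : PR b] [hr : PR r] [ht : PR t] [hs : PR s] [hi : PR i0] [hk : PR k] [hc : PR c] [hz : PR z] [hl : PR l] [hl' : PR l'] :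
    PP (fun x => TcpI (m x) (b x) (r x) (t x) (s x) (i0 x) (k x) (c x) (z x) (l x) (l' x)) := by
  have := @app1 _ _ _ _ _ hm
  have := @app1 _ _ _ _ _ hb
  have := @app1 _ _ _ _ _ hr
  have := @app1 _ _ _ _ _ ht
  have := @app1 _ _ _ _ _ hs
  have := @app1 _ _ _ _ _ hi
  have := @app1 _ _ _ _ _ hk
  have := @app1 _ _ _ _ _ hc
  have := @app1 _ _ _ _ _ hz
  have := @app1 _ _ _ _ _ hl
  have := @app1 _ _ _ _ _ hl'
  unfold TcpI; infer_instance
instance [hm : PR m] [hb : PR b] [hr : PR r] [hs : PR s] [hd : PR d] [hk : PR k] :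
    PP (fun x => RvN (m x) (b x) (r x) (s x) (d x) (k x)) := by
  have := @app1 _ _ _ _ _ hm
  have := @app1 _ _ _ _ _ hb
  have := @app1 _ _ _ _ _ hr
  have := @app1 _ _ _ _ _ hs
  have := @app1 _ _ _ _ _ hd
  have := @app1 _ _ _ _ _ hk
  unfold RvN; infer_instance
instance [hm : PR m] [hb : PR b] [hr : PR r] [hs : PR s] [hd : PR d] [hi : PR i0] [hk : PR k] :
    PP (fun x => RcfN (m x) (b x) (r x) (s x) (d x) (i0 x) (k x)) := by
  have := @app1 _ _ _ _ _ hm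
  have := @app1 _ _ _ _ _ hb
  have := @app1 _ _ _ _ _ hr
  have := @app1 _ _ _ _ _ hs
  have := @app1 _ _ _ _ _ hd
  have := @app1 _ _ _ _ _ hi
  have := @app1 _ _ _ _ _ hk
  unfold RcfN; infer_instance
instance [hm : PR m] [hb : PR b] [hr : PR r] [hs : PR s] [hd : PR d] [hi : PR i0] [hk : PR k] :
    PP (fun x => RcpN (m x) (b x) (r x) (s x) (d x) (i0 x) (k x)) := by
  have := @app1 _ _ _ _ _ hm
  have := @app1 _ _ _ _ _ hb
  have := @app1 _ _ _ _ _ hr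
  have := @app1 _ _ _ _ _ hs
  have := @app1 _ _ _ _ _ hd
  have := @app1 _ _ _ _ _ hi
  have := @app1 _ _ _ _ _ hk
  unfold RcpN; infer_instance
instance [hm : PR m] [hb : PR b] [hr : PR r] [hs : PR s] [hd : PR d] :
    PP (fun x => RrN (m x) (b x) (r x) (s x) (d x)) := by
  have := @app1 _ _ _ _ _ hm
  have := @app1 _ _ _ _ _ hb
  have := @app1 _ _ _ _ _ hr
  have := @app1 _ _ _ _ _ hs
  have := @app1 _ _ _ _ _ hd
  unfold RrN; infer_instance
instance [hm : PR m] [hb : PR b] [hr : PR r] [ht : PR t] [hs : PR s] [hk : PR k] :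
    PP (fun x => TvN (m x) (b x) (r x) (t x) (s x) (k x)) := by
  have := @app1 _ _ _ _ _ hm
  have := @app1 _ _ _ _ _ hb
  have := @app1 _ _ _ _ _ hr
  have := @app1 _ _ _ _ _ ht
  have := @app1 _ _ _ _ _ hs
  have := @app1 _ _ _ _ _ hk
  unfold TvN; infer_instance
instance [hm : PR m] [hb : PR b] [hr : PR r] [ht : PR t] [hs : PR s] [hi : PR i0] [hk : PR k] :
    PP (fun x => TcfN (m x) (b x) (r x) (t x) (s x) (i0 x) (k x)) := by
  have := @app1 _ _ _ _ _ hm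
  have := @app1 _ _ _ _ _ hb
  have := @app1 _ _ _ _ _ hr
  have := @app1 _ _ _ _ _ ht
  have := @app1 _ _ _ _ _ hs
  have := @app1 _ _ _ _ _ hi
  have := @app1 _ _ _ _ _ hk
  unfold TcfN; infer_instance
instance [hm : PR m] [hb : PR b] [hr : PR r] [ht : PR t] [hs : PR s] [hi : PR i0] [hk : PR k] :
    PP (fun x => TcpN (m x) (b x) (r x) (t x) (s x) (i0 x) (k x)) := by
  have := @app1 _ _ _ _ _ hm
  have := @app1 _ _ _ _ _ hb
  have := @app1 _ _ _ _ _ hr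
  have := @app1 _ _ _ _ _ ht
  have := @app1 _ _ _ _ _ hs
  have := @app1 _ _ _ _ _ hi
  have := @app1 _ _ _ _ _ hk
  unfold TcpN; infer_instance
instance [hm : PR m] [hb : PR b] [hr : PR r] [hs : PR s] : PP (fun x => ChkR (m x) (b x) (r x) (s x)) := by
  have := @app1 _ _ _ _ _ hm; have := @app1 _ _ _ _ _ hb; have := @app1 _ _ _ _ _ hr; have := @app1 _ _ _ _ _ hs
  unfold ChkR; infer_instance
instance [hm : PR m] [hb : PR b] [hr : PR r] [ht : PR t] [hs : PR s] : PP (fun x => ChkT (m x) (b x) (r x) (t x) (s x)) := by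
  have := @app1 _ _ _ _ _ hm; have := @app1 _ _ _ _ _ hb; have := @app1 _ _ _ _ _ hr; have := @app1 _ _ _ _ _ hs
  have := @app1 _ _ _ _ _ ht
  unfold ChkT; infer_instance
instance [hm : PR m] [hb : PR b] [hr : PR r] [ht : PR t] : PP (fun x => CheckN (m x) (b x) (r x) (t x)) := by
  have := @app1 _ _ _ _ _ hm; have := @app1 _ _ _ _ _ hb; have := @app1 _ _ _ _ _ hr; have := @app1 _ _ _ _ _ ht
  unfold CheckN; infer_instance
instance [hm : PR m] [hb : PR b] [ht : PR t] [hi : PR i0] : PP (fun x => RootN (m x) (b x) (t x) (i0 x)) := by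
  have := @app1 _ _ _ _ _ hm; have := @app1 _ _ _ _ _ hb; have := @app1 _ _ _ _ _ ht; have := @app1 _ _ _ _ _ hi
  unfold RootN; infer_instance
end

def QN (m b r t : ℕ) : PSys (Fin m) where
  S := {s // s < Wd m b ∧ rkN m b r s ≠ 0}
  T := {s // s < b ^ (2 + 4 * m) ∧ dig 2 t s = 1}
  cfg s a j := cell m b s.1 a (idx j)
  E s := flag m b s.1
  ρ s := rkN m b r s.1
  tcfg s j := dig b s.1 (idx j)

section
variable {m b r t : ℕ}

theorem evolves_iff {s s1 : (QN m b r t).S} {d e : Bool} {st : Prop} :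
    Evolves (TyS m) (QN m b r t) s s1 d e st ↔ EvolvesN m b r s.1 s1.1 d e st := by
  have h1 := sameK_iff (m := m) (C := cell m b s.1) (C' := cell m b s1.1)
  have h2 := filled_iff (m := m) (C := cell m b s.1)
  exact imp_congr h1 (and_congr Iff.rfl (imp_congr Iff.rfl (imp_congr (not_congr h2) Iff.rfl)))

theorem split_iff {s : (QN m b r t).S} {d : Bool} {c z l k0 i0 : ℕ} {st : Prop} :
    Split (TyS m) (QN m b r t) s d (fun a j => cell m b c a (idx j)) z (fun k => dig b l (kdx k)) (fun k i => k = k0 ∧ i.1 = i0) st ↔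
      SplitN m b r s.1 d c z l k0 i0 st := by
  have h1 := line_iff (m := m) (l := cell m b c (!d) 0) (h := cell m b c (!d) 1) (exF := fun i => z ≤ cell m b c d (3 + 4 * i))
    (exP := fun i => cell m b c d (4 + 4 * i) ≤ z) (L := dig b l) (k0 := k0) (i0 := i0)
  have e1 : ∀ s : (QN m b r t).S, (QN m b r t).cfg s = ch1 (fun a (j : J (Fin m)) => cell m b c a (idx j)) d z (fun k => dig b l (kdx k)) ↔
      ∀ a : Bool, ∀ k < 2 + 4 * m, cell m b s.1 a k = ch1N (cell m b c) d z (dig b l) a k := by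
    intro s
    simp only [← forall_J (m := m), ← ch1N_eq]
    exact ⟨fun h a j => congrFun (congrFun h a) j, fun h => funext fun a => funext fun j => h a j⟩
  have e2 : ∀ s : (QN m b r t).S, (QN m b r t).cfg s = ch2 (fun a (j : J (Fin m)) => cell m b c a (idx j)) d z (fun k => dig b l (kdx k)) ↔
      ∀ a : Bool, ∀ k < 2 + 4 * m, cell m b s.1 a k = ch2N (cell m b c) d z (dig b l) a k := by
    intro s
    simp only [← forall_J (m := m), ← ch2N_eq]
    exact ⟨fun h a j => congrFun (congrFun h a) j, fun h => funext fun a => funext fun j => h a j⟩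
  constructor
  · rintro ⟨a1, a2, a3, a4, a5, s1, s2, ⟨a6, a7⟩, a8, a9⟩
    exact ⟨fun a => oeq_iff.1 (a1 a), fun a => forall_J.1 fun j => Nat.even_iff.1 (a2 a j), a3, a4, h1.1 a5, s1.1, s1.2.1,
      s2.1, s2.2.1, s1.2.2, s2.2.2, (e1 s1).1 a6, evolves_iff.1 a7, (e2 s2).1 a8, evolves_iff.1 a9⟩
  · rintro ⟨a1, a2, a3, a4, a5, s1, b1, s2, b2, b3, b4, a6, a7, a8, a9⟩
    exact ⟨fun a => oeq_iff.2 (a1 a), fun a j => Nat.even_iff.2 (a2 a _ (idx_lt j)), a3, a4, h1.2 a5, ⟨s1, b1, b3⟩, ⟨s2, b2, b4⟩,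
      ⟨(e1 ⟨s1, b1, b3⟩).2 a6, evolves_iff.2 a7⟩, (e2 ⟨s2, b2, b4⟩).2 a8, evolves_iff.2 a9⟩

theorem tsplit_iff {s : (QN m b r t).T} {c z l l' k1 i1 k2 i2 : ℕ} :
    TSplit (TyS m) (QN m b r t) s (fun j => dig b c (idx j)) z (fun k => dig b l (kdx k)) (fun k => dig b l' (kdx k))
      (fun k i => k = k1 ∧ i.1 = i1) (fun k i => k = k2 ∧ i.1 = i2) ↔
      TSplitN m b r t s.1 c z l l' k1 i1 k2 i2 := by
  have h1 := line_iff (m := m) (l := dig b c 0) (h := z) (exF := fun i => False)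
    (exP := fun i => dig b c (4 + 4 * i) ≤ z) (L := dig b l) (k0 := k1) (i0 := i1)
  have h2 := line_iff (m := m) (l := z) (h := dig b c 1) (exF := fun i => z ≤ dig b c (3 + 4 * i))
    (exP := fun _ => False) (L := dig b l') (k0 := k2) (i0 := i2)
  have e1 : ∀ s : (QN m b r t).T, (QN m b r t).tcfg s = tri1 (fun (j : J (Fin m)) => dig b c (idx j)) z (fun k => dig b l (kdx k)) ↔
      ∀ k < 2 + 4 * m, dig b s.1 k = tri1N (dig b c) z (dig b l) k := by
    intro s
    rw [← forall_J (m := m)]; simp only [← tri1N_eq]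
    exact ⟨fun h j => congrFun h j, fun h => funext fun j => h j⟩
  have e2 : ∀ s : (QN m b r t).T, (QN m b r t).tcfg s = tri2 (fun (j : J (Fin m)) => dig b c (idx j)) z (fun k => dig b l' (kdx k)) ↔
      ∀ k < 2 + 4 * m, dig b s.1 k = tri2N (dig b c) z (dig b l') k := by
    intro s
    rw [← forall_J (m := m)]; simp only [← tri2N_eq]
    exact ⟨fun h j => congrFun h j, fun h => funext fun j => h j⟩
  have e3 : ∀ s : (QN m b r t).S, (QN m b r t).cfg s = triR (fun (j : J (Fin m)) => dig b c (idx j)) z (fun k => dig b l (kdx k))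
      (fun k => dig b l' (kdx k)) ↔
      ∀ a : Bool, ∀ k < 2 + 4 * m, cell m b s.1 a k = triRN (dig b c) z (dig b l) (dig b l') a k := by
    intro s
    simp only [← forall_J (m := m), ← triRN_eq]
    exact ⟨fun h a j => congrFun (congrFun h a) j, fun h => funext fun a => funext fun j => h a j⟩
  constructor
  · rintro ⟨a1, a2, a3, a4, a5, a6, a7, s1, s2, s3, b1, b2, b3⟩
    exact ⟨oeq_iff.1 a1, forall_J.1 fun j => Nat.even_iff.1 (a2 j), Nat.even_iff.1 a3, a4, a5, h1.1 a6, h2.1 a7, s1.1, s1.2.1,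
      s2.1, s2.2.1, s3.1, s3.2.1, s1.2.2, s2.2.2, s3.2.2, (e1 s1).1 b1, (e2 s2).1 b2, (e3 s3).1 b3⟩
  · rintro ⟨a1, a2, a3, a4, a5, a6, a7, s1, c1, s2, c2, s3, c3, d1, d2, d3, b1, b2, b3⟩
    exact ⟨oeq_iff.2 a1, fun j => Nat.even_iff.2 (a2 _ (idx_lt j)), Nat.even_iff.2 a3, a4, a5, h1.2 a6, h2.2 a7, ⟨s1, c1, d1⟩,
      ⟨s2, c2, d2⟩, ⟨s3, c3, d3⟩, (e1 ⟨s1, c1, d1⟩).2 b1, (e2 ⟨s2, c2, d2⟩).2 b2, (e3 ⟨s3, c3, d3⟩).2 b3⟩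
end
end HP

namespace HP
open J K

section
variable {m b r t : ℕ}

theorem idx_inj : Function.Injective (idx (m := m)) := by
  intro x y h
  cases x <;> cases y <;> simp only [idx] at h <;> first | rfl | (exfalso; omega) | (congr 1; ext; omega)
theorem kdx_inj : Function.Injective (kdx (m := m)) := by
  intro x y h
  cases x <;> cases y <;> simp only [kdx] at h <;> first | rfl | (exfalso; omega) | (congr 1; ext; omega)

theorem enc_code (hb : 2 ≤ b) (C : Bool → J (Fin m) → ℕ) (E : Bool → Bool → Prop) (hC : ∀ a j, C a j < b) :
    ∃ c < Wd m b, (∀ a j, cell m b c a (idx j) = C a j) ∧ ∀ a e, flag m b c a e ↔ E a e := by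
  classical
  let D : Bool → ℕ → ℕ := fun a => Function.extend idx (C a) 0
  have hD : ∀ a j, D a (idx j) = C a j := fun a j => idx_inj.extend_apply _ _ _
  have hDb : ∀ a, ∀ k < 2 + 4 * m, D a k < b := fun a k hk => by
    obtain ⟨j, rfl⟩ := idx_surj hk; rw [hD]; exact hC a j
  let fl : Bool → Bool → ℕ := fun a e => if E a e then 1 else 0
  have hfl : ∀ a e, fl a e < b := fun a e => by simp only [fl]; split_ifs <;> omega
  obtain ⟨c, hc, h⟩ := enc_dig (b := b) (2 * (2 + 4 * m) + 4) (fun k => if k < 2 + 4 * m then D false k else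
    if k < 2 * (2 + 4 * m) then D true (k - (2 + 4 * m)) else if k = 2 * (2 + 4 * m) then fl false false else
    if k = 2 * (2 + 4 * m) + 1 then fl false true else if k = 2 * (2 + 4 * m) + 2 then fl true false else fl true true)
    (fun k hk => by
      split_ifs with h1 h2
      · exact hDb _ _ h1
      · exact hDb _ _ (by omega)
      all_goals exact hfl _ _)
  refine ⟨c, hc, fun a j => ?_, fun a e => ?_⟩
  · have := idx_lt j
    cases a
    · unfold cell
      rw [if_neg (by simp), h _ (by omega), if_pos (by omega), zero_add, hD]
    · unfold cell
      rw [if_pos rfl, h _ (by omega), if_neg (by omega), if_pos (by omega), Nat.add_sub_cancel_left, hD]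
  · have hh : ∀ a e, fl a e ≠ 0 ↔ E a e := fun a e => by simp [fl]
    rw [← hh]
    unfold flag
    cases a <;> cases e <;> simp only [if_true, Bool.false_eq_true, if_false] <;> rw [h _ (by omega)] <;>
      rw [if_neg (by omega), if_neg (by omega)]
    · simp
    · simp
    · simp
    · simp

theorem enc_t (C : J (Fin m) → ℕ) (hC : ∀ j, C j < b) : ∃ c < b ^ (2 + 4 * m), ∀ j, dig b c (idx j) = C j := by
  obtain ⟨c, hc, h⟩ := enc_dig (b := b) (2 + 4 * m) (Function.extend idx C 0) (fun k hk => by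
    obtain ⟨j, rfl⟩ := idx_surj hk; rw [idx_inj.extend_apply]; exact hC j)
  exact ⟨c, hc, fun j => by rw [h _ (idx_lt j), idx_inj.extend_apply]⟩
theorem enc_l (C : K (Fin m) → ℕ) (hC : ∀ j, C j < b) : ∃ c < b ^ (4 * m), ∀ j, dig b c (kdx j) = C j := by
  obtain ⟨c, hc, h⟩ := enc_dig (b := b) (4 * m) (Function.extend kdx C 0) (fun k hk => by
    obtain ⟨j, rfl⟩ := kdx_surj hk; rw [kdx_inj.extend_apply]; exact hC j)
  exact ⟨c, hc, fun j => by rw [h _ (kdx_lt j), kdx_inj.extend_apply]⟩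

theorem noReq_eq : (noReq : ℕ → Fin m → Prop) = fun k i => k = 0 ∧ i.1 = m := by
  funext k i
  have := i.2
  simp only [noReq, eq_iff_iff, false_iff]
  omega
theorem oneReq_eq (k0 : ℕ) (i0 : Fin m) : oneReq k0 i0 = fun k i => k = k0 ∧ i.1 = i0.1 := by
  funext k i
  simp only [oneReq, Fin.ext_iff]

theorem split_enc (hb : 2 ≤ b) {s : (QN m b r t).S} {d C z L k0 i0 st} (hC : ∀ a j, C a j < b)
    (h : Split (TyS m) (QN m b r t) s d C z L (fun k i => k = k0 ∧ i.1 = i0) st) :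
    z < b ∧ ∃ c < Wd m b, ∃ l < b ^ (4 * m), (C = fun a j => cell m b c a (idx j)) ∧ SplitN m b r s.1 d c z l k0 i0 st := by
  obtain ⟨c, hc, h1, -⟩ := enc_code hb C (fun _ _ => False) hC
  obtain ⟨l, hl, h2⟩ := enc_l (b := b) L (fun k => (h.line.cu k).trans_lt (hC _ _))
  have e1 : C = fun a j => cell m b c a (idx j) := by funext a j; exact (h1 a j).symm
  have e2 : L = fun k => dig b l (kdx k) := by funext k; exact (h2 k).symm
  refine ⟨h.zhi.trans (hC _ _), c, hc, l, hl, e1, split_iff.1 ?_⟩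
  rw [← e1, ← e2]; exact h
theorem tsplit_enc {s : (QN m b r t).T} {C z L L' k1 i1 k2 i2} (hC : ∀ j, C j < b)
    (h : TSplit (TyS m) (QN m b r t) s C z L L' (fun k i => k = k1 ∧ i.1 = i1) (fun k i => k = k2 ∧ i.1 = i2)) :
    z < b ∧ ∃ c < b ^ (2 + 4 * m), ∃ l < b ^ (4 * m), ∃ l' < b ^ (4 * m), (C = fun j => dig b c (idx j)) ∧
      TSplitN m b r t s.1 c z l l' k1 i1 k2 i2 := by
  have hz := h.zhi.trans (hC _)
  obtain ⟨c, hc, h1⟩ := enc_t (b := b) C hC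
  obtain ⟨l, hl, h2⟩ := enc_l (b := b) L (fun k => (h.lineh.cu k).trans_lt hz)
  obtain ⟨l', hl', h3⟩ := enc_l (b := b) L' (fun k => (h.linev.cu k).trans_lt (hC _))
  have e1 : C = fun j => dig b c (idx j) := by funext j; exact (h1 j).symm
  have e2 : L = fun k => dig b l (kdx k) := by funext k; exact (h2 k).symm
  have e3 : L' = fun k => dig b l' (kdx k) := by funext k; exact (h3 k).symm
  refine ⟨hz, c, hc, l, hl, l', hl', e1, tsplit_iff.1 ?_⟩
  rw [← e1, ← e2, ← e3]; exact h

theorem check_good (hb : 2 ≤ b) (G : CheckN m b r t) : BGood b (TyS m) (QN m b r t) := by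
  have hc : ∀ s d k, cell m b s d k < b := fun s d k => dig_lt (by omega) _ _
  have hd : ∀ s k, dig b s k < b := fun s k => dig_lt (by omega) _ _
  have G1 : ∀ s : (QN m b r t).S, ChkR m b r s.1 := fun s => G.1 _ s.2.1 s.2.2
  have G2 : ∀ s : (QN m b r t).T, ChkT m b r t s.1 := fun s => G.2 _ s.2.1 s.2.2
  constructor
  · exact fun s a j => hc _ _ _
  · exact fun s j => hd _ _
  · exact fun s a j => Nat.even_iff.2 ((G1 s).1 a _ (idx_lt j))
  · exact fun s j => Nat.even_iff.2 ((G2 s).1 _ (idx_lt j))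
  · exact fun s => cst_iff.2 (G1 s).2.1
  · exact fun s => tcst_iff.2 (G2 s).2.1
  · intro s d k h1 h2
    obtain ⟨c, -, z, -, l, -, h3, h4⟩ := (G1 s).2.2.1 d k (h2.trans (hc _ _ _)) h1 h2
    refine ⟨_, z, fun k => dig b l (kdx k), fun a j => hc c a (idx j), rpos_iff.2 h3, ?_⟩
    rw [noReq_eq]; exact split_iff.2 h4
  · intro s e i k h1 h2 h3 h4
    obtain ⟨c, -, z, -, l, -, k', -, k0, -, h5, h6, h7, h8, h9⟩ :=
      (G1 s).2.2.2.1 e i i.2 k (h2.trans (hc _ _ _)) h1 h2 h3 h4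
    refine ⟨_, z, fun k => dig b l (kdx k), k', k0, fun a j => hc c a (idx j), rpos_iff.2 h5, Nat.even_iff.2 h6, h7, h8, ?_⟩
    rw [oneReq_eq]; exact split_iff.2 h9
  · intro s e i k h1 h2 h3 h4
    obtain ⟨c, -, z, -, l, -, k', hk, k0, -, h5, h6, h7, h8, h9⟩ :=
      (G1 s).2.2.2.2.1 e i i.2 k (h1.trans_lt (hc _ _ _)) h1 h2 h3 h4
    refine ⟨_, z, fun k => dig b l (kdx k), k', k0, fun a j => hc c a (idx j), hk, rpos_iff.2 h5, Nat.even_iff.2 h6, h7, h8, ?_⟩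
    rw [oneReq_eq]; exact split_iff.2 h9
  · intro s h1 h2
    obtain ⟨d, c, -, z, -, l, -, h4⟩ := (G1 s).2.2.2.2.2 (fun h => h1 (filled_iff.2 h)) h2
    refine ⟨d, _, z, fun k => dig b l (kdx k), fun a j => hc c a (idx j), ?_⟩
    rw [noReq_eq]; exact split_iff.2 h4
  · intro s k h1 h2
    obtain ⟨c, -, z, -, l, -, l', -, h3, h4⟩ := (G2 s).2.2.1 k (h2.trans (hd _ _)) h1 h2
    refine ⟨_, z, fun k => dig b l (kdx k), fun k => dig b l' (kdx k), fun j => hd c (idx j), rpos_iff.2 h3, ?_⟩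
    rw [noReq_eq]; exact tsplit_iff.2 h4
  · intro s i k h1 h2 h3
    obtain ⟨c, -, z, -, l, -, l', -, k', -, k0, -, h5, h6, h7, h8, h9, h10⟩ :=
      (G2 s).2.2.2.1 i i.2 k (h2.trans (hd _ _)) h1 h2 h3
    refine ⟨_, z, fun k => dig b l (kdx k), fun k => dig b l' (kdx k), k', k0, fun j => hd c (idx j), rpos_iff.2 h5, Nat.even_iff.2 h6, h7, h8, h9, ?_⟩
    rw [oneReq_eq, noReq_eq]; exact tsplit_iff.2 h10
  · intro s i k h1 h2 h3
    obtain ⟨c, -, z, -, l, -, l', -, k', hk, k0, -, h5, h6, h7, h8, h9, h10⟩ :=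
      (G2 s).2.2.2.2 i i.2 k (h1.trans_lt (hd _ _)) h1 h2 h3
    refine ⟨_, z, fun k => dig b l (kdx k), fun k => dig b l' (kdx k), k', k0, fun j => hd c (idx j), hk, rpos_iff.2 h5, Nat.even_iff.2 h6, h7, h8, h9, ?_⟩
    rw [oneReq_eq, noReq_eq]; exact tsplit_iff.2 h10

theorem good_check (hb : 2 ≤ b) (G : BGood b (TyS m) (QN m b r t)) : CheckN m b r t := by
  refine ⟨fun s hs1 hs2 => ?_, fun s hs1 hs2 => ?_⟩
  · let q : (QN m b r t).S := ⟨s, hs1, hs2⟩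
    refine ⟨fun a => forall_J.1 fun j => Nat.even_iff.1 (G.ev q a j), cst_iff.1 (G.cst q), fun d k _ h1 h2 => ?_,
      fun e i hi k _ h1 h2 h3 h4 => ?_, fun e i hi k _ h1 h2 h3 h4 => ?_, fun h1 h2 => ?_⟩
    · obtain ⟨C, z, L, h3, h4, h5⟩ := G.rv q d k h1 h2
      rw [noReq_eq] at h5
      obtain ⟨hz, c, hc, l, hl, rfl, h6⟩ := split_enc hb h3 h5
      exact ⟨c, hc, z, hz, l, hl, rpos_iff.1 h4, h6⟩
    · obtain ⟨C, z, L, k', k0, h5, h6, h7, h8, h9, h10⟩ := G.rcf q e ⟨i, hi⟩ k h1 h2 h3 h4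
      rw [oneReq_eq] at h10
      have := h9.trans (h5 _ _)
      obtain ⟨hz, c, hc, l, hl, rfl, h11⟩ := split_enc hb h5 h10
      exact ⟨c, hc, z, hz, l, hl, k', by omega, k0, this, rpos_iff.1 h6, Nat.even_iff.1 h7, h8, h9, h11⟩
    · obtain ⟨C, z, L, k', k0, h5, hk, h6, h7, h8, h9, h10⟩ := G.rcp q e ⟨i, hi⟩ k h1 h2 h3 h4
      rw [oneReq_eq] at h10
      obtain ⟨hz, c, hc, l, hl, rfl, h11⟩ := split_enc hb h5 h10
      exact ⟨c, hc, z, hz, l, hl, k', hk, k0, by omega, rpos_iff.1 h6, Nat.even_iff.1 h7, h8, h9, h11⟩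
    · obtain ⟨d, C, z, L, h3, h5⟩ := G.rr q (fun h => h1 (filled_iff.1 h)) h2
      rw [noReq_eq] at h5
      obtain ⟨hz, c, hc, l, hl, rfl, h6⟩ := split_enc hb h3 h5
      exact ⟨d, c, hc, z, hz, l, hl, h6⟩
  · let q : (QN m b r t).T := ⟨s, hs1, hs2⟩
    refine ⟨forall_J.1 fun j => Nat.even_iff.1 (G.tev q j), tcst_iff.1 (G.tcst q), fun k _ h1 h2 => ?_,
      fun i hi k _ h1 h2 h3 => ?_, fun i hi k _ h1 h2 h3 => ?_⟩
    · obtain ⟨C, z, L, L', h3, h4, h5⟩ := G.tv q k h1 h2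
      rw [noReq_eq] at h5
      obtain ⟨hz, c, hc, l, hl, l', hl', rfl, h6⟩ := tsplit_enc h3 h5
      exact ⟨c, hc, z, hz, l, hl, l', hl', rpos_iff.1 h4, h6⟩
    · obtain ⟨C, z, L, L', k', k0, h5, h6, h7, h8, h9, h10, h11⟩ := G.tcf q ⟨i, hi⟩ k h1 h2 h3
      rw [noReq_eq, oneReq_eq] at h11
      have := h10.trans (h5 _)
      obtain ⟨hz, c, hc, l, hl, l', hl', rfl, h12⟩ := tsplit_enc h5 h11
      exact ⟨c, hc, z, hz, l, hl, l', hl', k', by omega, k0, this, rpos_iff.1 h6, Nat.even_iff.1 h7, h8, h9, h10, h12⟩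
    · obtain ⟨C, z, L, L', k', k0, h5, hk, h6, h7, h8, h9, h10, h11⟩ := G.tcp q ⟨i, hi⟩ k h1 h2 h3
      rw [noReq_eq, oneReq_eq] at h11
      obtain ⟨hz, c, hc, l, hl, l', hl', rfl, h12⟩ := tsplit_enc h5 h11
      exact ⟨c, hc, z, hz, l, hl, l', hl', k', hk, k0, by omega, rpos_iff.1 h6, Nat.even_iff.1 h7, h8, h9, h10, h12⟩
end

/-! ### Transfer of systems -/
section
variable {I : Type} {Ty : Set I → Set I → Set I → Prop} {Q Q' : PSys I} {N : ℕ}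

structure Hom (Q' Q : PSys I) where
  f : Q'.S → Q.S
  g : Q'.T → Q.T
  fs : Function.Surjective f
  gs : Function.Surjective g
  cfg : ∀ s, Q.cfg (f s) = Q'.cfg s
  E : ∀ s, Q.E (f s) = Q'.E s
  tcfg : ∀ s, Q.tcfg (g s) = Q'.tcfg s
  rho : ∀ s s', Q.ρ (f s) ≤ Q.ρ (f s') ↔ Q'.ρ s ≤ Q'.ρ s'

theorem Hom.rho' (h : Hom Q' Q) (s s') : Q.ρ (h.f s) < Q.ρ (h.f s') ↔ Q'.ρ s < Q'.ρ s' := by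
  rw [← not_le, ← not_le, h.rho]

theorem Hom.evolves (h : Hom Q' Q) {s s1 d e st} (H : Evolves Ty Q (h.f s) (h.f s1) d e st) : Evolves Ty Q' s s1 d e st := by
  simpa only [Evolves, h.cfg, h.E, h.rho, h.rho'] using H
theorem Hom.split (h : Hom Q' Q) {s d C z L req st} (H : Split Ty Q (h.f s) d C z L req st) : Split Ty Q' s d C z L req st := by
  obtain ⟨h1, h2, h3, h4, h5, s1, s2, ⟨h6, h7⟩, h8, h9⟩ := H
  obtain ⟨s1, rfl⟩ := h.fs s1
  obtain ⟨s2, rfl⟩ := h.fs s2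
  rw [h.cfg] at h6 h8
  simp only [h.cfg] at h1
  exact ⟨h1, h2, h3, h4, h5, s1, s2, ⟨h6, h.evolves h7⟩, h8, h.evolves h9⟩
theorem Hom.tsplit (h : Hom Q' Q) {s C z L L' req req'} (H : TSplit Ty Q (h.g s) C z L L' req req') :
    TSplit Ty Q' s C z L L' req req' := by
  obtain ⟨h1, h2, h3, h4, h5, h6, h7, s1, s2, s3, h8, h9, h10⟩ := H
  obtain ⟨s1, rfl⟩ := h.gs s1
  obtain ⟨s2, rfl⟩ := h.gs s2
  obtain ⟨s3, rfl⟩ := h.fs s3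
  rw [h.tcfg] at h1 h8 h9
  rw [h.cfg] at h10
  exact ⟨h1, h2, h3, h4, h5, h6, h7, s1, s2, s3, h8, h9, h10⟩

theorem Hom.bgood (h : Hom Q' Q) (G : BGood N Ty Q) : BGood N Ty Q' := by
  constructor
  · intro s; rw [← h.cfg]; exact G.bd _
  · intro s; rw [← h.tcfg]; exact G.tbd _
  · intro s; rw [← h.cfg]; exact G.ev _
  · intro s; rw [← h.tcfg]; exact G.tev _
  · intro s; rw [← h.cfg]; exact G.cst _
  · intro s; rw [← h.tcfg]; exact G.tcst _
  · intro s d k; rw [← h.cfg]; intro h1 h2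
    obtain ⟨C, z, L, a1, a2, a3⟩ := G.rv _ d k h1 h2
    exact ⟨C, z, L, a1, a2, h.split a3⟩
  · intro s e i k; rw [← h.cfg]; intro h1 h2 h3 h4
    obtain ⟨C, z, L, k', k0, a1, a2, a3, a4, a5, a6⟩ := G.rcf _ e i k h1 h2 h3 h4
    exact ⟨C, z, L, k', k0, a1, a2, a3, a4, a5, h.split a6⟩
  · intro s e i k; rw [← h.cfg]; intro h1 h2 h3 h4
    obtain ⟨C, z, L, k', k0, a1, a2, a3, a4, a5, a6, a7⟩ := G.rcp _ e i k h1 h2 h3 h4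
    exact ⟨C, z, L, k', k0, a1, a2, a3, a4, a5, a6, h.split a7⟩
  · intro s; rw [← h.cfg, ← h.E]; intro h1 h2
    obtain ⟨d, C, z, L, a1, a3⟩ := G.rr _ h1 h2
    exact ⟨d, C, z, L, a1, h.split a3⟩
  · intro s k; rw [← h.tcfg]; intro h1 h2
    obtain ⟨C, z, L, L', a1, a2, a3⟩ := G.tv _ k h1 h2
    exact ⟨C, z, L, L', a1, a2, h.tsplit a3⟩
  · intro s i k; rw [← h.tcfg]; intro h1 h2 h3
    obtain ⟨C, z, L, L', k', k0, a1, a2, a3, a4, a5, a6, a7⟩ := G.tcf _ i k h1 h2 h3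
    exact ⟨C, z, L, L', k', k0, a1, a2, a3, a4, a5, a6, h.tsplit a7⟩
  · intro s i k; rw [← h.tcfg]; intro h1 h2 h3
    obtain ⟨C, z, L, L', k', k0, a1, a2, a3, a4, a5, a6, a7, a8⟩ := G.tcp _ i k h1 h2 h3
    exact ⟨C, z, L, L', k', k0, a1, a2, a3, a4, a5, a6, a7, h.tsplit a8⟩
end
end HP

namespace HP
open J K
set_option synthInstance.maxSize 100000
set_option synthInstance.maxHeartbeats 400000

section
variable {m b : ℕ}

def decR (m b c : ℕ) : Code (Fin m) := (fun a j => cell m b c a (idx j), flag m b c)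
def decT (m b c : ℕ) : J (Fin m) → ℕ := fun j => dig b c (idx j)

open Classical in
theorem cert (hb : 2 ≤ b) {MR : Set (Code (Fin m))} {MT : Set (J (Fin m) → ℕ)} {ρ : Code (Fin m) → ℕ}
    (G : BGood b (TyS m) (mkQ MR MT ρ)) : ∃ r < (Wd m b + 2) ^ Wd m b, ∃ t < 2 ^ (b ^ (2 + 4 * m)),
      CheckN m b r t ∧ ∀ A ∈ MT, ∃ θ < b ^ (2 + 4 * m), dig 2 t θ = 1 ∧ ∀ j, dig b θ (idx j) = A j := by
  let below : ℕ → Finset ℕ := fun c => (Finset.range (Wd m b)).filter fun c' => decR m b c' ∈ MR ∧ ρ (decR m b c') < ρ (decR m b c)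
  have hcard : ∀ c, (below c).card ≤ Wd m b := fun c => (Finset.card_filter_le _ _).trans (by simp)
  obtain ⟨r, hr, h1⟩ := enc_dig (b := Wd m b + 2) (Wd m b) (fun c => if decR m b c ∈ MR then (below c).card + 1 else 0)
    (fun c _ => by have := hcard c; split_ifs <;> omega)
  obtain ⟨t, ht, h2⟩ := enc_dig (b := 2) (b ^ (2 + 4 * m)) (fun c => if decT m b c ∈ MT then 1 else 0)
    (fun c _ => by split_ifs <;> omega)
  have m1 : ∀ s : (QN m b r t).S, decR m b s.1 ∈ MR := by
    intro s
    by_contra h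
    exact s.2.2 (by rw [rkN, h1 _ s.2.1, if_neg h])
  have m2 : ∀ s : (QN m b r t).T, decT m b s.1 ∈ MT := by
    intro s
    by_contra h
    have := s.2.2
    rw [h2 _ s.2.1, if_neg h] at this
    omega
  have k2 : ∀ A ∈ MT, ∃ θ < b ^ (2 + 4 * m), dig 2 t θ = 1 ∧ ∀ j, dig b θ (idx j) = A j := by
    intro A hA
    obtain ⟨c, hc, h⟩ := enc_t (b := b) A (G.tbd ⟨A, hA⟩)
    have : decT m b c = A := funext h
    exact ⟨c, hc, by rw [h2 _ hc, this, if_pos hA], h⟩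
  have hrk : ∀ s : (QN m b r t).S, (QN m b r t).ρ s = (below s.1).card + 1 := by
    intro s
    show rkN m b r s.1 = _
    rw [rkN, h1 _ s.2.1, if_pos (m1 s)]
  have H : Hom (QN m b r t) (mkQ MR MT ρ) := by
    refine ⟨fun s => ⟨_, m1 s⟩, fun s => ⟨_, m2 s⟩, ?_, ?_, fun s => rfl, fun s => rfl, fun s => rfl, ?_⟩
    · rintro ⟨⟨C, E⟩, hs⟩
      obtain ⟨c, hc, a1, a2⟩ := enc_code hb C E (G.bd ⟨_, hs⟩)
      have e : decR m b c = (C, E) := by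
        refine Prod.ext ?_ ?_
        · funext a j; exact a1 a j
        · funext a j; exact propext (a2 a j)
      refine ⟨⟨c, hc, ?_⟩, Subtype.ext e⟩
      rw [rkN, h1 _ hc, e, if_pos hs]
      omega
    · rintro ⟨A, hA⟩
      obtain ⟨c, hc, h, h'⟩ := k2 A hA
      exact ⟨⟨c, hc, h⟩, Subtype.ext (funext h')⟩
    · intro s s'
      rw [hrk, hrk]
      show ρ (decR m b s.1) ≤ ρ (decR m b s'.1) ↔ _
      constructor
      · intro h
        refine Nat.add_le_add_right (Finset.card_le_card ?_) 1
        intro x hx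
        simp only [below, Finset.mem_filter] at hx ⊢
        exact ⟨hx.1, hx.2.1, hx.2.2.trans_le h⟩
      · contrapose!
        intro h
        refine Nat.add_lt_add_right (Finset.card_lt_card ?_) 1
        rw [Finset.ssubset_iff_of_subset]
        · refine ⟨s'.1, ?_, ?_⟩
          · simp only [below, Finset.mem_filter, Finset.mem_range]
            exact ⟨s'.2.1, m1 s', h⟩
          · simp [below]
        · intro x hx
          simp only [below, Finset.mem_filter] at hx ⊢
          exact ⟨hx.1, hx.2.1, hx.2.2.trans h⟩
  exact ⟨r, hr, t, ht, good_check hb (H.bgood G), k2⟩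

theorem nbig (m : ℕ) : NBig (Fin m) (64 * m + 64) := by
  classical
  intro f g g' x y z
  have : Fintype (J (Fin m)) := Fintype.ofInjective (fun j => (⟨idx j, idx_lt j⟩ : Fin (2 + 4 * m)))
    (fun a b h => idx_inj (Fin.mk.inj_iff.1 h))
  have : Fintype (K (Fin m)) := Fintype.ofInjective (fun j => (⟨kdx j, kdx_lt j⟩ : Fin (4 * m)))
    (fun a b h => kdx_inj (Fin.mk.inj_iff.1 h))
  have cJ : Fintype.card (J (Fin m)) ≤ 2 + 4 * m := by
    have := Fintype.card_le_of_injective (fun j : J (Fin m) => (⟨idx j, idx_lt j⟩ : Fin (2 + 4 * m)))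
      (fun a b h => idx_inj (Fin.mk.inj_iff.1 h))
    simpa using this
  have cK : Fintype.card (K (Fin m)) ≤ 4 * m := by
    have := Fintype.card_le_of_injective (fun j : K (Fin m) => (⟨kdx j, kdx_lt j⟩ : Fin (4 * m)))
      (fun a b h => kdx_inj (Fin.mk.inj_iff.1 h))
    simpa using this
  let F1 : Finset ℝ := Finset.univ.image (f true)
  let F2 : Finset ℝ := Finset.univ.image (f false)
  let F3 : Finset ℝ := Finset.univ.image g
  let F4 : Finset ℝ := Finset.univ.image g'
  have c1 : F1.card ≤ 2 + 4 * m := (Finset.card_image_le).trans (by simpa using cJ)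
  have c2 : F2.card ≤ 2 + 4 * m := (Finset.card_image_le).trans (by simpa using cJ)
  have c3 : F3.card ≤ 4 * m := (Finset.card_image_le).trans (by simpa using cK)
  have c4 : F4.card ≤ 4 * m := (Finset.card_image_le).trans (by simpa using cK)
  have c5 : ({x, y, z} : Finset ℝ).card ≤ 3 := Finset.card_le_three
  refine ⟨F1 ∪ F2 ∪ (F3 ∪ F4) ∪ {x, y, z}, ?_, ?_, ?_, ?_, ?_, ?_, ?_⟩
  · intro a j; cases a <;> simp [F1, F2]
  · intro k; simp [F3]
  · intro k; simp [F4]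
  · simp
  · simp
  · simp
  · have d1 := Finset.card_union_le (F1 ∪ F2 ∪ (F3 ∪ F4)) {x, y, z}
    have d2 := Finset.card_union_le (F1 ∪ F2) (F3 ∪ F4)
    have d3 := Finset.card_union_le F1 F2
    have d4 := Finset.card_union_le F3 F4
    omega

def AccN (m i0 : ℕ) : Prop := ∃ r < (Wd m (64 * m + 64) + 2) ^ Wd m (64 * m + 64), ∃ t < 2 ^ ((64 * m + 64) ^ (2 + 4 * m)),
  CheckN m (64 * m + 64) r t ∧ RootN m (64 * m + 64) t i0

theorem acc_of_mod {τ : (Bool → ℝ) → Set (Fin m)} (M : Mod τ (TyS m)) {i0 : Fin m} {q} (hq : i0 ∈ τ q) : AccN m i0.1 := by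
  obtain ⟨A, hA, h1, h2, h3⟩ := broot M (nbig m) hq
  obtain ⟨r, hr, t, ht, hc, hk⟩ := cert (by omega) (bsys M (nbig m))
  obtain ⟨θ, hθ, ht', hj⟩ := hk A hA
  refine ⟨r, hr, t, ht, hc, θ, hθ, ht', fun i hi => ?_, fun i hi => ?_, ?_⟩
  · exact (hj (ff ⟨i, hi⟩)).trans ((h1 _).trans (hj lo).symm)
  · exact (hj (np ⟨i, hi⟩)).trans ((h2 _).trans (hj J.hi).symm)
  · have a := hj (nf i0)
    have b := hj lo
    simp only [idx] at a b
    rw [a, b]; exact h3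

theorem mod_of_acc {i0 : Fin m} (h : AccN m i0.1) : ∃ (τ : (Bool → ℝ) → Set (Fin m)) (l u : ℝ), l < u ∧
    (∀ p i, i ∈ τ p → l < p false ∧ p false < p true ∧ p true < u) ∧
    (∀ p, l < p false → p false < p true → p true < u → TyS m (Fo τ p) (Po τ p) (τ p)) ∧ ∃ q, i0 ∈ τ q := by
  obtain ⟨r, hr, t, ht, hc, θ, hθ, ht', h1, h2, h3⟩ := h
  have G := (check_good (by omega) hc).good
  exact sys_model G ⟨θ, hθ, ht'⟩ (fun i => h1 i i.2) (fun i => h2 i i.2) i0 h3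

instance {α : Type} [Primcodable α] {m i0 : α → ℕ} [hm : PR m] [hi : PR i0] : PP (fun x => AccN (m x) (i0 x)) := by
  have := @app1 _ _ _ _ _ hm; have := @app1 _ _ _ _ _ hi
  unfold AccN; infer_instance
end
end HP

namespace HP

theorem lt_pair {c x : ℕ} (h : 0 < c) : x < Nat.pair c x := by
  have : c + x ≤ Nat.pair c x := Nat.add_le_pair c x
  omega

def dec (n : ℕ) : Formula :=
  if _h1 : (Nat.unpair n).1 = 1 then .neg (dec (Nat.unpair n).2) else
  if _h2 : (Nat.unpair n).1 = 2 then .or (dec (Nat.unpair (Nat.unpair n).2).1) (dec (Nat.unpair (Nat.unpair n).2).2) else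
  if _h3 : (Nat.unpair n).1 = 3 then .F (dec (Nat.unpair n).2) else
  if _h4 : (Nat.unpair n).1 = 4 then .P (dec (Nat.unpair n).2) else .var (Nat.unpair n).2
termination_by n
decreasing_by
  all_goals
    have h0 := Nat.pair_unpair n
    have h5 := Nat.add_le_pair (Nat.unpair n).1 (Nat.unpair n).2
    have h6 := Nat.unpair_left_le (Nat.unpair n).2
    have h7 := Nat.unpair_right_le (Nat.unpair n).2
    omega

theorem dec1 (j : ℕ) : dec (Nat.pair 1 j) = .neg (dec j) := by rw [dec]; simp
theorem dec2 (j k : ℕ) : dec (Nat.pair 2 (Nat.pair j k)) = .or (dec j) (dec k) := by rw [dec]; simp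
theorem dec3 (j : ℕ) : dec (Nat.pair 3 j) = .F (dec j) := by rw [dec]; simp
theorem dec4 (j : ℕ) : dec (Nat.pair 4 j) = .P (dec j) := by rw [dec]; simp
theorem dec_enc (φ : Formula) : dec φ.enc = φ := by
  induction φ with
  | var n => rw [Formula.enc, dec]; simp
  | neg φ ih => rw [Formula.enc, dec1, ih]
  | or φ ψ ih1 ih2 => rw [Formula.enc, dec2, ih1, ih2]
  | F φ ih => rw [Formula.enc, dec3, ih]
  | P φ ih => rw [Formula.enc, dec4, ih]

theorem exists_scale {l u : ℝ} (h : l < u) : ∃ f : ℝ → ℝ, StrictMono f ∧ ∀ y, (∃ x, f x = y) ↔ l < y ∧ y < u := by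
  let e := orderIsoIooNegOneOne ℝ
  refine ⟨fun x => l + (u - l) * (((e x : ℝ) + 1) / 2), fun x y hxy => ?_, fun y => ⟨?_, ?_⟩⟩
  · have : (e x : ℝ) < e y := e.strictMono hxy
    have h' : 0 < u - l := by linarith
    have := mul_lt_mul_of_pos_left (show ((e x : ℝ) + 1) / 2 < ((e y : ℝ) + 1) / 2 by linarith) h'
    simpa using this
  · rintro ⟨x, rfl⟩
    have h1 : -1 < (e x : ℝ) := (e x).2.1
    have h2 : (e x : ℝ) < 1 := (e x).2.2
    constructor <;> nlinarith
  · rintro ⟨h1, h2⟩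
    have h' : 0 < u - l := by linarith
    refine ⟨e.symm ⟨2 * ((y - l) / (u - l)) - 1, ?_, ?_⟩, ?_⟩
    · have : 0 < (y - l) / (u - l) := by apply div_pos <;> linarith
      linarith
    · have : (y - l) / (u - l) < 1 := by rw [div_lt_one h']; linarith
      linarith
    · simp only [OrderIso.apply_symm_apply]
      field_simp
      ring

def pt (f : ℝ → ℝ) (w : HalfPlane) : Bool → ℝ := fun a => if a then f w.1.2 else f w.1.1

theorem pt_lt {f : ℝ → ℝ} (hf : StrictMono f) (w w' : HalfPlane) : (∀ a, pt f w a < pt f w' a) ↔ slt w.1 w'.1 := by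
  constructor
  · exact fun h => ⟨hf.lt_iff_lt.1 (h false), hf.lt_iff_lt.1 (h true)⟩
  · rintro ⟨h1, h2⟩ a
    cases a
    · exact hf h1
    · exact hf h2
theorem pt_inj {f : ℝ → ℝ} (hf : StrictMono f) {w w' : HalfPlane} (h : pt f w = pt f w') : w = w' :=
  Subtype.ext (Prod.ext (hf.injective (congrFun h false)) (hf.injective (congrFun h true)))
theorem pt_surj {f : ℝ → ℝ} (hf : StrictMono f) {l u : ℝ} (h : ∀ y, (∃ x, f x = y) ↔ l < y ∧ y < u) {p : Bool → ℝ}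
    (h1 : l < p false) (h2 : p false < p true) (h3 : p true < u) : ∃ w, pt f w = p := by
  obtain ⟨x, hx⟩ := (h _).2 ⟨h1, h2.trans h3⟩
  obtain ⟨y, hy⟩ := (h _).2 ⟨h1.trans h2, h3⟩
  refine ⟨⟨(x, y), hf.lt_iff_lt.1 (by rw [hx, hy]; exact h2)⟩, ?_⟩
  funext a
  cases a
  · exact hx
  · exact hy
theorem pt_mem {f : ℝ → ℝ} (hf : StrictMono f) {l u : ℝ} (h : ∀ y, (∃ x, f x = y) ↔ l < y ∧ y < u) (w : HalfPlane) :
    l < pt f w false ∧ pt f w false < pt f w true ∧ pt f w true < u :=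
  ⟨((h _).1 ⟨_, rfl⟩).1, hf w.2, ((h _).1 ⟨_, rfl⟩).2⟩

theorem sat_F {v : ℕ → Set HalfPlane} {w : HalfPlane} {φ : Formula} :
    Sat sltHRefl v w (.F φ) ↔ Sat sltHRefl v w φ ∨ ∃ u, slt w.1 u.1 ∧ Sat sltHRefl v u φ := by
  constructor
  · rintro ⟨u, rfl | h, hs⟩
    · exact Or.inl hs
    · exact Or.inr ⟨u, h, hs⟩
  · rintro (h | ⟨u, h, hs⟩)
    · exact ⟨w, Or.inl rfl, h⟩
    · exact ⟨u, Or.inr h, hs⟩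
theorem sat_P {v : ℕ → Set HalfPlane} {w : HalfPlane} {φ : Formula} :
    Sat sltHRefl v w (.P φ) ↔ Sat sltHRefl v w φ ∨ ∃ u, slt u.1 w.1 ∧ Sat sltHRefl v u φ := by
  constructor
  · rintro ⟨u, rfl | h, hs⟩
    · exact Or.inl hs
    · exact Or.inr ⟨u, h, hs⟩
  · rintro (h | ⟨u, h, hs⟩)
    · exact ⟨w, Or.inl rfl, h⟩
    · exact ⟨u, Or.inr h, hs⟩

theorem mod_of_sat {v : ℕ → Set HalfPlane} {w : HalfPlane} {φ : Formula} (h : Sat sltHRefl v w φ) {m : ℕ} (hm : φ.enc < m) :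
    ∃ τ : (Bool → ℝ) → Set (Fin m), Mod τ (TyS m) ∧ ∃ q, (⟨φ.enc, hm⟩ : Fin m) ∈ τ q := by
  obtain ⟨f, hf, hr⟩ := exists_scale (zero_lt_one (α := ℝ))
  let τ : (Bool → ℝ) → Set (Fin m) := fun p => {i | ∃ w, pt f w = p ∧ Sat sltHRefl v w (dec i.1)}
  have ht : ∀ w i, i < m → (extS (τ (pt f w)) i ↔ Sat sltHRefl v w (dec i)) := by
    intro w i hi
    constructor
    · rintro ⟨_, w', h1, h2⟩
      rw [pt_inj hf h1] at h2; exact h2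
    · intro h
      exact ⟨hi, w, rfl, h⟩
  have hF : ∀ w i, i < m → (extS (Fo τ (pt f w)) i ↔ ∃ u, slt w.1 u.1 ∧ Sat sltHRefl v u (dec i)) := by
    intro w i hi
    constructor
    · rintro ⟨_, q, h1, w', rfl, h2⟩
      exact ⟨w', (pt_lt hf _ _).1 h1, h2⟩
    · rintro ⟨u, h1, h2⟩
      exact ⟨hi, pt f u, (pt_lt hf _ _).2 h1, u, rfl, h2⟩
  have hP : ∀ w i, i < m → (extS (Po τ (pt f w)) i ↔ ∃ u, slt u.1 w.1 ∧ Sat sltHRefl v u (dec i)) := by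
    intro w i hi
    constructor
    · rintro ⟨_, q, h1, w', rfl, h2⟩
      exact ⟨w', (pt_lt hf _ _).1 h1, h2⟩
    · rintro ⟨u, h1, h2⟩
      exact ⟨hi, pt f u, (pt_lt hf _ _).2 h1, u, rfl, h2⟩
  refine ⟨τ, ⟨?_, ?_⟩, pt f w, w, rfl, ?_⟩
  · rintro p i ⟨w, rfl, -⟩
    exact pt_mem hf hr w
  · intro p h1 h2 h3
    obtain ⟨w, rfl⟩ := pt_surj hf hr h1 h2 h3
    intro j hj
    refine ⟨fun k hk hp => ?_, fun hp => ?_, fun hp => ?_, fun hp => ?_⟩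
    · rw [ht _ _ hp, ht _ _ hj, ht _ _ hk, dec2]; rfl
    · rw [ht _ _ hp, ht _ _ hj, dec1]; rfl
    · rw [ht _ _ hp, ht _ _ hj, hF _ _ hj, dec3, sat_F]
    · rw [ht _ _ hp, ht _ _ hj, hP _ _ hj, dec4, sat_P]
  · simpa only [dec_enc] using h

theorem sat_of_mod {m : ℕ} {τ : (Bool → ℝ) → Set (Fin m)} {l u : ℝ} (hlu : l < u)
    (hs : ∀ p i, i ∈ τ p → l < p false ∧ p false < p true ∧ p true < u)
    (hty : ∀ p, l < p false → p false < p true → p true < u → TyS m (Fo τ p) (Po τ p) (τ p)) :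
    ∃ v : ℕ → Set HalfPlane, ∀ q, (∃ i, i ∈ τ q) → ∃ w, ∀ φ : Formula, φ.enc < m → (Sat sltHRefl v w φ ↔ extS (τ q) φ.enc) := by
  obtain ⟨f, hf, hr⟩ := exists_scale hlu
  let v : ℕ → Set HalfPlane := fun n => {w | extS (τ (pt f w)) (Nat.pair 0 n)}
  have key : ∀ φ : Formula, φ.enc < m → ∀ w, Sat sltHRefl v w φ ↔ extS (τ (pt f w)) φ.enc := by
    intro φ
    induction φ with
    | var n => intro _ w; exact Iff.rfl
    | neg φ ih =>
      intro h w
      have h' : φ.enc < m := (lt_pair one_pos).trans h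
      have T := (hty (pt f w) (pt_mem hf hr w).1 (pt_mem hf hr w).2.1 (pt_mem hf hr w).2.2 φ.enc h').2.1 h
      exact (not_congr (ih h' w)).trans T.symm
    | or φ ψ ih1 ih2 =>
      intro h w
      have h0 : Nat.pair φ.enc ψ.enc < m := (lt_pair two_pos).trans h
      have h1 : φ.enc < m := (Nat.left_le_pair _ _).trans_lt h0
      have h2 : ψ.enc < m := (Nat.right_le_pair _ _).trans_lt h0
      have T := (hty (pt f w) (pt_mem hf hr w).1 (pt_mem hf hr w).2.1 (pt_mem hf hr w).2.2 φ.enc h1).1 _ h2 h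
      exact (or_congr (ih1 h1 w) (ih2 h2 w)).trans T.symm
    | F φ ih =>
      intro h w
      have h' : φ.enc < m := (lt_pair (by norm_num)).trans h
      have T := (hty (pt f w) (pt_mem hf hr w).1 (pt_mem hf hr w).2.1 (pt_mem hf hr w).2.2 φ.enc h').2.2.1 h
      rw [sat_F]
      refine (or_congr (ih h' w) ?_).trans T.symm
      constructor
      · rintro ⟨u, h1, h2⟩
        obtain ⟨a, b⟩ := (ih h' u).1 h2
        exact ⟨a, pt f u, (pt_lt hf _ _).2 h1, b⟩
      · rintro ⟨a, q, h1, h2⟩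
        obtain ⟨b1, b2, b3⟩ := hs _ _ h2
        obtain ⟨u, rfl⟩ := pt_surj hf hr b1 b2 b3
        exact ⟨u, (pt_lt hf _ _).1 h1, (ih h' u).2 ⟨a, h2⟩⟩
    | P φ ih =>
      intro h w
      have h' : φ.enc < m := (lt_pair (by norm_num)).trans h
      have T := (hty (pt f w) (pt_mem hf hr w).1 (pt_mem hf hr w).2.1 (pt_mem hf hr w).2.2 φ.enc h').2.2.2 h
      rw [sat_P]
      refine (or_congr (ih h' w) ?_).trans T.symm
      constructor
      · rintro ⟨u, h1, h2⟩
        obtain ⟨a, b⟩ := (ih h' u).1 h2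
        exact ⟨a, pt f u, (pt_lt hf _ _).2 h1, b⟩
      · rintro ⟨a, q, h1, h2⟩
        obtain ⟨b1, b2, b3⟩ := hs _ _ h2
        obtain ⟨u, rfl⟩ := pt_surj hf hr b1 b2 b3
        exact ⟨u, (pt_lt hf _ _).1 h1, (ih h' u).2 ⟨a, h2⟩⟩
  refine ⟨v, ?_⟩
  rintro q ⟨i, hi⟩
  obtain ⟨b1, b2, b3⟩ := hs _ _ hi
  obtain ⟨w, rfl⟩ := pt_surj hf hr b1 b2 b3
  exact ⟨w, fun φ h => key φ h w⟩

theorem acc_iff (φ : Formula) : AccN (Nat.pair 1 φ.enc + 1) (Nat.pair 1 φ.enc) ↔ ¬ Valid sltHRefl φ := by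
  have hm : (Formula.neg φ).enc < Nat.pair 1 φ.enc + 1 := Nat.lt_succ_self _
  constructor
  · intro h hv
    obtain ⟨τ, l, u, h1, h2, h3, q, h4⟩ := mod_of_acc (i0 := ⟨_, hm⟩) h
    obtain ⟨v, h5⟩ := sat_of_mod h1 h2 h3
    obtain ⟨w, h6⟩ := h5 q ⟨_, h4⟩
    exact (h6 (.neg φ) hm).2 ⟨hm, h4⟩ (hv v w)
  · intro h
    unfold Valid at h
    push Not at h
    obtain ⟨v, w, h⟩ := h
    obtain ⟨τ, M, q, hq⟩ := mod_of_sat (φ := .neg φ) h hm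
    exact acc_of_mod M hq

theorem accPP : PP (fun n : ℕ => ¬ AccN (Nat.pair 1 n + 1) (Nat.pair 1 n)) := by
  have h1 : PR (fun n : ℕ => Nat.pair 1 n) := ⟨Primrec₂.natPair.comp (.const 1) .id⟩
  have h2 : PR (fun n : ℕ => Nat.pair 1 n + 1) := ⟨Primrec.succ.comp h1.h⟩
  have h3 : PP (fun n : ℕ => AccN (Nat.pair 1 n + 1) (Nat.pair 1 n)) := inferInstance
  exact ⟨h3.h.not⟩

end HP

/-- The set of validities of the basic temporal language over `(H_<, ⪯)` is decidable:
there is a computable total function (on codes of formulas) returning `true`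
exactly on the valid formulas. -/
theorem validity_decidable_halfplane_sltRefl :
    ∃ f : ℕ → Bool, Computable f ∧
      ∀ φ : Formula, (f φ.enc = true ↔ Valid sltHRefl φ) := by
  obtain ⟨_, h⟩ := HP.accPP.h
  refine ⟨_, h.to_comp, fun φ => ?_⟩
  rw [decide_eq_true_iff]
  beta_reduce
  rw [HP.acc_iff, not_not]
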